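/- Let (Ω, 𝓕, ℙ) be a probability space and θ : Ω → Ω a measurable bijection with measurable inverse such that θ preserves ℙ. Fix integers d ≥ 1, p ≥ 2, a direct-sum decomposition ℝ^d = X_1 ⊕ ⋯ ⊕ X_p into nonzero linear subspaces, real numbers λ_1 > ⋯ > λ_τ > 0 > λ_{τ+1} > ⋯ > λ_p with 1 ≤ τ ≤ p−1 satisfying the non-resonance condition λ_j ≠ λ_i + λ_κ for all i ∈ {1,…,τ}, κ ∈ {τ+1,…,p}, j ∈ {1,…,p}, and a real α ∈ [0,1]. Let ρ : Ω → (0,∞) be measurable and tempered from below. Let F : Ω × ℝ^d → ℝ^d be such that for every ω ∈ Ω: the restriction of F(ω,·) to the open ball B(0,ρ(ω)) is a C² diffeomorphism onto its image with F(ω,0) = 0; ω ↦ F(ω,x), ω ↦ DF(ω,x) and ω ↦ D²F(ω,x) are measurable; and there are measurable functions M, L : Ω → (0,∞), tempered from above, with ‖F(ω,x)‖ ≤ M(ω), ‖DF(ω,x)‖ ≤ M(ω), ‖D²F(ω,x)‖ ≤ M(ω) and ‖D²F(ω,x) − D²F(ω,y)‖ ≤ L(ω)‖x − y‖^α for all x,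 y ∈ B(0,ρ(ω)). In case α = 0, assume additionally that for every ω and every ε > 0 the family of maps x ↦ e^{−ε|n|}·D²F(θⁿω, x), indexed by n ∈ ℤ and defined on B(0,ρ(θⁿω)), is uniformly equicontinuous. Set Λ(ω) := DF(ω,0), assume each Λ(ω) is invertible with Λ(ω)X_j = X_j for every j, and let Λ(n,ω) be the linear cocycle generated by Λ over θ. Assume that for every ε > 0 there is a measurable K_ε : Ω → [1,∞), tempered from above, such that for every ω and every j ∈ {1,…,p}: ‖Λ(n,ω)|_{X_j}‖ ≤ K_ε(ω)e^{(λ_j−ε)n} for all n < 0, and ‖Λ(n,ω)|_{X_j}‖ ≤ K_ε(ω)e^{(λ_j+ε)n} for all n ≥ 0. Then there exist: a real β with β = 0 when α = 0 and β ∈ (0,α] when α > 0; a measurable ρ_U : Ω → (0,∞), tempered from below, with ρ_U(ω) ≤ ρ(ω) for all ω; and a map Φ : Ω × ℝ^d → ℝ^d with ω ↦ Φ(ω,x) and ω ↦ DΦ(ω,x) measurable, such that for every ω ∈ Ω: the restriction of Φ(ω,·) to B(0,ρ_U(ω)) is a C¹ diffeomorphism onto its image whose derivative, together with the derivative of its inverse,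 is β-Hölder continuous when α > 0; Φ(ω,0) = 0; DΦ(ω,0) = id; and Φ(θω, F(ω,x)) = Λ(ω)(Φ(ω,x)) for every x ∈ B(0,ρ_U(ω)). -/

import Mathlib

open Metric Set Filter

abbrev Ed (d : ℕ) := EuclideanSpace ℝ (Fin d)

/-- `K` is tempered from above along the ℤ-iterates `θiter` of the base system:
lim_{n→±∞} (1/n)·max{0, log K(θⁿω)} = 0 for every ω. -/
def TemperedAbove {Ω : Type*} (θiter : ℤ → Ω → Ω) (K : Ω → ℝ) : Prop :=
  ∀ ω : Ω,
    Tendsto (fun n : ℤ => ((n : ℝ))⁻¹ * max 0 (Real.log (K (θiter n ω)))) atTop (nhds 0) ∧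
    Tendsto (fun n : ℤ => ((n : ℝ))⁻¹ * max 0 (Real.log (K (θiter n ω)))) atBot (nhds 0)

/-- `K` is tempered from below along the ℤ-iterates `θiter` of the base system:
lim_{n→±∞} (1/n)·min{0, log K(θⁿω)} = 0 for every ω. -/
def TemperedBelow {Ω : Type*} (θiter : ℤ → Ω → Ω) (K : Ω → ℝ) : Prop :=
  ∀ ω : Ω,
    Tendsto (fun n : ℤ => ((n : ℝ))⁻¹ * min 0 (Real.log (K (θiter n ω)))) atTop (nhds 0) ∧
    Tendsto (fun n : ℤ => ((n : ℝ))⁻¹ * min 0 (Real.log (K (θiter n ω)))) atBot (nhds 0)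

set_option linter.unusedSectionVars false
set_option linter.unusedVariables false
set_option linter.unusedSimpArgs false
set_option linter.deprecated false



namespace RB
section calc1
variable {p : ℕ} {V : Fin p → Type} [∀ b, NormedAddCommGroup (V b)] [∀ b, NormedSpace ℝ (V b)]
  {F F' : Type*} [NormedAddCommGroup F] [NormedSpace ℝ F] [NormedAddCommGroup F'] [NormedSpace ℝ F']

/-- weighted `ℓ¹` seminorm -/
noncomputable def nm (w : Fin p → ℝ) (v : ∀ b, V b) : ℝ := ∑ b, w b * ‖v b‖

theorem nm_nonneg {w : Fin p → ℝ} (hw : ∀ b, 0 ≤ w b) (v : ∀ b, V b) : 0 ≤ nm w v :=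
  Finset.sum_nonneg fun b _ => mul_nonneg (hw b) (norm_nonneg _)

theorem nm_mono {w w' : Fin p → ℝ} (h : ∀ b, w b ≤ w' b) (v : ∀ b, V b) : nm w v ≤ nm w' v :=
  Finset.sum_le_sum fun b _ => mul_le_mul_of_nonneg_right (h b) (norm_nonneg _)

theorem nm_smul (c : ℝ) (w : Fin p → ℝ) (v : ∀ b, V b) : nm (fun b => c * w b) v = c * nm w v := by
  unfold nm; rw [Finset.mul_sum]; exact Finset.sum_congr rfl fun b _ => by ring

/-- operator-valued function bounded by a weight -/
def OB1 (w : (∀ b, V b) → (∀ b, V b) → Fin p → ℝ) (c : ℝ) (D : Set (∀ b, V b))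
    (A : (∀ b, V b) → (∀ b, V b) →L[ℝ] F) : Prop :=
  ∀ x ∈ D, ∀ v, ‖A x v‖ ≤ c * nm (w x x) v

def OB2 (w : (∀ b, V b) → (∀ b, V b) → Fin p → ℝ) (β c : ℝ) (D : Set (∀ b, V b))
    (A : (∀ b, V b) → (∀ b, V b) →L[ℝ] F) : Prop :=
  ∀ x ∈ D, ∀ y ∈ D, ∀ v, ‖A x v - A y v‖ ≤ c * ‖x - y‖ ^ β * nm (w x y) v

structure WM (w : (∀ b, V b) → (∀ b, V b) → Fin p → ℝ) : Prop where
  nn : ∀ x y b, 0 ≤ w x y b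
  ml : ∀ x y b, w x x b ≤ w x y b
  mr : ∀ x y b, w y y b ≤ w x y b

variable {w w' : (∀ b, V b) → (∀ b, V b) → Fin p → ℝ} {β c c' : ℝ} {D : Set (∀ b, V b)}
  {A A' : (∀ b, V b) → (∀ b, V b) →L[ℝ] F}

theorem OB1.mono (h : OB1 w c D A) (hw : WM w) (hc : c ≤ c') : OB1 w c' D A := fun x hx v =>
  (h x hx v).trans (mul_le_mul_of_nonneg_right hc (nm_nonneg (hw.nn x x) v))

theorem OB2.mono (h : OB2 w β c D A) (hw : WM w) (hc : c ≤ c') : OB2 w β c' D A :=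
  fun x hx y hy v => (h x hx y hy v).trans (mul_le_mul_of_nonneg_right
    (mul_le_mul_of_nonneg_right hc (by positivity)) (nm_nonneg (hw.nn x y) v))

theorem OB1.wmono (h : OB1 w c D A) (hc : 0 ≤ c) (hw : ∀ x ∈ D, ∀ y ∈ D, ∀ b, w x y b ≤ w' x y b) :
    OB1 w' c D A := fun x hx v =>
  (h x hx v).trans (mul_le_mul_of_nonneg_left (nm_mono (hw x hx x hx) v) hc)

theorem OB2.wmono (h : OB2 w β c D A) (hc : 0 ≤ c)
    (hw : ∀ x ∈ D, ∀ y ∈ D, ∀ b, w x y b ≤ w' x y b) :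
    OB2 w' β c D A := fun x hx y hy v =>
  (h x hx y hy v).trans (mul_le_mul_of_nonneg_left (nm_mono (hw x hx y hy) v) (by positivity))

theorem OB1.add (h : OB1 w c D A) (h' : OB1 w c' D A') : OB1 w (c + c') D (fun x => A x + A' x) := by
  intro x hx v
  have := norm_add_le (A x v) (A' x v)
  have h1 := h x hx v
  have h2 := h' x hx v
  simp only [ContinuousLinearMap.add_apply]
  linarith

theorem OB1.sub (h : OB1 w c D A) (h' : OB1 w c' D A') : OB1 w (c + c') D (fun x => A x - A' x) := by
  intro x hx v
  have := norm_sub_le (A x v) (A' x v)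
  have h1 := h x hx v
  have h2 := h' x hx v
  simp only [ContinuousLinearMap.sub_apply]
  linarith

theorem OB2.add (h : OB2 w β c D A) (h' : OB2 w β c' D A') :
    OB2 w β (c + c') D (fun x => A x + A' x) := by
  intro x hx y hy v
  have := norm_add_le (A x v - A y v) (A' x v - A' y v)
  have h1 := h x hx y hy v
  have h2 := h' x hx y hy v
  simp only [ContinuousLinearMap.add_apply]
  rw [add_sub_add_comm]
  linarith

theorem OB2.sub (h : OB2 w β c D A) (h' : OB2 w β c' D A') :
    OB2 w β (c + c') D (fun x => A x - A' x) := by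
  intro x hx y hy v
  have := norm_sub_le (A x v - A y v) (A' x v - A' y v)
  have h1 := h x hx y hy v
  have h2 := h' x hx y hy v
  simp only [ContinuousLinearMap.sub_apply]
  rw [sub_sub_sub_comm]
  linarith

/-- product rule, first order -/
theorem OB1.prod {U : (∀ b, V b) → F →L[ℝ] F'} {a C : ℝ} {φ : (∀ b, V b) → ℝ}
    (hU : ∀ x ∈ D, ‖U x‖ ≤ a * φ x) (ha : 0 ≤ a) (hφ : ∀ x, 0 ≤ φ x) (hA : OB1 w c D A)
    (hc : 0 ≤ c) (hw : ∀ x ∈ D, ∀ b, φ x * w x x b ≤ C * w' x x b) :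
    OB1 w' (a * c * C) D (fun x => (U x).comp (A x)) := by
  intro x hx v
  simp only [ContinuousLinearMap.comp_apply]
  calc ‖U x (A x v)‖ ≤ ‖U x‖ * ‖A x v‖ := (U x).le_opNorm _
    _ ≤ (a * φ x) * (c * nm (w x x) v) :=
        mul_le_mul (hU x hx) (hA x hx v) (norm_nonneg _) (mul_nonneg ha (hφ x))
    _ = a * c * nm (fun b => φ x * w x x b) v := by rw [nm_smul]; ring
    _ ≤ a * c * nm (fun b => C * w' x x b) v :=
        mul_le_mul_of_nonneg_left (nm_mono (hw x hx) v) (mul_nonneg ha hc)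
    _ = _ := by rw [nm_smul]; ring

/-- product rule, Hölder part -/
theorem OB2.prod {U : (∀ b, V b) → F →L[ℝ] F'} {a C : ℝ} {φ : (∀ b, V b) → (∀ b, V b) → ℝ}
    (hU : ∀ x ∈ D, ∀ y ∈ D, ‖U y‖ ≤ a * φ x y)
    (hU2 : ∀ x ∈ D, ∀ y ∈ D, ‖U x - U y‖ ≤ a * ‖x - y‖ ^ β * φ x y)
    (ha : 0 ≤ a) (hφ : ∀ x y, 0 ≤ φ x y) (hwm : WM w) (hA : OB1 w c D A) (hA2 : OB2 w β c D A)
    (hc : 0 ≤ c) (hw : ∀ x ∈ D, ∀ y ∈ D, ∀ b, φ x y * w x y b ≤ C * w' x y b) :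
    OB2 w' β (2 * (a * c * C)) D (fun x => (U x).comp (A x)) := by
  intro x hx y hy v
  simp only [ContinuousLinearMap.comp_apply]
  have e : U x (A x v) - U y (A y v) = (U x - U y) (A x v) + U y (A x v - A y v) := by
    simp [map_sub]
  have h1 : ‖(U x - U y) (A x v)‖ ≤ (a * ‖x - y‖ ^ β * φ x y) * (c * nm (w x y) v) := by
    refine ((U x - U y).le_opNorm _).trans (mul_le_mul (hU2 x hx y hy) ?_ (norm_nonneg _) ?_)
    · exact (hA x hx v).trans (mul_le_mul_of_nonneg_left (nm_mono (hwm.ml x y) v) hc)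
    · have := hφ x y; positivity
  have h2 : ‖U y (A x v - A y v)‖ ≤ (a * φ x y) * (c * ‖x - y‖ ^ β * nm (w x y) v) :=
    ((U y).le_opNorm _).trans (mul_le_mul (hU x hx y hy) (hA2 x hx y hy v) (norm_nonneg _)
      (mul_nonneg ha (hφ x y)))
  have h3 : φ x y * nm (w x y) v ≤ C * nm (w' x y) v := by
    rw [← nm_smul, ← nm_smul]; exact nm_mono (hw x hx y hy) v
  have h4 : 0 ≤ 2 * (a * c) * ‖x - y‖ ^ β := by positivity
  rw [e]
  calc _ ≤ _ := norm_add_le _ _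
    _ ≤ (2 * (a * c) * ‖x - y‖ ^ β) * (φ x y * nm (w x y) v) := by
        refine (add_le_add h1 h2).trans (le_of_eq ?_); ring
    _ ≤ (2 * (a * c) * ‖x - y‖ ^ β) * (C * nm (w' x y) v) := mul_le_mul_of_nonneg_left h3 h4
    _ = _ := by ring

/-- interpolation for the coefficient -/
theorem interp {a q t β : ℝ} (ha : 0 ≤ a) (hq : 0 ≤ q) (ht : 0 ≤ t) (hβ : 0 < β) (hβ1 : β < 1)
    {u : ℝ} (hu : 0 ≤ u) (h1 : u ≤ a * q) (h2 : u ≤ a * t) : u ≤ a * t ^ β * q ^ (1 - β) := by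
  rcases le_total q t with h | h
  · calc u ≤ a * q := h1
      _ = a * (q ^ β * q ^ (1 - β)) := by
          rw [← Real.rpow_add_of_nonneg hq hβ.le (by linarith)]; simp
      _ ≤ a * (t ^ β * q ^ (1 - β)) := by gcongr
      _ = _ := by ring
  · calc u ≤ a * t := h2
      _ = a * (t ^ β * t ^ (1 - β)) := by
          rw [← Real.rpow_add_of_nonneg ht hβ.le (by linarith)]; simp
      _ ≤ a * (t ^ β * q ^ (1 - β)) := by
          have : t ^ (1 - β) ≤ q ^ (1 - β) := Real.rpow_le_rpow ht h (by linarith)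
          gcongr
      _ = _ := by ring

theorem norm_single (i : Fin p) (v : V i) : ‖(Pi.single i v : ∀ b, V b)‖ = ‖v‖ := by
  apply le_antisymm
  · refine (pi_norm_le_iff_of_nonneg (norm_nonneg _)).2 fun b => ?_
    by_cases h : b = i
    · subst h; simp
    · simp [Pi.single_eq_of_ne h]
  · simpa using norm_le_pi_norm (Pi.single i v : ∀ b, V b) i

/-- mean value estimate moving a single block -/
theorem mvt_single {g : (∀ b, V b) → F} (hg : Differentiable ℝ g)
    (h : OB1 w c (closedBall 0 1) (fderiv ℝ g)) (hc : 0 ≤ c)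
    (hw1 : ∀ x ∈ closedBall (0 : ∀ b, V b) 1, ∀ b, w x x b ≤ 1)
    (i : Fin p) (hv : ∀ x : ∀ b, V b, x i = 0 → g x = 0)
    (x : ∀ b, V b) (hx : x ∈ closedBall (0 : ∀ b, V b) 1) : ‖g x‖ ≤ c * ‖x i‖ := by
  set e : ∀ b, V b := Pi.single i (x i) with he
  set z : ℝ → (∀ b, V b) := fun τ => x + (τ - 1) • e with hz
  have hzd : ∀ τ, HasDerivAt z e τ := by
    intro τ
    have := ((hasDerivAt_id τ).sub_const 1).smul_const e
    have h2 := this.const_add x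
    rw [one_smul] at h2
    exact h2
  have hcomp : ∀ τ b, ‖z τ b‖ ≤ if b = i then |τ| * ‖x i‖ else ‖x b‖ := by
    intro τ b
    by_cases hb : b = i
    · subst hb
      have : z τ b = τ • x b := by simp [hz, he, sub_smul]
      simp [this, norm_smul]
    · simp [hz, he, hb, Pi.single_eq_of_ne hb]
  have hxb : ∀ b, ‖x b‖ ≤ 1 := fun b => (norm_le_pi_norm x b).trans (by simpa using hx)
  have hzm : ∀ τ ∈ Icc (0:ℝ) 1, z τ ∈ closedBall (0 : ∀ b, V b) 1 := by
    intro τ hτ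
    rw [mem_closedBall_zero_iff]
    refine (pi_norm_le_iff_of_nonneg zero_le_one).2 fun b => (hcomp τ b).trans ?_
    split_ifs
    · rw [abs_of_nonneg hτ.1]
      have := hxb i
      nlinarith [hτ.1, hτ.2, norm_nonneg (x i)]
    · exact hxb b
  have hd : ∀ τ ∈ Icc (0:ℝ) 1, HasDerivWithinAt (fun τ => g (z τ)) (fderiv ℝ g (z τ) e) (Icc 0 1) τ :=
    fun τ _ => ((hg (z τ)).hasFDerivAt.comp_hasDerivAt τ (hzd τ)).hasDerivWithinAt
  have hb : ∀ τ ∈ Ico (0:ℝ) 1, ‖fderiv ℝ g (z τ) e‖ ≤ c * ‖x i‖ := by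
    intro τ hτ
    have hτ' := hzm τ ⟨hτ.1, hτ.2.le⟩
    refine (h _ hτ' e).trans (mul_le_mul_of_nonneg_left ?_ hc)
    unfold nm
    rw [Finset.sum_eq_single i]
    · have := hw1 _ hτ' i
      simp only [he, Pi.single_eq_same]
      nlinarith [norm_nonneg (x i)]
    · intro b _ hb; simp [he, Pi.single_eq_of_ne hb]
    · simp
  have := norm_image_sub_le_of_norm_deriv_le_segment_01' hd hb
  have z1 : z 1 = x := by simp [hz]
  have z0 : g (z 0) = 0 := hv _ (by simp [hz, he])
  simpa [z1, z0] using this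

theorem nm_le {w : Fin p → ℝ} {R : ℝ} (h : ∀ b, w b ≤ R) (hR : 0 ≤ R) (v : ∀ b, V b) :
    nm w v ≤ R * p * ‖v‖ := by
  unfold nm
  calc _ ≤ ∑ _b : Fin p, R * ‖v‖ := Finset.sum_le_sum fun b _ =>
        mul_le_mul (h b) (norm_le_pi_norm v b) (norm_nonneg _) hR
    _ = _ := by simp; ring

theorem mvt_lip {g : (∀ b, V b) → F} (hg : Differentiable ℝ g)
    (h : OB1 w c (closedBall 0 1) (fderiv ℝ g)) (hc : 0 ≤ c)
    (hw1 : ∀ x ∈ closedBall (0 : ∀ b, V b) 1, ∀ b, w x x b ≤ 1)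
    (x : ∀ b, V b) (hx : x ∈ closedBall (0 : ∀ b, V b) 1)
    (y : ∀ b, V b) (hy : y ∈ closedBall (0 : ∀ b, V b) 1) : ‖g x - g y‖ ≤ c * p * ‖x - y‖ := by
  refine (convex_closedBall (0 : ∀ b, V b) 1).norm_image_sub_le_of_norm_fderiv_le
    (𝕜 := ℝ) (fun z _ => hg z) (fun z hz => ?_) hy hx
  refine ContinuousLinearMap.opNorm_le_bound _ (by positivity) fun v => ?_
  refine (h z hz v).trans ?_
  have := nm_le (hw1 z hz) zero_le_one v
  nlinarith

/-- series of functions with weighted derivative bounds -/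
theorem series_lemma [CompleteSpace F] {u : ℕ → (∀ b, V b) → F} {a : ℕ → ℝ}
    (hu : ∀ n, Differentiable ℝ (u n)) (hu0 : ∀ n, u n 0 = 0) (ha : ∀ n, 0 ≤ a n)
    (hs : Summable a) (hwm : WM w)
    (hwb : ∀ r : ℝ, ∃ R : ℝ, 0 ≤ R ∧ ∀ x ∈ ball (0 : ∀ b, V b) r, ∀ b, w x x b ≤ R)
    (h1 : ∀ n, OB1 w (a n) univ (fderiv ℝ (u n))) :
    (∀ x, Summable fun n => u n x) ∧ Differentiable ℝ (fun x => ∑' n, u n x) ∧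
    OB1 w (∑' n, a n) univ (fderiv ℝ (fun x => ∑' n, u n x)) ∧
    (∀ β, (∀ n, OB2 w β (a n) univ (fderiv ℝ (u n))) →
      OB2 w β (∑' n, a n) univ (fderiv ℝ (fun x => ∑' n, u n x))) ∧
    (∀ x v, HasSum (fun n => fderiv ℝ (u n) x v) (fderiv ℝ (fun x => ∑' n, u n x) x v)) := by
  have key : ∀ x, (Summable fun n => u n x) ∧ (Summable fun n => fderiv ℝ (u n) x) ∧
      HasFDerivAt (fun x => ∑' n, u n x) (∑' n, fderiv ℝ (u n) x) x := by
    intro x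
    set r := ‖x‖ + 1
    have hr : 0 < r := by positivity
    obtain ⟨R, hR, hRb⟩ := hwb r
    have hsum : Summable fun n => a n * (R * p) := hs.mul_right _
    have hbd : ∀ n, ∀ z ∈ ball (0 : ∀ b, V b) r, ‖fderiv ℝ (u n) z‖ ≤ a n * (R * p) := by
      intro n z hz
      refine ContinuousLinearMap.opNorm_le_bound _ (mul_nonneg (ha n) (by positivity)) fun v => ?_
      refine (h1 n z (mem_univ _) v).trans ?_
      have := nm_le (hRb z hz) hR v
      rw [mul_assoc]
      exact mul_le_mul_of_nonneg_left this (ha n)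
    have hx : x ∈ ball (0 : ∀ b, V b) r := by simp [r]
    have h0 : (0 : ∀ b, V b) ∈ ball (0 : ∀ b, V b) r := by simpa using hr
    have hpc : IsPreconnected (ball (0 : ∀ b, V b) r) := (convex_ball _ _).isPreconnected
    have hs0 : Summable fun n => u n 0 := by simp [hu0, summable_zero]
    have hf : ∀ n, ∀ z ∈ ball (0 : ∀ b, V b) r, HasFDerivAt (u n) (fderiv ℝ (u n) z) z :=
      fun n z _ => (hu n z).hasFDerivAt
    refine ⟨summable_of_summable_hasFDerivAt_of_isPreconnected hsum isOpen_ball hpc hf hbd h0 hs0 hx,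
      ?_, hasFDerivAt_tsum_of_isPreconnected hsum isOpen_ball hpc hf hbd h0 hs0 hx⟩
    exact Summable.of_norm_bounded hsum fun n => hbd n x hx
  have ap : ∀ x v, HasSum (fun n => fderiv ℝ (u n) x v) (fderiv ℝ (fun x => ∑' n, u n x) x v) := by
    intro x v
    rw [(key x).2.2.fderiv]
    exact (key x).2.1.hasSum.mapL (ContinuousLinearMap.apply ℝ F v)
  refine ⟨fun x => (key x).1, fun x => (key x).2.2.differentiableAt, ?_, ?_, ap⟩
  · intro x _ v
    have hb : HasSum (fun n => a n * nm (w x x) v) ((∑' n, a n) * nm (w x x) v) :=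
      hs.hasSum.mul_right _
    rw [← (ap x v).tsum_eq]
    exact tsum_of_norm_bounded hb fun n => h1 n x (mem_univ _) v
  · intro β h2 x _ y _ v
    have hb : HasSum (fun n => a n * (‖x - y‖ ^ β * nm (w x y) v))
      ((∑' n, a n) * (‖x - y‖ ^ β * nm (w x y) v)) := hs.hasSum.mul_right _
    rw [← ((ap x v).sub (ap y v)).tsum_eq, mul_assoc]
    refine tsum_of_norm_bounded hb fun n => ?_
    rw [← mul_assoc]; exact h2 n x (mem_univ _) y (mem_univ _) v

end calc1
end RB

namespace RB
section weights
variable {p : ℕ} {V : Fin p → Type} [∀ b, NormedAddCommGroup (V b)] [∀ b, NormedSpace ℝ (V b)]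
  {F F' : Type*} [NormedAddCommGroup F] [NormedSpace ℝ F] [NormedAddCommGroup F'] [NormedSpace ℝ F']

noncomputable def mx (i : Fin p) (x y : ∀ b, V b) : ℝ := max ‖x i‖ ‖y i‖

theorem mx_nonneg (i : Fin p) (x y : ∀ b, V b) : 0 ≤ mx i x y := le_max_of_le_left (norm_nonneg _)
theorem mx_le_one (i : Fin p) {x y : ∀ b, V b} (hx : x ∈ closedBall (0 : ∀ b, V b) 1)
    (hy : y ∈ closedBall (0 : ∀ b, V b) 1) : mx i x y ≤ 1 :=
  max_le ((norm_le_pi_norm x i).trans (by simpa using hx))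
    ((norm_le_pi_norm y i).trans (by simpa using hy))

/-- the anisotropic weight attached to the pair `(i, κ)` and the direction `b` -/
noncomputable def wtt (s t : Fin p → ℝ) (i κ : Fin p) (x y : ∀ b, V b) (b : Fin p) : ℝ :=
  if b ∈ Finset.Icc i κ then (mx i x y) ^ (s b) * (mx κ x y) ^ (t b) else 0

def SN (s t : Fin p → ℝ) (i κ : Fin p) : Prop := ∀ b ∈ Finset.Icc i κ, 0 ≤ s b ∧ 0 ≤ t b

variable {s t s' t' : Fin p → ℝ} {η β c : ℝ} {i κ i' κ' : Fin p}

theorem wtt_nonneg (x y : ∀ b, V b) (b : Fin p) : 0 ≤ wtt s t i κ x y b := by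
  unfold wtt
  split_ifs
  · exact mul_nonneg (Real.rpow_nonneg (mx_nonneg _ _ _) _) (Real.rpow_nonneg (mx_nonneg _ _ _) _)
  · exact le_rfl

theorem wtt_mono (h : SN s t i κ) {x y x' y' : ∀ b, V b} (hi : mx i x y ≤ mx i x' y')
    (hk : mx κ x y ≤ mx κ x' y') (b : Fin p) : wtt s t i κ x y b ≤ wtt s t i κ x' y' b := by
  unfold wtt
  split_ifs with hb
  · exact mul_le_mul (Real.rpow_le_rpow (mx_nonneg _ _ _) hi (h b hb).1)
      (Real.rpow_le_rpow (mx_nonneg _ _ _) hk (h b hb).2) (Real.rpow_nonneg (mx_nonneg _ _ _) _)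
      (Real.rpow_nonneg (mx_nonneg _ _ _) _)
  · exact le_rfl

theorem wtt_WM (h : SN s t i κ) : WM (V := V) (wtt s t i κ) where
  nn := wtt_nonneg
  ml x y b := wtt_mono h (by simp [mx]) (by simp [mx]) b
  mr x y b := wtt_mono h (by simp [mx]) (by simp [mx]) b

theorem wtt_le_one (h : SN s t i κ) {x y : ∀ b, V b} (hx : x ∈ closedBall (0 : ∀ b, V b) 1)
    (hy : y ∈ closedBall (0 : ∀ b, V b) 1) (b : Fin p) : wtt s t i κ x y b ≤ 1 := by
  unfold wtt
  split_ifs with hb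
  · exact mul_le_one₀ (Real.rpow_le_one (mx_nonneg _ _ _) (mx_le_one _ hx hy) (h b hb).1)
      (Real.rpow_nonneg (mx_nonneg _ _ _) _)
      (Real.rpow_le_one (mx_nonneg _ _ _) (mx_le_one _ hx hy) (h b hb).2)
  · exact zero_le_one

theorem wtt_bdd (h : SN s t i κ) (r : ℝ) :
    ∃ R : ℝ, 0 ≤ R ∧ ∀ x ∈ ball (0 : ∀ b, V b) r, ∀ b, wtt s t i κ x x b ≤ R := by
  refine ⟨∑ b, |r| ^ (s b) * |r| ^ (t b), by positivity, fun x hx b => ?_⟩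
  have hx' : ∀ b, ‖x b‖ ≤ |r| := fun b =>
    (norm_le_pi_norm x b).trans ((mem_ball_zero_iff.1 hx).le.trans (le_abs_self r))
  refine le_trans ?_ (Finset.single_le_sum (f := fun b => |r| ^ (s b) * |r| ^ (t b))
    (fun b _ => by positivity) (Finset.mem_univ b))
  unfold wtt
  split_ifs with hb
  · exact mul_le_mul (Real.rpow_le_rpow (mx_nonneg _ _ _) (max_le (hx' _) (hx' _)) (h b hb).1)
      (Real.rpow_le_rpow (mx_nonneg _ _ _) (max_le (hx' _) (hx' _)) (h b hb).2)
      (Real.rpow_nonneg (mx_nonneg _ _ _) _) (by positivity)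
  · positivity

theorem rpow_mono_exp {X a b : ℝ} (h0 : 0 ≤ X) (h1 : X ≤ 1) (hb : 0 ≤ a) (hab : a ≤ b) :
    X ^ b ≤ X ^ a := Real.rpow_le_rpow_of_exponent_ge' h0 h1 hb hab

theorem wtt_exp_mono (hS : SN s t i κ) (hI : Finset.Icc i' κ' ⊆ Finset.Icc i κ)
    (h1 : ∀ b ∈ Finset.Icc i' κ', (i' = i ∧ s b ≤ s' b) ∨ (s b = 0 ∧ 0 ≤ s' b))
    (h2 : ∀ b ∈ Finset.Icc i' κ', (κ' = κ ∧ t b ≤ t' b) ∨ (t b = 0 ∧ 0 ≤ t' b))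
    {x y : ∀ b, V b} (hx : x ∈ closedBall (0 : ∀ b, V b) 1)
    (hy : y ∈ closedBall (0 : ∀ b, V b) 1) (b : Fin p) :
    wtt s' t' i' κ' x y b ≤ wtt s t i κ x y b := by
  by_cases hb : b ∈ Finset.Icc i' κ'
  · have hb' := hI hb
    unfold wtt
    rw [if_pos hb, if_pos hb']
    have e1 : mx i' x y ^ s' b ≤ mx i x y ^ s b := by
      rcases h1 b hb with ⟨rfl, h⟩ | ⟨h, h'⟩
      · exact rpow_mono_exp (mx_nonneg _ _ _) (mx_le_one _ hx hy) (hS b hb').1 h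
      · rw [h, Real.rpow_zero]
        exact Real.rpow_le_one (mx_nonneg _ _ _) (mx_le_one _ hx hy) h'
    have e2 : mx κ' x y ^ t' b ≤ mx κ x y ^ t b := by
      rcases h2 b hb with ⟨rfl, h⟩ | ⟨h, h'⟩
      · exact rpow_mono_exp (mx_nonneg _ _ _) (mx_le_one _ hx hy) (hS b hb').2 h
      · rw [h, Real.rpow_zero]
        exact Real.rpow_le_one (mx_nonneg _ _ _) (mx_le_one _ hx hy) h'
    exact mul_le_mul e1 e2 (Real.rpow_nonneg (mx_nonneg _ _ _) _)
      (Real.rpow_nonneg (mx_nonneg _ _ _) _)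
  · have : wtt s' t' i' κ' x y b = 0 := by unfold wtt; rw [if_neg hb]
    rw [this]; exact wtt_nonneg x y b

/-- full second-order weights: `s + t = 1 - η` -/
structure WOK (s t : Fin p → ℝ) (η : ℝ) (i κ : Fin p) : Prop where
  η1 : η < 1
  sn : SN s t i κ
  st : ∀ b ∈ Finset.Icc i κ, s b + t b = 1 - η

theorem wtt_P1 (h : WOK s t η i κ) (hβ : β ≤ η) {x y : ∀ b, V b}
    (hx : x ∈ closedBall (0 : ∀ b, V b) 1) (hy : y ∈ closedBall (0 : ∀ b, V b) 1) (b : Fin p) :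
    (min (mx i x y) (mx κ x y)) ^ (1 - β) * wtt 0 0 i κ x y b ≤ 1 * wtt s t i κ x y b := by
  unfold wtt
  split_ifs with hb
  · have h0 : 0 ≤ min (mx i x y) (mx κ x y) := le_min (mx_nonneg _ _ _) (mx_nonneg _ _ _)
    have h1 : min (mx i x y) (mx κ x y) ≤ 1 := (min_le_left _ _).trans (mx_le_one _ hx hy)
    simp only [Pi.zero_apply, Real.rpow_zero, mul_one, one_mul]
    calc _ ≤ (min (mx i x y) (mx κ x y)) ^ (1 - η) :=
          rpow_mono_exp h0 h1 (by linarith [h.η1]) (by linarith)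
      _ = (min (mx i x y) (mx κ x y)) ^ (s b) * (min (mx i x y) (mx κ x y)) ^ (t b) := by
          rw [← Real.rpow_add_of_nonneg h0 (h.sn b hb).1 (h.sn b hb).2, h.st b hb]
      _ ≤ _ := mul_le_mul (Real.rpow_le_rpow h0 (min_le_left _ _) (h.sn b hb).1)
          (Real.rpow_le_rpow h0 (min_le_right _ _) (h.sn b hb).2) (Real.rpow_nonneg h0 _)
          (Real.rpow_nonneg (mx_nonneg _ _ _) _)
  · simp

theorem wtt_P2 (h : WOK s t η i κ) (hβ : β ≤ η) {x y : ∀ b, V b}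
    (hx : x ∈ closedBall (0 : ∀ b, V b) 1) (hy : y ∈ closedBall (0 : ∀ b, V b) 1) (b : Fin p) :
    (mx i x y) ^ (1 - β) * wtt 0 t i κ x y b ≤ 1 * wtt s t i κ x y b := by
  unfold wtt
  split_ifs with hb
  · simp only [Pi.zero_apply, Real.rpow_zero, mul_one, one_mul]
    refine mul_le_mul_of_nonneg_right ?_ (Real.rpow_nonneg (mx_nonneg _ _ _) _)
    have := h.st b hb
    have := h.sn b hb
    exact rpow_mono_exp (mx_nonneg _ _ _) (mx_le_one _ hx hy) this.1 (by linarith)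
  · simp

theorem wtt_P3 (h : WOK s t η i κ) (hβ : β ≤ η) {x y : ∀ b, V b}
    (hx : x ∈ closedBall (0 : ∀ b, V b) 1) (hy : y ∈ closedBall (0 : ∀ b, V b) 1) (b : Fin p) :
    (mx κ x y) ^ (1 - β) * wtt s 0 i κ x y b ≤ 1 * wtt s t i κ x y b := by
  unfold wtt
  split_ifs with hb
  · simp only [Pi.zero_apply, Real.rpow_zero, mul_one, one_mul]
    rw [mul_comm]
    refine mul_le_mul_of_nonneg_left ?_ (Real.rpow_nonneg (mx_nonneg _ _ _) _)
    have := h.st b hb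
    have := h.sn b hb
    exact rpow_mono_exp (mx_nonneg _ _ _) (mx_le_one _ hx hy) this.2 (by linarith)
  · simp

/-- saturation map -/
structure Sat (σ : (∀ b, V b) → (∀ b, V b)) (C β : ℝ) : Prop where
  diff : Differentiable ℝ σ
  cb : ∀ x b, ‖σ x b‖ ≤ ‖x b‖
  box : ∀ x, σ x ∈ closedBall (0 : ∀ b, V b) 1
  idn : ∀ x, ‖x‖ ≤ 1 / 2 → σ x = x
  d1 : ∀ x v b, ‖fderiv ℝ σ x v b‖ ≤ C * ‖v b‖
  d2 : ∀ x y v b, ‖fderiv ℝ σ x v b - fderiv ℝ σ y v b‖ ≤ C * ‖x - y‖ ^ β * ‖v b‖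
  lip : ∀ x y, ‖σ x - σ y‖ ≤ C * ‖x - y‖
  one : 1 ≤ C

theorem nm_comp_le {w : Fin p → ℝ} (hw : ∀ b, 0 ≤ w b) {v v' : ∀ b, V b} {C : ℝ}
    (h : ∀ b, ‖v' b‖ ≤ C * ‖v b‖) : nm w v' ≤ C * nm w v := by
  unfold nm
  rw [Finset.mul_sum]
  refine Finset.sum_le_sum fun b _ => ?_
  have := mul_le_mul_of_nonneg_left (h b) (hw b)
  linarith

variable {σ : (∀ b, V b) → (∀ b, V b)} {C : ℝ} {S : (∀ b, V b) → F}

theorem sat_mx (hσ : Sat σ C β) (i : Fin p) (x y : ∀ b, V b) : mx i (σ x) (σ y) ≤ mx i x y :=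
  max_le_max (hσ.cb x i) (hσ.cb y i)

theorem Sat.comp1 (hσ : Sat σ C β) (h : SN s t i κ) (hc : 0 ≤ c) (hS : Differentiable ℝ S)
    (h1 : OB1 (wtt s t i κ) c (closedBall 0 1) (fderiv ℝ S)) :
    OB1 (wtt s t i κ) (2 * C ^ 2 * c) univ (fderiv ℝ (fun x => S (σ x))) := by
  intro x _ v
  have hd : fderiv ℝ (fun x => S (σ x)) x v = fderiv ℝ S (σ x) (fderiv ℝ σ x v) := by
    rw [show (fun x => S (σ x)) = S ∘ σ from rfl, fderiv_comp x (hS _) (hσ.diff x)]; rfl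
  rw [hd]
  have hC := hσ.one
  have n0 : 0 ≤ nm (wtt s t i κ x x) v := nm_nonneg (wtt_nonneg x x) v
  calc _ ≤ c * nm (wtt s t i κ (σ x) (σ x)) (fderiv ℝ σ x v) := h1 _ (hσ.box x) _
    _ ≤ c * (C * nm (wtt s t i κ x x) v) := by
        refine mul_le_mul_of_nonneg_left ?_ hc
        refine (nm_comp_le (wtt_nonneg _ _) (hσ.d1 x v)).trans ?_
        exact mul_le_mul_of_nonneg_left
          (nm_mono (wtt_mono h (sat_mx hσ _ _ _) (sat_mx hσ _ _ _)) v) (by linarith)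
    _ ≤ _ := by
        have : C ≤ 2 * C ^ 2 := by nlinarith
        have : c * (C * nm (wtt s t i κ x x) v) ≤ c * ((2 * C ^ 2) * nm (wtt s t i κ x x) v) := by
          gcongr
        linarith

theorem Sat.comp2 (hσ : Sat σ C β) (h : SN s t i κ) (hc : 0 ≤ c) (hβ0 : 0 ≤ β) (hβ1 : β ≤ 1)
    (hS : Differentiable ℝ S)
    (h1 : OB1 (wtt s t i κ) c (closedBall 0 1) (fderiv ℝ S))
    (h2 : OB2 (wtt s t i κ) β c (closedBall 0 1) (fderiv ℝ S)) :
    OB2 (wtt s t i κ) β (2 * C ^ 2 * c) univ (fderiv ℝ (fun x => S (σ x))) := by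
  intro x _ y _ v
  have hd : ∀ x, fderiv ℝ (fun x => S (σ x)) x v = fderiv ℝ S (σ x) (fderiv ℝ σ x v) := by
    intro x
    rw [show (fun x => S (σ x)) = S ∘ σ from rfl, fderiv_comp x (hS _) (hσ.diff x)]; rfl
  rw [hd, hd]
  have hC := hσ.one
  have n0 : 0 ≤ nm (wtt s t i κ x y) v := nm_nonneg (wtt_nonneg x y) v
  have r0 : 0 ≤ ‖x - y‖ ^ β := by positivity
  have e : fderiv ℝ S (σ x) (fderiv ℝ σ x v) - fderiv ℝ S (σ y) (fderiv ℝ σ y v)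
      = (fderiv ℝ S (σ x) (fderiv ℝ σ x v) - fderiv ℝ S (σ y) (fderiv ℝ σ x v))
        + fderiv ℝ S (σ y) (fderiv ℝ σ x v - fderiv ℝ σ y v) := by
    rw [map_sub]; abel
  have w1 : ∀ v : (∀ b, V b), nm (wtt s t i κ (σ x) (σ y)) v ≤ nm (wtt s t i κ x y) v := fun v =>
    nm_mono (wtt_mono h (sat_mx hσ _ _ _) (sat_mx hσ _ _ _)) v
  have w2 : ∀ v : (∀ b, V b), nm (wtt s t i κ (σ y) (σ y)) v ≤ nm (wtt s t i κ x y) v := fun v =>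
    (nm_mono ((wtt_WM h).mr (σ x) (σ y)) v).trans (w1 v)
  have a1 : ‖fderiv ℝ S (σ x) (fderiv ℝ σ x v) - fderiv ℝ S (σ y) (fderiv ℝ σ x v)‖
      ≤ c * (C * ‖x - y‖ ^ β) * (C * nm (wtt s t i κ x y) v) := by
    refine (h2 _ (hσ.box x) _ (hσ.box y) _).trans ?_
    have l1 : ‖σ x - σ y‖ ^ β ≤ C * ‖x - y‖ ^ β := by
      calc _ ≤ (C * ‖x - y‖) ^ β := Real.rpow_le_rpow (norm_nonneg _) (hσ.lip x y) hβ0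
        _ = C ^ β * ‖x - y‖ ^ β := Real.mul_rpow (by linarith) (norm_nonneg _)
        _ ≤ _ := by
          refine mul_le_mul_of_nonneg_right ?_ r0
          calc C ^ β ≤ C ^ (1:ℝ) := Real.rpow_le_rpow_of_exponent_le hC hβ1
            _ = C := Real.rpow_one C
    refine mul_le_mul (mul_le_mul_of_nonneg_left l1 hc) ?_ (nm_nonneg (wtt_nonneg _ _) _)
      (by positivity)
    exact (w1 _).trans (nm_comp_le (wtt_nonneg _ _) (hσ.d1 x v))
  have a2 : ‖fderiv ℝ S (σ y) (fderiv ℝ σ x v - fderiv ℝ σ y v)‖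
      ≤ c * ((C * ‖x - y‖ ^ β) * nm (wtt s t i κ x y) v) := by
    refine (h1 _ (hσ.box y) _).trans (mul_le_mul_of_nonneg_left ?_ hc)
    exact (w2 _).trans (nm_comp_le (wtt_nonneg _ _) (fun b => hσ.d2 x y v b))
  rw [e]
  refine (norm_add_le _ _).trans ((add_le_add a1 a2).trans ?_)
  have hCC : C ≤ C ^ 2 := by nlinarith
  have : c * ((C * ‖x - y‖ ^ β) * nm (wtt s t i κ x y) v)
      ≤ c * ((C ^ 2 * ‖x - y‖ ^ β) * nm (wtt s t i κ x y) v) := by gcongr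
  linarith

end weights
end RB

namespace RB
section tlem
variable {p : ℕ} {V : Fin p → Type} [∀ b, NormedAddCommGroup (V b)] [∀ b, NormedSpace ℝ (V b)]
variable {s t : Fin p → ℝ} {η β c : ℝ} {i κ : Fin p}

/-- diagonal operator -/
noncomputable def dg (A : ∀ b, V b →L[ℝ] V b) : (∀ b, V b) →L[ℝ] (∀ b, V b) :=
  ContinuousLinearMap.pi fun b => (A b).comp (ContinuousLinearMap.proj b)

@[simp] theorem dg_apply (A : ∀ b, V b →L[ℝ] V b) (x : ∀ b, V b) (b : Fin p) :
    dg A x b = A b (x b) := rfl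

theorem dg_norm_le {A : ∀ b, V b →L[ℝ] V b} {R : ℝ} (hR : 0 ≤ R) (h : ∀ b, ‖A b‖ ≤ R)
    (x : ∀ b, V b) : ‖dg A x‖ ≤ R * ‖x‖ :=
  (pi_norm_le_iff_of_nonneg (by positivity)).2 fun b => by
    rw [dg_apply]
    exact ((A b).le_opNorm _).trans (mul_le_mul (h b) (norm_le_pi_norm x b) (norm_nonneg _) hR)

theorem nm_dg (h : SN s t i κ) {A : ∀ b, V b →L[ℝ] V b} {a : Fin p → ℝ} (ha : ∀ b, ‖A b‖ ≤ a b)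
    {Z : ℝ} (hZ : ∀ b ∈ Finset.Icc i κ, a i ^ s b * a κ ^ t b * a b ≤ Z) (x y v : ∀ b, V b) :
    nm (wtt s t i κ (dg A x) (dg A y)) (dg A v) ≤ Z * nm (wtt s t i κ x y) v := by
  have ha0 : ∀ b, 0 ≤ a b := fun b => (norm_nonneg _).trans (ha b)
  have hm : ∀ b, mx b (dg A x) (dg A y) ≤ a b * mx b x y := by
    intro b
    refine max_le ?_ ?_
    · exact ((A b).le_opNorm _).trans (mul_le_mul (ha b) (le_max_left _ _) (norm_nonneg _) (ha0 b))
    · exact ((A b).le_opNorm _).trans (mul_le_mul (ha b) (le_max_right _ _) (norm_nonneg _) (ha0 b))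
  unfold nm
  rw [Finset.mul_sum]
  refine Finset.sum_le_sum fun b _ => ?_
  unfold wtt
  split_ifs with hb
  · have e1 : mx i (dg A x) (dg A y) ^ s b ≤ a i ^ s b * mx i x y ^ s b := by
      rw [← Real.mul_rpow (ha0 i) (mx_nonneg _ _ _)]
      exact Real.rpow_le_rpow (mx_nonneg _ _ _) (hm i) (h b hb).1
    have e2 : mx κ (dg A x) (dg A y) ^ t b ≤ a κ ^ t b * mx κ x y ^ t b := by
      rw [← Real.mul_rpow (ha0 κ) (mx_nonneg _ _ _)]
      exact Real.rpow_le_rpow (mx_nonneg _ _ _) (hm κ) (h b hb).2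
    have e3 : ‖dg A v b‖ ≤ a b * ‖v b‖ :=
      ((A b).le_opNorm _).trans (mul_le_mul_of_nonneg_right (ha b) (norm_nonneg _))
    have p1 : 0 ≤ mx i x y ^ s b := Real.rpow_nonneg (mx_nonneg _ _ _) _
    have p2 : 0 ≤ mx κ x y ^ t b := Real.rpow_nonneg (mx_nonneg _ _ _) _
    have q1 : 0 ≤ a i ^ s b := Real.rpow_nonneg (ha0 _) _
    have q2 : 0 ≤ a κ ^ t b := Real.rpow_nonneg (ha0 _) _
    have q3 := ha0 b
    calc _ ≤ ((a i ^ s b * mx i x y ^ s b) * (a κ ^ t b * mx κ x y ^ t b)) * (a b * ‖v b‖) :=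
          mul_le_mul (mul_le_mul e1 e2 (Real.rpow_nonneg (mx_nonneg _ _ _) _) (by positivity)) e3
            (norm_nonneg _) (by positivity)
      _ = (a i ^ s b * a κ ^ t b * a b) * ((mx i x y ^ s b * mx κ x y ^ t b) * ‖v b‖) := by ring
      _ ≤ _ := mul_le_mul_of_nonneg_right (hZ b hb) (by positivity)
  · simp

theorem conj_fderiv {A : ∀ b, V b →L[ℝ] V b} {j : Fin p} (L : V j →L[ℝ] V j)
    {h : (∀ b, V b) → (∀ b, V b)} (hd : Differentiable ℝ h) (x v : ∀ b, V b) :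
    HasFDerivAt (fun x => L (h (dg A x) j))
      (L.comp ((ContinuousLinearMap.proj j).comp ((fderiv ℝ h (dg A x)).comp (dg A)))) x := by
  have h1 : HasFDerivAt (fun x => h (dg A x)) ((fderiv ℝ h (dg A x)).comp (dg A)) x :=
    (hd (dg A x)).hasFDerivAt.comp x (dg A).hasFDerivAt
  have h2 := (ContinuousLinearMap.proj (R := ℝ) (φ := V) j).hasFDerivAt.comp x h1
  exact L.hasFDerivAt.comp x h2

theorem conj_OB1 (hS : SN s t i κ) {A : ∀ b, V b →L[ℝ] V b} {a : Fin p → ℝ}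
    (ha : ∀ b, ‖A b‖ ≤ a b) {j : Fin p} {L : V j →L[ℝ] V j} {l c Z : ℝ} (hl : ‖L‖ ≤ l) (hc : 0 ≤ c)
    (hZ : ∀ b ∈ Finset.Icc i κ, a i ^ s b * a κ ^ t b * a b ≤ Z)
    {h : (∀ b, V b) → (∀ b, V b)} (hd : Differentiable ℝ h)
    (h1 : OB1 (wtt s t i κ) c univ (fderiv ℝ h)) :
    OB1 (wtt s t i κ) (l * c * Z) univ (fderiv ℝ (fun x => L (h (dg A x) j))) := by
  intro x _ v
  rw [(conj_fderiv L hd x v).fderiv]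
  have hl0 : 0 ≤ l := (norm_nonneg _).trans hl
  calc _ ≤ ‖L‖ * ‖fderiv ℝ h (dg A x) (dg A v) j‖ := L.le_opNorm _
    _ ≤ l * (c * (Z * nm (wtt s t i κ x x) v)) := by
        refine mul_le_mul hl ?_ (norm_nonneg _) hl0
        refine (norm_le_pi_norm _ j).trans ((h1 _ (mem_univ _) _).trans ?_)
        exact mul_le_mul_of_nonneg_left (nm_dg hS ha hZ x x v) hc
    _ = _ := by ring

theorem conj_OB2 (hS : SN s t i κ) {A : ∀ b, V b →L[ℝ] V b} {a : Fin p → ℝ}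
    (ha : ∀ b, ‖A b‖ ≤ a b) {j : Fin p} {L : V j →L[ℝ] V j} {l c Z R : ℝ} (hl : ‖L‖ ≤ l) (hc : 0 ≤ c)
    (hR : ∀ b, a b ≤ R) (hR0 : 0 ≤ R) (hβ : 0 ≤ β)
    (hZ : ∀ b ∈ Finset.Icc i κ, a i ^ s b * a κ ^ t b * a b ≤ Z)
    {h : (∀ b, V b) → (∀ b, V b)} (hd : Differentiable ℝ h)
    (h2 : OB2 (wtt s t i κ) β c univ (fderiv ℝ h)) :
    OB2 (wtt s t i κ) β (l * c * Z * R ^ β) univ (fderiv ℝ (fun x => L (h (dg A x) j))) := by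
  intro x _ y _ v
  rw [(conj_fderiv L hd x v).fderiv, (conj_fderiv L hd y v).fderiv]
  have hl0 : 0 ≤ l := (norm_nonneg _).trans hl
  have e : ‖dg A x - dg A y‖ ^ β ≤ R ^ β * ‖x - y‖ ^ β := by
    rw [← map_sub, ← Real.mul_rpow hR0 (norm_nonneg _)]
    exact Real.rpow_le_rpow (norm_nonneg _) (dg_norm_le hR0 (fun b => (ha b).trans (hR b)) _) hβ
  have n0 := nm_nonneg (wtt_nonneg (s := s) (t := t) (i := i) (κ := κ) (dg A x) (dg A y)) (dg A v)
  calc _ = ‖L ((fderiv ℝ h (dg A x) (dg A v) - fderiv ℝ h (dg A y) (dg A v)) j)‖ := by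
        simp [map_sub]
    _ ≤ ‖L‖ * ‖(fderiv ℝ h (dg A x) (dg A v) - fderiv ℝ h (dg A y) (dg A v)) j‖ := L.le_opNorm _
    _ ≤ l * (c * (R ^ β * ‖x - y‖ ^ β) * (Z * nm (wtt s t i κ x y) v)) := by
        refine mul_le_mul hl ?_ (norm_nonneg _) hl0
        refine (norm_le_pi_norm _ j).trans ((h2 _ (mem_univ _) _ (mem_univ _) _).trans ?_)
        exact mul_le_mul (mul_le_mul_of_nonneg_left e hc) (nm_dg hS ha hZ x y v) n0
          (by positivity)
    _ = _ := by ring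

/-- the diagonal cocycle with tempered bounds -/
structure Coc {Ω : Type*} (θ : Equiv.Perm Ω) (B : ℤ → Ω → ∀ b, V b →L[ℝ] V b) (K : Ω → ℝ)
    (lam : Fin p → ℝ) (ε : ℝ) : Prop where
  B0 : ∀ ω b, B 0 ω b = ContinuousLinearMap.id ℝ (V b)
  Badd : ∀ m n ω b, B (m + n) ω b = (B m ((θ ^ n) ω) b).comp (B n ω b)
  bd : ∀ n ω b, ‖B n ω b‖ ≤ K ω * Real.exp (lam b * n + ε * |(n : ℝ)|)
  K1 : ∀ ω, 1 ≤ K ω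
  Ksub : ∀ (n : ℤ) ω, K ((θ ^ n) ω) ≤ Real.exp (ε * |(n : ℝ)|) * K ω

variable {Ω : Type*} {θ : Equiv.Perm Ω} {B : ℤ → Ω → ∀ b, V b →L[ℝ] V b} {K : Ω → ℝ}
  {lam : Fin p → ℝ} {ε : ℝ}

/-- scalar estimate behind the operator `T` -/
theorem scal_est (hB : Coc θ B K lam ε) (hε : 0 < ε) (hS : SN s t i κ)
    (hst : ∀ b ∈ Finset.Icc i κ, s b + t b ≤ 1) {Λ γ : ℝ} (hΛ : ∀ b, |lam b| ≤ Λ)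
    (hβ0 : 0 ≤ β) (hβ1 : β ≤ 1) (hβΛ : β * Λ ≤ ε) (hγ : 16 * ε ≤ γ) (j : Fin p) (m : ℤ)
    (hm : ∀ b ∈ Finset.Icc i κ,
      (s b * lam i + t b * lam κ + lam b - lam j) * m ≤ -γ * |(m : ℝ)|) (ω : Ω) :
    ∃ Z : ℝ, (∀ b ∈ Finset.Icc i κ, (K ω * Real.exp (lam i * m + ε * |(m : ℝ)|)) ^ s b *
      (K ω * Real.exp (lam κ * m + ε * |(m : ℝ)|)) ^ t b *
      (K ω * Real.exp (lam b * m + ε * |(m : ℝ)|)) ≤ Z) ∧ 0 ≤ Z ∧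
      ∀ r, r = (1:ℝ) ∨ r = (K ω * Real.exp ((Λ + ε) * |(m : ℝ)|)) ^ β →
      (K ((θ ^ (m + 1)) ω) * Real.exp (lam j * (-(m + 1) : ℤ) + ε * |((-(m + 1) : ℤ) : ℝ)|)) *
        ((K ((θ ^ m) ω)) ^ 4)⁻¹ * Z * r
      ≤ Real.exp (Λ + 2 * ε) * Real.exp (-(γ / 2) * |(m : ℝ)|) := by
  set a := |(m : ℝ)| with ha
  have ha0 : 0 ≤ a := abs_nonneg _
  have hΛ0 : 0 ≤ Λ := (abs_nonneg _).trans (hΛ j)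
  set k := K ((θ ^ m) ω) with hk
  have hk1 : 1 ≤ k := hB.K1 _
  have hK1 := hB.K1 ω
  have hKk : K ω ≤ Real.exp (ε * a) * k := by
    have := hB.Ksub (-m) ((θ ^ m) ω)
    simpa [← Equiv.Perm.mul_apply, ← zpow_add] using this
  have hKk1 : K ((θ ^ (m + 1)) ω) ≤ Real.exp ε * k := by
    have := hB.Ksub 1 ((θ ^ m) ω)
    rw [← Equiv.Perm.mul_apply, ← zpow_add, add_comm 1 m] at this
    simpa using this
  refine ⟨K ω ^ 2 * Real.exp (lam j * m - γ * a + 2 * ε * a), ?_, by positivity, ?_⟩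
  · intro b hb
    have h1 := hS b hb
    rw [Real.mul_rpow (by linarith) (Real.exp_pos _).le,
      Real.mul_rpow (by linarith) (Real.exp_pos _).le, ← Real.exp_mul, ← Real.exp_mul]
    have hKs : K ω ^ s b * K ω ^ t b ≤ K ω := by
      rw [← Real.rpow_add (by linarith)]
      calc _ ≤ K ω ^ (1:ℝ) := Real.rpow_le_rpow_of_exponent_le hK1 (hst b hb)
        _ = _ := Real.rpow_one _
    have hexp : (lam i * m + ε * a) * s b + (lam κ * m + ε * a) * t b + (lam b * m + ε * a)
        ≤ lam j * m - γ * a + 2 * ε * a := by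
      have h2 := hm b hb
      have h3 := hst b hb
      have : (s b + t b) * (ε * a) ≤ 1 * (ε * a) := mul_le_mul_of_nonneg_right h3 (by positivity)
      linarith
    calc _ = (K ω ^ s b * K ω ^ t b) * K ω * Real.exp ((lam i * m + ε * a) * s b +
          (lam κ * m + ε * a) * t b + (lam b * m + ε * a)) := by
          rw [Real.exp_add (_ + _) (lam b * m + ε * a),
            Real.exp_add ((lam i * m + ε * a) * s b) ((lam κ * m + ε * a) * t b)]; ring
      _ ≤ K ω * K ω * Real.exp (lam j * m - γ * a + 2 * ε * a) := by gcongr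
      _ = _ := by ring
  · have hr : ∀ r, r = (1:ℝ) ∨ r = (K ω * Real.exp ((Λ + ε) * a)) ^ β →
        0 ≤ r ∧ r ≤ K ω * Real.exp (2 * ε * a) := by
      rintro r (rfl | rfl)
      · refine ⟨zero_le_one, ?_⟩
        have : 1 ≤ Real.exp (2 * ε * a) := Real.one_le_exp (by positivity)
        nlinarith
      · refine ⟨by positivity, ?_⟩
        rw [Real.mul_rpow (by linarith) (Real.exp_pos _).le, ← Real.exp_mul]
        refine mul_le_mul ?_ ?_ (Real.exp_pos _).le (by linarith)
        · calc _ ≤ K ω ^ (1:ℝ) := Real.rpow_le_rpow_of_exponent_le hK1 hβ1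
            _ = _ := Real.rpow_one _
        · apply Real.exp_le_exp.2
          have : (Λ * β + ε * β) * a ≤ (2 * ε) * a := by
            refine mul_le_mul_of_nonneg_right ?_ ha0
            nlinarith
          linarith
    intro r hr'
    obtain ⟨r0, r1⟩ := hr r hr'
    have hjm : lam j * ((-(m + 1) : ℤ) : ℝ) + ε * |((-(m + 1) : ℤ) : ℝ)|
        ≤ -(lam j * m) + Λ + ε * a + ε := by
      push_cast
      have h1 : |-((m:ℝ) + 1)| ≤ a + 1 := by
        rw [abs_neg]; exact (abs_add_le _ _).trans (by simp [ha])
      have h2 := neg_le_of_abs_le (hΛ j)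
      nlinarith
    calc _ ≤ (Real.exp ε * k * Real.exp (-(lam j * m) + Λ + ε * a + ε)) * (k ^ 4)⁻¹ *
          ((Real.exp (ε * a) * k) ^ 2 * Real.exp (lam j * m - γ * a + 2 * ε * a)) *
          ((Real.exp (ε * a) * k) * Real.exp (2 * ε * a)) := by
          have : r ≤ (Real.exp (ε * a) * k) * Real.exp (2 * ε * a) :=
            r1.trans (mul_le_mul_of_nonneg_right hKk (Real.exp_pos _).le)
          gcongr
      _ = Real.exp (ε + (-(lam j * m) + Λ + ε * a + ε) + (ε * a + ε * a)
            + (lam j * m - γ * a + 2 * ε * a) + (ε * a) + (2 * ε * a)) := by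
          have : k ≠ 0 := by linarith
          simp only [Real.exp_add]
          field_simp
      _ ≤ Real.exp (Λ + 2 * ε + (-(γ / 2) * a)) := by
          apply Real.exp_le_exp.2
          have : 8 * ε * a ≤ γ / 2 * a := mul_le_mul_of_nonneg_right (by linarith) ha0
          linarith
      _ = _ := Real.exp_add _ _

end tlem
end RB

namespace RB
section top
variable {p : ℕ} {V : Fin p → Type} [∀ b, NormedAddCommGroup (V b)] [∀ b, NormedSpace ℝ (V b)]
variable {s t : Fin p → ℝ} {β c γ Λ : ℝ} {i κ : Fin p}
variable {Ω : Type*} {θ : Equiv.Perm Ω} {B : ℤ → Ω → ∀ b, V b →L[ℝ] V b} {K : Ω → ℝ}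
  {lam : Fin p → ℝ} {ε : ℝ} {dir : Fin p → Bool}

noncomputable def mi (dir : Fin p → Bool) (j : Fin p) (n : ℕ) : ℤ :=
  if dir j then (n : ℤ) else -((n : ℤ) + 1)

noncomputable def sg (dir : Fin p → Bool) (j : Fin p) : ℝ := if dir j then -1 else 1

noncomputable def Tt (θ : Equiv.Perm Ω) (B : ℤ → Ω → ∀ b, V b →L[ℝ] V b)
    (h : Ω → (∀ b, V b) → (∀ b, V b)) (m : ℤ) (ω : Ω) (j : Fin p) (x : ∀ b, V b) : V j :=
  B (-(m + 1)) ((θ ^ (m + 1)) ω) j (h ((θ ^ m) ω) (dg (B m ω) x) j)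

noncomputable def TT (θ : Equiv.Perm Ω) (B : ℤ → Ω → ∀ b, V b →L[ℝ] V b) (dir : Fin p → Bool)
    (h : Ω → (∀ b, V b) → (∀ b, V b)) (ω : Ω) (x : ∀ b, V b) : ∀ b, V b :=
  fun j => sg dir j • ∑' n, Tt θ B h (mi dir j n) ω j x

/-- standing assumptions for the cohomological operator -/
structure TS (θ : Equiv.Perm Ω) (B : ℤ → Ω → ∀ b, V b →L[ℝ] V b) (K : Ω → ℝ)
    (lam : Fin p → ℝ) (ε : ℝ) (s t : Fin p → ℝ) (i κ : Fin p) (β γ Λ : ℝ)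
    (dir : Fin p → Bool) : Prop where
  coc : Coc θ B K lam ε
  ε0 : 0 < ε
  sn : SN s t i κ
  st : ∀ b ∈ Finset.Icc i κ, s b + t b ≤ 1
  hΛ : ∀ b, |lam b| ≤ Λ
  β0 : 0 ≤ β
  β1 : β ≤ 1
  βΛ : β * Λ ≤ ε
  γε : 16 * ε ≤ γ
  fw : ∀ j, dir j = true → ∀ b ∈ Finset.Icc i κ, s b * lam i + t b * lam κ + lam b - lam j ≤ -γ
  bw : ∀ j, dir j = false → ∀ b ∈ Finset.Icc i κ, γ ≤ s b * lam i + t b * lam κ + lam b - lam j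

noncomputable def CT (Λ ε γ : ℝ) : ℝ := Real.exp (Λ + 2 * ε) * ∑' n : ℕ, Real.exp (-(γ / 2) * n)

theorem summ_exp (hγ : 0 < γ) : Summable fun n : ℕ => Real.exp (-(γ / 2) * n) := by
  have : ∀ n : ℕ, Real.exp (-(γ / 2) * n) = (Real.exp (-(γ / 2))) ^ n := fun n => by
    rw [← Real.exp_nat_mul]; ring_nf
  simp_rw [this]
  exact summable_geometric_of_lt_one (Real.exp_pos _).le (Real.exp_lt_one_iff.2 (by linarith))

theorem CT_pos (hγ : 0 < γ) : 0 < CT Λ ε γ := by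
  refine mul_pos (Real.exp_pos _) ?_
  exact (summ_exp hγ).tsum_pos (fun n => (Real.exp_pos _).le) 0 (Real.exp_pos _)

theorem mi_abs (dir : Fin p → Bool) (j : Fin p) (n : ℕ) : (n : ℝ) ≤ |((mi dir j n : ℤ) : ℝ)| := by
  unfold mi
  split_ifs
  · push_cast; exact le_abs_self _
  · push_cast; rw [abs_neg]
    exact le_trans (by linarith) (le_abs_self ((n : ℝ) + 1))

theorem Tt_OB (ts : TS θ B K lam ε s t i κ β γ Λ dir) {h : Ω → (∀ b, V b) → (∀ b, V b)}
    (hc : 0 ≤ c) (hd : ∀ ω, Differentiable ℝ (h ω))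
    (h1 : ∀ ω, OB1 (wtt s t i κ) (c * (K ω ^ 4)⁻¹) univ (fderiv ℝ (h ω))) (ω : Ω) (j : Fin p) (n : ℕ) :
    OB1 (wtt s t i κ) (c * (Real.exp (Λ + 2 * ε) * Real.exp (-(γ / 2) * n))) univ
      (fderiv ℝ (Tt θ B h (mi dir j n) ω j)) ∧
    ((∀ ω, OB2 (wtt s t i κ) β (c * (K ω ^ 4)⁻¹) univ (fderiv ℝ (h ω))) →
      OB2 (wtt s t i κ) β (c * (Real.exp (Λ + 2 * ε) * Real.exp (-(γ / 2) * n))) univ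
      (fderiv ℝ (Tt θ B h (mi dir j n) ω j))) := by
  set m := mi dir j n with hm
  have hγ0 : 0 < γ := by linarith [ts.γε, ts.ε0]
  have hΛ0 : 0 ≤ Λ := (abs_nonneg _).trans (ts.hΛ j)
  have hmm : ∀ b ∈ Finset.Icc i κ,
      (s b * lam i + t b * lam κ + lam b - lam j) * m ≤ -γ * |(m : ℝ)| := by
    intro b hb
    cases hdj : dir j
    · have h2 := ts.bw j hdj b hb
      have hm' : (m : ℝ) = -((n : ℝ) + 1) := by simp [hm, mi, hdj]
      rw [hm', abs_neg, abs_of_nonneg (by positivity)]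
      have : (0:ℝ) ≤ n := Nat.cast_nonneg n
      nlinarith
    · have h2 := ts.fw j hdj b hb
      have hm' : (m : ℝ) = n := by simp [hm, mi, hdj]
      rw [hm', abs_of_nonneg (by positivity)]
      have : (0:ℝ) ≤ n := Nat.cast_nonneg n
      nlinarith
  obtain ⟨Z, hZ, hZ0, hr⟩ := scal_est ts.coc ts.ε0 ts.sn ts.st ts.hΛ ts.β0 ts.β1 ts.βΛ ts.γε j m hmm ω
  have hfin : ∀ r, r = (1:ℝ) ∨ r = (K ω * Real.exp ((Λ + ε) * |(m : ℝ)|)) ^ β →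
      (K ((θ ^ (m + 1)) ω) * Real.exp (lam j * (-(m + 1) : ℤ) + ε * |((-(m + 1) : ℤ) : ℝ)|)) *
        (c * (K ((θ ^ m) ω) ^ 4)⁻¹) * Z * r
      ≤ c * (Real.exp (Λ + 2 * ε) * Real.exp (-(γ / 2) * n)) := by
    intro r hr'
    have h3 := mul_le_mul_of_nonneg_left (hr r hr') hc
    have h4 : Real.exp (-(γ / 2) * |(m : ℝ)|) ≤ Real.exp (-(γ / 2) * n) := by
      apply Real.exp_le_exp.2
      have := mi_abs dir j n
      rw [← hm] at this
      nlinarith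
    have h5 : c * (Real.exp (Λ + 2 * ε) * Real.exp (-(γ / 2) * |(m : ℝ)|)) ≤
      c * (Real.exp (Λ + 2 * ε) * Real.exp (-(γ / 2) * n)) := by gcongr
    refine le_trans (le_of_eq ?_) (h3.trans h5)
    ring
  have hk : 0 ≤ c * (K ((θ ^ m) ω) ^ 4)⁻¹ := by positivity
  have hK1 := ts.coc.K1 ω
  refine ⟨?_, fun h2 => ?_⟩
  · have := conj_OB1 ts.sn (fun b => ts.coc.bd m ω b) (ts.coc.bd (-(m+1)) ((θ ^ (m + 1)) ω) j) hk hZ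
      (hd ((θ ^ m) ω)) (h1 _)
    refine OB1.mono this (wtt_WM ts.sn) ?_
    simpa using hfin 1 (Or.inl rfl)
  · have := conj_OB2 (R := K ω * Real.exp ((Λ + ε) * |(m : ℝ)|)) ts.sn
      (fun b => ts.coc.bd m ω b) (ts.coc.bd (-(m+1)) ((θ ^ (m + 1)) ω) j) hk ?_ ?_ ts.β0 hZ
      (hd ((θ ^ m) ω)) (h2 _)
    · exact OB2.mono this (wtt_WM ts.sn) (hfin _ (Or.inr rfl))
    · intro b
      refine mul_le_mul_of_nonneg_left (Real.exp_le_exp.2 ?_) (by linarith)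
      have h6 : lam b * m ≤ Λ * |(m : ℝ)| := by
        refine (le_abs_self _).trans ?_
        rw [abs_mul]
        exact mul_le_mul_of_nonneg_right (ts.hΛ b) (abs_nonneg _)
      linarith
    · positivity

theorem Tt_diff {h : Ω → (∀ b, V b) → (∀ b, V b)} (hd : ∀ ω, Differentiable ℝ (h ω))
    (m : ℤ) (ω : Ω) (j : Fin p) : Differentiable ℝ (Tt θ B h m ω j) := fun x =>
  (conj_fderiv _ (hd _) x 0).differentiableAt

theorem fderiv_comp_apply {g : (∀ b, V b) → (∀ b, V b)} (hg : Differentiable ℝ g)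
    (x v : ∀ b, V b) (j : Fin p) : fderiv ℝ g x v j = fderiv ℝ (fun x => g x j) x v := by
  have h := (ContinuousLinearMap.proj (R := ℝ) (φ := V) j).hasFDerivAt.comp x (hg x).hasFDerivAt
  have h' : HasFDerivAt (fun x => g x j)
    ((ContinuousLinearMap.proj (R := ℝ) (φ := V) j).comp (fderiv ℝ g x)) x := h
  rw [h'.fderiv]; rfl

/-- main estimate for the operator `TT` -/
theorem TT_main [∀ b, CompleteSpace (V b)]
    (ts : TS θ B K lam ε s t i κ β γ Λ dir) {h : Ω → (∀ b, V b) → (∀ b, V b)}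
    (hc : 0 ≤ c) (hd : ∀ ω, Differentiable ℝ (h ω)) (h0 : ∀ ω, h ω 0 = 0)
    (h1 : ∀ ω, OB1 (wtt s t i κ) (c * (K ω ^ 4)⁻¹) univ (fderiv ℝ (h ω))) (ω : Ω) :
    (∀ x j, Summable fun n => Tt θ B h (mi dir j n) ω j x) ∧ Differentiable ℝ (TT θ B dir h ω) ∧
    OB1 (wtt s t i κ) (c * CT Λ ε γ) univ (fderiv ℝ (TT θ B dir h ω)) ∧
    ((∀ ω, OB2 (wtt s t i κ) β (c * (K ω ^ 4)⁻¹) univ (fderiv ℝ (h ω))) →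
      OB2 (wtt s t i κ) β (c * CT Λ ε γ) univ (fderiv ℝ (TT θ B dir h ω))) := by
  have hγ0 : 0 < γ := by linarith [ts.γε, ts.ε0]
  have hsum : Summable fun n : ℕ => c * (Real.exp (Λ + 2 * ε) * Real.exp (-(γ / 2) * n)) :=
    ((summ_exp hγ0).mul_left _).mul_left _
  have htot : ∑' n : ℕ, c * (Real.exp (Λ + 2 * ε) * Real.exp (-(γ / 2) * n)) = c * CT Λ ε γ := by
    rw [tsum_mul_left, tsum_mul_left]; rfl
  have main := fun j => series_lemma (w := wtt s t i κ) (fun n => Tt_diff (θ := θ) (B := B) hd (mi dir j n) ω j)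
    (fun n => by simp [Tt, h0]) (fun n => by positivity) hsum (wtt_WM ts.sn) (wtt_bdd ts.sn)
    (fun n => (Tt_OB ts hc hd h1 ω j n).1)
  have hdj : ∀ j, Differentiable ℝ fun x => TT θ B dir h ω x j := fun j =>
    (main j).2.1.const_smul (sg dir j)
  have hD : Differentiable ℝ (TT θ B dir h ω) := differentiable_pi.2 hdj
  have hfd : ∀ j x v, fderiv ℝ (TT θ B dir h ω) x v j =
      sg dir j • fderiv ℝ (fun x => ∑' n, Tt θ B h (mi dir j n) ω j x) x v := by
    intro j x v
    rw [fderiv_comp_apply hD]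
    have := ((main j).2.1 x).hasFDerivAt.const_smul (sg dir j)
    have h2 : HasFDerivAt (fun x => TT θ B dir h ω x j) _ x := this
    rw [h2.fderiv]; rfl
  have hsg : ∀ j, ‖sg dir j‖ = 1 := fun j => by unfold sg; split_ifs <;> simp
  have hCT : 0 ≤ c * CT Λ ε γ := mul_nonneg hc (CT_pos hγ0).le
  refine ⟨fun x j => (main j).1 x, hD, ?_, ?_⟩
  · intro x _ v
    have hn := nm_nonneg (wtt_nonneg (s := s) (t := t) (i := i) (κ := κ) x x) v
    refine (pi_norm_le_iff_of_nonneg (by positivity)).2 fun j => ?_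
    rw [hfd, norm_smul, hsg, one_mul, ← htot]
    exact (main j).2.2.1 x (mem_univ _) v
  · intro h2 x _ y _ v
    have hn := nm_nonneg (wtt_nonneg (s := s) (t := t) (i := i) (κ := κ) x y) v
    refine (pi_norm_le_iff_of_nonneg (by positivity)).2 fun j => ?_
    rw [Pi.sub_apply, hfd, hfd, ← smul_sub, norm_smul, hsg, one_mul, ← htot]
    exact (main j).2.2.2.1 β (fun n => (Tt_OB ts hc hd h1 ω j n).2 h2) x (mem_univ _) y (mem_univ _) v

theorem Tt_shift (hB : Coc θ B K lam ε) (h : Ω → (∀ b, V b) → (∀ b, V b)) (m : ℤ) (ω : Ω)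
    (j : Fin p) (x : ∀ b, V b) :
    Tt θ B h m (θ ω) j (dg (B 1 ω) x) = B 1 ω j (Tt θ B h (m + 1) ω j x) := by
  unfold Tt
  have e1 : ∀ k : ℤ, (θ ^ k) (θ ω) = (θ ^ (k + 1)) ω := fun k => by
    rw [zpow_add, Equiv.Perm.mul_apply, zpow_one]
  have e2 : dg (B m (θ ω)) (dg (B 1 ω) x) = dg (B (m + 1) ω) x := by
    ext b; simp [hB.Badd m 1 ω b]
  have e3 : B (-(m + 1)) ((θ ^ (m + 1 + 1)) ω) j
      = (B 1 ω j).comp (B (-(m + 1 + 1)) ((θ ^ (m + 1 + 1)) ω) j) := by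
    have := hB.Badd 1 (-(m + 1 + 1)) ((θ ^ (m + 1 + 1)) ω) j
    rw [← Equiv.Perm.mul_apply, ← zpow_add] at this
    simp only [neg_add_cancel, zpow_zero, Equiv.Perm.coe_one, id_eq] at this
    rw [← this]; congr 2; ring
  rw [e1, e1, e2, e3]; rfl

theorem Tt_zero (hB : Coc θ B K lam ε) (h : Ω → (∀ b, V b) → (∀ b, V b)) (ω : Ω)
    (j : Fin p) (x : ∀ b, V b) : B 1 ω j (Tt θ B h 0 ω j x) = h ω x j := by
  have := hB.Badd 1 (-1) (θ ω) j
  have e : (θ ^ (-1 : ℤ)) (θ ω) = ω := by simp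
  rw [e] at this
  have e2 : dg (B 0 ω) x = x := by ext b; simp [hB.B0]
  simp only [Tt, zero_add, zpow_one, zpow_zero, Equiv.Perm.coe_one, id_eq, e2]
  rw [← ContinuousLinearMap.comp_apply, ← this]
  simp [hB.B0]

theorem TT_eq (hB : Coc θ B K lam ε) {h : Ω → (∀ b, V b) → (∀ b, V b)}
    (hs : ∀ ω x j, Summable fun n => Tt θ B h (mi dir j n) ω j x) (ω : Ω) (x : ∀ b, V b) :
    TT θ B dir h (θ ω) (dg (B 1 ω) x) = dg (B 1 ω) (TT θ B dir h ω x) + h ω x := by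
  funext j
  have hsj := hs ω x j
  simp only [Pi.add_apply, dg_apply, TT, map_smul, Tt_shift hB]
  rw [ContinuousLinearMap.map_tsum _ hsj, ← Tt_zero hB h ω j x]
  have hsj' : Summable fun n => B 1 ω j (Tt θ B h (mi dir j n) ω j x) := hsj.mapL _
  cases hdj : dir j
  · have e : ∀ n, B 1 ω j (Tt θ B h (mi dir j n + 1) ω j x) = B 1 ω j (Tt θ B h (-(n:ℤ)) ω j x) := by
      intro n; congr 2; simp [mi, hdj]
    have e' : ∀ n, B 1 ω j (Tt θ B h (mi dir j n) ω j x) =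
        B 1 ω j (Tt θ B h (-((n + 1 : ℕ):ℤ)) ω j x) := by
      intro n; congr 2; simp [mi, hdj]
    simp_rw [e'] at hsj' ⊢
    simp_rw [e]
    have hs2 : Summable fun n : ℕ => B 1 ω j (Tt θ B h (-(n:ℤ)) ω j x) :=
      (summable_nat_add_iff 1).1 hsj'
    rw [hs2.tsum_eq_zero_add]
    simp [sg, hdj, add_comm]
  · have e : ∀ n, B 1 ω j (Tt θ B h (mi dir j n + 1) ω j x) =
        B 1 ω j (Tt θ B h ((n + 1 : ℕ):ℤ) ω j x) := by
      intro n; congr 2; simp [mi, hdj]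
    have e' : ∀ n, B 1 ω j (Tt θ B h (mi dir j n) ω j x) =
        B 1 ω j (Tt θ B h (n:ℤ) ω j x) := by
      intro n; congr 2; simp [mi, hdj]
    simp_rw [e'] at hsj' ⊢
    simp_rw [e]
    rw [hsj'.tsum_eq_zero_add]
    simp [sg, hdj]

theorem TT_sub {h h' : Ω → (∀ b, V b) → (∀ b, V b)}
    (hs : ∀ ω x j, Summable fun n => Tt θ B h (mi dir j n) ω j x)
    (hs' : ∀ ω x j, Summable fun n => Tt θ B h' (mi dir j n) ω j x) (ω : Ω) :
    TT θ B dir (fun ω x => h ω x - h' ω x) ω = fun x => TT θ B dir h ω x - TT θ B dir h' ω x := by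
  funext x j
  simp only [TT, Pi.sub_apply]
  rw [← smul_sub, ← (hs ω x j).tsum_sub (hs' ω x j)]
  congr 2; funext n; simp [Tt]

theorem TT_van {h : Ω → (∀ b, V b) → (∀ b, V b)} (b : Fin p)
    (hv : ∀ ω x, x b = 0 → h ω x = 0) (ω : Ω) (x : ∀ b, V b) (hx : x b = 0) :
    TT θ B dir h ω x = 0 := by
  funext j
  have : ∀ n, Tt θ B h (mi dir j n) ω j x = 0 := by
    intro n; unfold Tt; rw [hv _ _ (by simp [hx])]; simp
  simp [TT, this]

theorem meas_comp {α : Type*} [MeasurableSpace α] [MeasurableSpace Ω]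
    {E1 E2 : Type*} [NormedAddCommGroup E1] [MeasurableSpace E1] [BorelSpace E1]
    [SecondCountableTopology E1] [NormedAddCommGroup E2] [MeasurableSpace E2] [BorelSpace E2]
    {g : Ω → E1 → E2} (hg : ∀ x, Measurable fun ω => g ω x) (hc : ∀ ω, Continuous (g ω))
    {a : α → Ω} (ha : Measurable a) {y : α → E1} (hy : Measurable y) :
    Measurable fun z => g (a z) (y z) := by
  have := MeasureTheory.measurable_uncurry_of_continuous_of_measurable (u := fun x ω => g ω x) (hc) (hg)
  exact this.comp (hy.prodMk ha)

theorem meas_tsum [MeasurableSpace Ω] {E1 : Type*} [NormedAddCommGroup E1] [MeasurableSpace E1]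
    [BorelSpace E1] [SecondCountableTopology E1] {u : ℕ → Ω → E1} (hu : ∀ n, Measurable (u n))
    (hs : ∀ ω, Summable fun n => u n ω) : Measurable fun ω => ∑' n, u n ω := by
  refine measurable_of_tendsto_metrizable
    (f := fun N ω => ∑ n ∈ Finset.range N, u n ω) (fun N => ?_) ?_
  · exact Finset.measurable_sum _ fun n _ => hu n
  · rw [tendsto_pi_nhds]
    exact fun ω => (hs ω).hasSum.tendsto_sum_nat

theorem TT_meas [MeasurableSpace Ω] [∀ b, MeasurableSpace (V b)] [∀ b, BorelSpace (V b)]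
    [∀ b, SecondCountableTopology (V b)]
    (hθ : ∀ m : ℤ, Measurable (θ ^ m : Equiv.Perm Ω))
    (hBm : ∀ n b v, Measurable fun ω => B n ω b v)
    {h : Ω → (∀ b, V b) → (∀ b, V b)}
    (hs : ∀ ω x j, Summable fun n => Tt θ B h (mi dir j n) ω j x)
    (hm : ∀ x, Measurable fun ω => h ω x) (hc : ∀ ω, Continuous (h ω)) (x : ∀ b, V b) :
    Measurable fun ω => TT θ B dir h ω x := by
  refine measurable_pi_iff.2 fun j => ?_
  refine Measurable.const_smul (meas_tsum (fun n => ?_) fun ω => hs ω x j) _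
  unfold Tt
  generalize mi dir j n = m
  have h1 : Measurable fun ω => dg (B m ω) x := measurable_pi_iff.2 fun b => hBm m b (x b)
  have h2 : Measurable fun ω => h ((θ ^ m) ω) (dg (B m ω) x) := meas_comp hm hc (hθ m) h1
  have h3 : Measurable fun ω => h ((θ ^ m) ω) (dg (B m ω) x) j := (measurable_pi_apply j).comp h2
  exact meas_comp (g := fun ω v => B (-(m+1)) ω j v) (fun v => hBm _ j v)
    (fun ω => (B (-(m+1)) ω j).continuous) (hθ (m+1)) h3

end top
end RB

namespace RB
section solve
variable {p : ℕ} {V : Fin p → Type} [∀ b, NormedAddCommGroup (V b)] [∀ b, NormedSpace ℝ (V b)]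
variable {s t : Fin p → ℝ} {β c η a : ℝ} {i κ : Fin p}
  {w w' : (∀ b, V b) → (∀ b, V b) → Fin p → ℝ} {A : (∀ b, V b) → (∀ b, V b) →L[ℝ] (∀ b, V b)}

theorem prodQ {U : (∀ b, V b) → (∀ b, V b) →L[ℝ] (∀ b, V b)} {Q : (∀ b, V b) → (∀ b, V b) → ℝ}
    (ha : 0 ≤ a) (hc : 0 ≤ c) (hβ0 : 0 < β) (hβ1 : β < 1) (hQ0 : ∀ x y, 0 ≤ Q x y)
    (hQ1 : ∀ x ∈ closedBall (0 : ∀ b, V b) 1, ∀ y ∈ closedBall (0 : ∀ b, V b) 1, Q x y ≤ 1)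
    (hQm : ∀ x y, Q x x ≤ Q x y ∧ Q y y ≤ Q x y)
    (U1 : ∀ x ∈ closedBall (0 : ∀ b, V b) 1, 2 * ‖U x‖ ≤ a * Q x x)
    (U2 : ∀ x ∈ closedBall (0 : ∀ b, V b) 1, ∀ y ∈ closedBall (0 : ∀ b, V b) 1,
      ‖U x - U y‖ ≤ a * ‖x - y‖)
    (hw : ∀ x ∈ closedBall (0 : ∀ b, V b) 1, ∀ y ∈ closedBall (0 : ∀ b, V b) 1, ∀ b,
      Q x y ^ (1 - β) * w x y b ≤ 1 * w' x y b) (hwm : WM w) (hwm' : WM w')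
    (h1 : OB1 w c (closedBall 0 1) A) (h2 : OB2 w β c (closedBall 0 1) A) :
    OB1 w' (2 * (a * c)) (closedBall 0 1) (fun x => (U x).comp (A x)) ∧
    OB2 w' β (2 * (a * c)) (closedBall 0 1) (fun x => (U x).comp (A x)) := by
  have hb : ∀ x ∈ closedBall (0 : ∀ b, V b) 1, ∀ y ∈ closedBall (0 : ∀ b, V b) 1,
      ‖U y‖ ≤ a * Q x y ^ (1 - β) := by
    intro x hx y hy
    have e1 : Q x y ≤ Q x y ^ (1 - β) := by
      calc Q x y = Q x y ^ (1:ℝ) := (Real.rpow_one _).symm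
        _ ≤ _ := rpow_mono_exp (hQ0 x y) (hQ1 x hx y hy) (by linarith) (by linarith)
    have e2 := U1 y hy
    have e3 : a * Q y y ≤ a * Q x y ^ (1 - β) :=
      mul_le_mul_of_nonneg_left ((hQm x y).2.trans e1) ha
    linarith [norm_nonneg (U y)]
  constructor
  · have := OB1.prod (w' := w') (C := 1) (φ := fun x => Q x x ^ (1 - β)) (fun x hx => hb x hx x hx) ha
      (fun x => Real.rpow_nonneg (hQ0 x x) _) h1 hc (fun x hx b => hw x hx x hx b)
    exact this.mono hwm' (by nlinarith [mul_nonneg ha hc])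
  · have := OB2.prod (w' := w') (C := 1) (φ := fun x y => Q x y ^ (1 - β)) hb ?_ ha
      (fun x y => Real.rpow_nonneg (hQ0 x y) _) hwm h1 h2 hc (fun x hx y hy b => hw x hx y hy b)
    · simpa using this
    · intro x hx y hy
      refine interp ha (hQ0 x y) (norm_nonneg _) hβ0 hβ1 (norm_nonneg _) ?_ (U2 x hx y hy)
      have e1 := U1 x hx
      have e2 := U1 y hy
      have e3 := mul_le_mul_of_nonneg_left (hQm x y).1 ha
      have e4 := mul_le_mul_of_nonneg_left (hQm x y).2 ha
      linarith [norm_sub_le (U x) (U y)]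

theorem Qmin_facts (i κ : Fin p) :
    (∀ x y : ∀ b, V b, 0 ≤ min (mx i x y) (mx κ x y)) ∧
    (∀ x ∈ closedBall (0 : ∀ b, V b) 1, ∀ y ∈ closedBall (0 : ∀ b, V b) 1,
      min (mx i x y) (mx κ x y) ≤ 1) ∧
    (∀ x y : ∀ b, V b, min (mx i x x) (mx κ x x) ≤ min (mx i x y) (mx κ x y) ∧
      min (mx i y y) (mx κ y y) ≤ min (mx i x y) (mx κ x y)) := by
  refine ⟨fun x y => le_min (mx_nonneg _ _ _) (mx_nonneg _ _ _),
    fun x hx y hy => (min_le_left _ _).trans (mx_le_one _ hx hy), fun x y => ⟨?_, ?_⟩⟩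
  · exact min_le_min (by simp [mx]) (by simp [mx])
  · exact min_le_min (by simp [mx]) (by simp [mx])

theorem SN_zero (i κ : Fin p) : SN (0 : Fin p → ℝ) 0 i κ := fun b _ => ⟨le_rfl, le_rfl⟩

theorem wtt_le_zero (h : SN s t i κ) {x y : ∀ b, V b} (hx : x ∈ closedBall (0 : ∀ b, V b) 1)
    (hy : y ∈ closedBall (0 : ∀ b, V b) 1) (b : Fin p) :
    wtt s t i κ x y b ≤ wtt 0 0 i κ x y b :=
  wtt_exp_mono (SN_zero i κ) (Finset.Subset.refl _) (fun b hb => Or.inr ⟨rfl, (h b hb).1⟩)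
    (fun b hb => Or.inr ⟨rfl, (h b hb).2⟩) hx hy b

/-- fibre-wise estimates for the nonlinear source -/
structure FF (f : (∀ b, V b) → (∀ b, V b)) (M : ℝ) : Prop where
  diff : Differentiable ℝ f
  z : f 0 = 0
  dz : fderiv ℝ f 0 = 0
  lip : ∀ x y, ‖fderiv ℝ f x - fderiv ℝ f y‖ ≤ M * ‖x - y‖
  M0 : 0 ≤ M

structure NN (s t : Fin p → ℝ) (i κ : Fin p) (β CN C0 M : ℝ) (f N k : (∀ b, V b) → (∀ b, V b)) :
    Prop where
  nd : Differentiable ℝ N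
  n0 : N 0 = 0
  n1 : OB1 (wtt 0 0 i κ) CN (closedBall 0 1) (fderiv ℝ N)
  n2 : OB2 (wtt 0 0 i κ) β CN (closedBall 0 1) (fderiv ℝ N)
  kd : Differentiable ℝ k
  s1 : OB1 (wtt s t i κ) (C0 * M) (closedBall 0 1) (fderiv ℝ (fun x => f (N x) - k x))
  s2 : OB2 (wtt s t i κ) β (C0 * M) (closedBall 0 1) (fderiv ℝ (fun x => f (N x) - k x))
  vi : ∀ x, x i = 0 → f (N x) - k x = 0
  vk : ∀ x, x κ = 0 → f (N x) - k x = 0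

structure GG (s t : Fin p → ℝ) (i κ : Fin p) (β c : ℝ) (D : Set (∀ b, V b))
    (g : (∀ b, V b) → (∀ b, V b)) : Prop where
  diff : Differentiable ℝ g
  vi : ∀ x, x i = 0 → g x = 0
  vk : ∀ x, x κ = 0 → g x = 0
  o1 : OB1 (wtt s t i κ) c D (fderiv ℝ g)
  o2 : OB2 (wtt s t i κ) β c D (fderiv ℝ g)

variable {f N k g g' : (∀ b, V b) → (∀ b, V b)} {CN C0 M d : ℝ}

theorem FF.nrm (hf : FF f M) (x : ∀ b, V b) : ‖fderiv ℝ f x‖ ≤ M * ‖x‖ := by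
  have := hf.lip x 0
  simpa [hf.dz] using this

theorem min_bound (hsn : SN s t i κ) (hg : Differentiable ℝ g) (hvi : ∀ x, x i = 0 → g x = 0)
    (hvk : ∀ x, x κ = 0 → g x = 0) (hd : 0 ≤ d)
    (h1 : OB1 (wtt s t i κ) d (closedBall 0 1) (fderiv ℝ g)) (x : ∀ b, V b)
    (hx : x ∈ closedBall (0 : ∀ b, V b) 1) : ‖g x‖ ≤ d * min (mx i x x) (mx κ x x) := by
  have e1 := mvt_single hg h1 hd (fun x hx b => wtt_le_one hsn hx hx b) i hvi x hx
  have e2 := mvt_single hg h1 hd (fun x hx b => wtt_le_one hsn hx hx b) κ hvk x hx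
  rcases min_cases (mx i x x) (mx κ x x) with h | h <;> rw [h.1] <;> simpa [mx]

theorem NG_lip (hsn : SN s t i κ) (hN : NN s t i κ β CN C0 M f N k) (hCN : 1 ≤ CN)
    (hg : GG s t i κ β 1 (closedBall 0 1) g) (x : ∀ b, V b) (hx : x ∈ closedBall (0 : ∀ b, V b) 1)
    (y : ∀ b, V b) (hy : y ∈ closedBall (0 : ∀ b, V b) 1) :
    ‖(N x + g x) - (N y + g y)‖ ≤ 2 * CN * p * ‖x - y‖ := by
  have e1 := mvt_lip hN.nd hN.n1 (by linarith) (fun x hx b => wtt_le_one (SN_zero i κ) hx hx b) x hx y hy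
  have e2 := mvt_lip hg.diff hg.o1 zero_le_one (fun x hx b => wtt_le_one hsn hx hx b) x hx y hy
  have e3 := norm_add_le (N x - N y) (g x - g y)
  have e4 : 1 * (p:ℝ) * ‖x - y‖ ≤ CN * p * ‖x - y‖ := by gcongr
  rw [add_sub_add_comm]
  linarith

theorem one_le_p (i : Fin p) : (1:ℝ) ≤ p := by exact_mod_cast (Nat.one_le_iff_ne_zero.2 (by
  rintro rfl; exact i.elim0))

theorem S_deriv (hf : FF f M) (hN : NN s t i κ β CN C0 M f N k) (hg : Differentiable ℝ g)
    (x : ∀ b, V b) : HasFDerivAt (fun x => f (N x + g x) - k x)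
      ((fderiv ℝ f (N x + g x)).comp (fderiv ℝ N x + fderiv ℝ g x) - fderiv ℝ k x) x :=
  ((hf.diff _).hasFDerivAt.comp x ((hN.nd x).hasFDerivAt.add (hg x).hasFDerivAt)).sub
    (hN.kd x).hasFDerivAt

theorem S_est (hβ0 : 0 < β) (hβη : β ≤ η) (wok : WOK s t η i κ) (hf : FF f M) (hCN : 1 ≤ CN)
    (hN : NN s t i κ β CN C0 M f N k) (hg : GG s t i κ β 1 (closedBall 0 1) g) :
    GG s t i κ β ((C0 + 16 * CN ^ 2 * p) * M) (closedBall 0 1) (fun x => f (N x + g x) - k x) := by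
  have hsn := wok.sn
  have hβ1 : β < 1 := hβη.trans_lt wok.η1
  have hM := hf.M0
  have hp := one_le_p i
  have hCp : 1 ≤ 2 * CN * p := by nlinarith
  have z0 : (0 : ∀ b, V b) ∈ closedBall (0 : ∀ b, V b) 1 := by simp
  have hg0 : g 0 = 0 := hg.vi 0 rfl
  have hdS : ∀ x, fderiv ℝ (fun x => f (N x + g x) - k x) x =
      fderiv ℝ (fun x => f (N x) - k x) x
      + ((fderiv ℝ f (N x + g x) - fderiv ℝ f (N x)).comp (fderiv ℝ N x)
        + (fderiv ℝ f (N x + g x)).comp (fderiv ℝ g x)) := by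
    intro x
    have h0 := S_deriv (g := 0) hf hN (differentiable_const _) x
    simp only [Pi.zero_apply, add_zero] at h0
    rw [(S_deriv hf hN hg.diff x).fderiv, h0.fderiv]
    ext v : 1
    have : fderiv ℝ (0 : (∀ b, V b) → (∀ b, V b)) x = 0 := fderiv_const_apply _
    simp [map_add, this]
    abel
  obtain ⟨q0, q1, q2⟩ := Qmin_facts (V := V) i κ
  have gb := min_bound hsn hg.diff hg.vi hg.vk zero_le_one hg.o1
  have lipN := mvt_lip hN.nd hN.n1 (by linarith) (fun x hx b => wtt_le_one (SN_zero i κ) hx hx b)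
  have lipG := NG_lip hsn hN hCN hg
  have P1 := prodQ (a := 4 * CN * p * M) (c := CN) (w := wtt 0 0 i κ) (w' := wtt s t i κ)
    (U := fun x => fderiv ℝ f (N x + g x) - fderiv ℝ f (N x))
    (A := fderiv ℝ N) (by positivity) (by linarith) hβ0 hβ1 q0 q1 q2
    (by
      intro x hx
      have e1 := hf.lip (N x + g x) (N x)
      rw [add_sub_cancel_left] at e1
      have e2 := mul_le_mul_of_nonneg_left (gb x hx) hM
      rw [one_mul] at e2
      have e3 : 2 * (M * min (mx i x x) (mx κ x x)) ≤ 4 * CN * p * M * min (mx i x x) (mx κ x x) := by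
        have := q0 x x
        have h5 : 2 * M ≤ 4 * CN * p * M := by nlinarith
        nlinarith
      linarith)
    (by
      intro x hx y hy
      have e1 := hf.lip (N x + g x) (N y + g y)
      have e2 := hf.lip (N x) (N y)
      have e3 := mul_le_mul_of_nonneg_left (lipG x hx y hy) hM
      have e4 := mul_le_mul_of_nonneg_left (lipN x hx y hy) hM
      have e5 := norm_sub_le (fderiv ℝ f (N x + g x) - fderiv ℝ f (N y + g y))
        (fderiv ℝ f (N x) - fderiv ℝ f (N y))
      rw [sub_sub_sub_comm]
      have : 0 ≤ CN * p * M * ‖x - y‖ := by positivity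
      linarith)
    (fun x hx y hy b => wtt_P1 wok hβη hx hy b) (wtt_WM (SN_zero i κ)) (wtt_WM hsn) hN.n1 hN.n2
  have P2 := prodQ (a := 4 * CN * p * M) (c := 1) (w := wtt s t i κ) (w' := wtt s t i κ)
    (U := fun x => fderiv ℝ f (N x + g x)) (Q := fun _ _ => 1)
    (A := fderiv ℝ g) (by positivity) zero_le_one hβ0 hβ1 (fun _ _ => zero_le_one)
    (fun _ _ _ _ => le_rfl) (fun _ _ => ⟨le_rfl, le_rfl⟩)
    (by
      intro x hx
      have e1 := hf.nrm (N x + g x)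
      have e2 := lipG x hx 0 z0
      rw [hN.n0, hg0, add_zero, sub_zero, sub_zero] at e2
      have hx1 : ‖x‖ ≤ 1 := by simpa using hx
      have e3 : ‖N x + g x‖ ≤ 2 * CN * p := e2.trans (by nlinarith)
      have e4 := mul_le_mul_of_nonneg_left e3 hM
      linarith)
    (by
      intro x hx y hy
      have e1 := hf.lip (N x + g x) (N y + g y)
      have e3 := mul_le_mul_of_nonneg_left (lipG x hx y hy) hM
      have : 0 ≤ CN * p * M * ‖x - y‖ := by positivity
      linarith)
    (fun x hx y hy b => by simp) (wtt_WM hsn) (wtt_WM hsn) hg.o1 hg.o2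
  have hconst : C0 * M + (2 * (4 * CN * p * M * CN) + 2 * (4 * CN * p * M * 1))
      ≤ (C0 + 16 * CN ^ 2 * p) * M := by
    have : CN * p * M ≤ CN ^ 2 * p * M := by
      have : CN ≤ CN ^ 2 := by nlinarith
      gcongr
    linarith
  refine ⟨fun x => (S_deriv hf hN hg.diff x).differentiableAt, ?_, ?_, ?_, ?_⟩
  · intro x hx; rw [hg.vi x hx, add_zero]; exact hN.vi x hx
  · intro x hx; rw [hg.vk x hx, add_zero]; exact hN.vk x hx
  · rw [show fderiv ℝ (fun x => f (N x + g x) - k x) = _ from funext hdS]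
    exact (hN.s1.add (P1.1.add P2.1)).mono (wtt_WM hsn) hconst
  · rw [show fderiv ℝ (fun x => f (N x + g x) - k x) = _ from funext hdS]
    exact (hN.s2.add (P1.2.add P2.2)).mono (wtt_WM hsn) hconst

theorem S_contr (hβ0 : 0 < β) (hβη : β ≤ η) (wok : WOK s t η i κ) (hf : FF f M) (hCN : 1 ≤ CN)
    (hC0 : 0 ≤ C0)
    (hN : NN s t i κ β CN C0 M f N k) (hg : GG s t i κ β 1 (closedBall 0 1) g)
    (hg' : GG s t i κ β 1 (closedBall 0 1) g') (hd : 0 ≤ d)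
    (h1 : OB1 (wtt s t i κ) d (closedBall 0 1) (fderiv ℝ (fun x => g x - g' x))) :
    OB1 (wtt s t i κ) ((C0 + 16 * CN ^ 2 * p) * M * d) (closedBall 0 1)
      (fderiv ℝ (fun x => (f (N x + g x) - k x) - (f (N x + g' x) - k x))) := by
  have hsn := wok.sn
  have hβ1 : β < 1 := hβη.trans_lt wok.η1
  have hM := hf.M0
  have hp := one_le_p i
  have z0 : (0 : ∀ b, V b) ∈ closedBall (0 : ∀ b, V b) 1 := by simp
  have hg0 : g 0 = 0 := hg.vi 0 rfl
  have hdd : Differentiable ℝ fun x => g x - g' x := hg.diff.sub hg'.diff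
  have gb := min_bound hsn hdd (fun x hx => by rw [hg.vi x hx, hg'.vi x hx, sub_zero])
    (fun x hx => by rw [hg.vk x hx, hg'.vk x hx, sub_zero]) hd h1
  have lipG := NG_lip hsn hN hCN hg
  have hdS : ∀ x, fderiv ℝ (fun x => (f (N x + g x) - k x) - (f (N x + g' x) - k x)) x =
      (fderiv ℝ f (N x + g x) - fderiv ℝ f (N x + g' x)).comp (fderiv ℝ N x + fderiv ℝ g' x)
        + (fderiv ℝ f (N x + g x)).comp (fderiv ℝ (fun x => g x - g' x) x) := by
    intro x
    have e : HasFDerivAt (fun x => (f (N x + g x) - k x) - (f (N x + g' x) - k x)) _ x :=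
      (S_deriv hf hN hg.diff x).sub (S_deriv hf hN hg'.diff x)
    have e2 : HasFDerivAt (fun x => g x - g' x) _ x :=
      (hg.diff x).hasFDerivAt.sub (hg'.diff x).hasFDerivAt
    rw [e.fderiv, e2.fderiv]
    ext v : 1
    simp [map_add, map_sub]
    abel
  obtain ⟨q0, q1, q2⟩ := Qmin_facts (V := V) i κ
  have hA : OB1 (wtt 0 0 i κ) (CN + 1) (closedBall 0 1) (fun x => fderiv ℝ N x + fderiv ℝ g' x) :=
    hN.n1.add (hg'.o1.wmono zero_le_one (fun x hx y hy b => wtt_le_zero hsn hx hy b))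
  have P1 := OB1.prod (w' := wtt s t i κ) (C := 1) (a := M * d)
    (U := fun x => fderiv ℝ f (N x + g x) - fderiv ℝ f (N x + g' x))
    (φ := fun x => (min (mx i x x) (mx κ x x)) ^ (1 - β)) (D := closedBall 0 1)
    (by
      intro x hx
      have e1 := hf.lip (N x + g x) (N x + g' x)
      rw [add_sub_add_left_eq_sub] at e1
      have e2 := mul_le_mul_of_nonneg_left (gb x hx) hM
      have e3 : min (mx i x x) (mx κ x x) ≤ min (mx i x x) (mx κ x x) ^ (1 - β) := by
        calc _ = (min (mx i x x) (mx κ x x)) ^ (1:ℝ) := (Real.rpow_one _).symm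
          _ ≤ _ := rpow_mono_exp (q0 x x) (q1 x hx x hx) (by linarith) (by linarith)
      have e4 := mul_le_mul_of_nonneg_left e3 (mul_nonneg hM hd)
      linarith)
    (mul_nonneg hM hd) (fun x => Real.rpow_nonneg (q0 x x) _) hA (by linarith)
    (fun x hx b => wtt_P1 wok hβη hx hx b)
  have P2 := OB1.prod (w' := wtt s t i κ) (C := 1) (a := 2 * CN * p * M)
    (U := fun x => fderiv ℝ f (N x + g x)) (φ := fun _ => 1) (D := closedBall 0 1)
    (by
      intro x hx
      have e1 := hf.nrm (N x + g x)
      have e2 := lipG x hx 0 z0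
      rw [hN.n0, hg0, add_zero, sub_zero, sub_zero] at e2
      have hx1 : ‖x‖ ≤ 1 := by simpa using hx
      have e3 : ‖N x + g x‖ ≤ 2 * CN * p := e2.trans (by
        have : 0 ≤ 2 * CN * p := by positivity
        nlinarith)
      have e4 := mul_le_mul_of_nonneg_left e3 hM
      linarith)
    (by positivity) (fun x => zero_le_one) h1 hd (fun x hx b => by simp)
  rw [show fderiv ℝ (fun x => (f (N x + g x) - k x) - (f (N x + g' x) - k x)) = _ from funext hdS]
  refine (P1.add P2).mono (wtt_WM hsn) ?_
  have hMd : 0 ≤ M * d := mul_nonneg hM hd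
  have : CN + 1 + 2 * CN * p ≤ C0 + 16 * CN ^ 2 * p := by
    have h1 : CN ≤ CN ^ 2 := by nlinarith
    have h2 : CN * p ≤ CN ^ 2 * p := by gcongr
    nlinarith
  nlinarith

end solve
end RB

namespace RB
section solve2
variable {p : ℕ} {V : Fin p → Type} [∀ b, NormedAddCommGroup (V b)] [∀ b, NormedSpace ℝ (V b)]
  [∀ b, CompleteSpace (V b)]
variable {s t : Fin p → ℝ} {β c γ Λ η δ CN C0 Cσ : ℝ} {i κ : Fin p}
variable {Ω : Type*} {θ : Equiv.Perm Ω} {B : ℤ → Ω → ∀ b, V b →L[ℝ] V b} {K : Ω → ℝ}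
  {lam : Fin p → ℝ} {ε : ℝ} {dir : Fin p → Bool}
  {f N k g g' : Ω → (∀ b, V b) → (∀ b, V b)} {σ : (∀ b, V b) → (∀ b, V b)}

/-- the source term -/
def Src (f N k : Ω → (∀ b, V b) → (∀ b, V b)) (σ : (∀ b, V b) → (∀ b, V b))
    (g : Ω → (∀ b, V b) → (∀ b, V b)) (ω : Ω) (x : ∀ b, V b) : ∀ b, V b :=
  f ω (N ω (σ x) + g ω (σ x)) - k ω (σ x)

theorem GG.restr {g : (∀ b, V b) → (∀ b, V b)} (h : GG s t i κ β c univ g) (hsn : SN s t i κ)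
    {c' : ℝ} (hc : c ≤ c') (D : Set (∀ b, V b)) : GG s t i κ β c' D g :=
  ⟨h.diff, h.vi, h.vk, fun x _ v => h.o1.mono (wtt_WM hsn) hc x (mem_univ _) v,
    fun x _ y _ v => h.o2.mono (wtt_WM hsn) hc x (mem_univ _) y (mem_univ _) v⟩

structure SS (θ : Equiv.Perm Ω) (B : ℤ → Ω → ∀ b, V b →L[ℝ] V b) (K : Ω → ℝ)
    (lam : Fin p → ℝ) (ε : ℝ) (s t : Fin p → ℝ) (i κ : Fin p) (β γ Λ : ℝ)
    (dir : Fin p → Bool) (η δ CN C0 Cσ : ℝ) (f N k : Ω → (∀ b, V b) → (∀ b, V b))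
    (σ : (∀ b, V b) → (∀ b, V b)) : Prop where
  ts : TS θ B K lam ε s t i κ β γ Λ dir
  β0 : 0 < β
  βη : β ≤ η
  wok : WOK s t η i κ
  sat : Sat σ Cσ β
  δ0 : 0 ≤ δ
  CN1 : 1 ≤ CN
  C00 : 0 ≤ C0
  hf : ∀ ω, FF (f ω) (δ * (K ω ^ 4)⁻¹)
  hN : ∀ ω, NN s t i κ β CN C0 (δ * (K ω ^ 4)⁻¹) (f ω) (N ω) (k ω)

noncomputable def Cs (Λ ε γ δ CN C0 Cσ : ℝ) (p : ℕ) : ℝ :=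
  2 * Cσ ^ 2 * ((C0 + 16 * CN ^ 2 * p) * δ) * CT Λ ε γ

theorem Src_zero {C β : ℝ} (hσ : Sat σ C β) (b : Fin p) (h : ∀ ω x, x b = 0 →
    f ω (N ω x + g ω x) - k ω x = 0) (ω : Ω) (x : ∀ b, V b) (hx : x b = 0) :
    Src f N k σ g ω x = 0 := by
  refine h ω (σ x) ?_
  have := hσ.cb x b
  rw [hx, norm_zero] at this
  exact norm_le_zero_iff.1 this

theorem Src_step (ss : SS θ B K lam ε s t i κ β γ Λ dir η δ CN C0 Cσ f N k σ)
    (hg : ∀ ω, GG s t i κ β 1 (closedBall 0 1) (g ω)) :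
    (∀ ω x j, Summable fun n => Tt θ B (Src f N k σ g) (mi dir j n) ω j x) ∧
    (∀ ω, Differentiable ℝ (Src f N k σ g ω)) ∧
    (∀ ω, GG s t i κ β (Cs Λ ε γ δ CN C0 Cσ p) univ (TT θ B dir (Src f N k σ g) ω)) := by
  have hS := fun ω => S_est ss.β0 ss.βη ss.wok (ss.hf ω) ss.CN1 (ss.hN ω) (hg ω)
  have hK : ∀ ω, 0 < K ω := fun ω => zero_lt_one.trans_le (ss.ts.coc.K1 ω)
  have hd0 := ss.δ0
  have hC0 := ss.C00
  have hCN := ss.CN1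
  have hCσ := ss.sat.one
  have hnn : ∀ ω, 0 ≤ (C0 + 16 * CN ^ 2 * p) * (δ * (K ω ^ 4)⁻¹) := fun ω => by
    have := hK ω; positivity
  have hsd : ∀ ω, Differentiable ℝ (Src f N k σ g ω) := fun ω => (hS ω).diff.comp ss.sat.diff
  have o1 : ∀ ω, OB1 (wtt s t i κ) (2 * Cσ ^ 2 * ((C0 + 16 * CN ^ 2 * p) * δ) * (K ω ^ 4)⁻¹) univ
      (fderiv ℝ (Src f N k σ g ω)) := fun ω => by
    have := ss.sat.comp1 ss.ts.sn (hnn ω) (hS ω).diff (hS ω).o1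
    convert this using 1 <;> first | (ring; done) | rfl
  have o2 : ∀ ω, OB2 (wtt s t i κ) β (2 * Cσ ^ 2 * ((C0 + 16 * CN ^ 2 * p) * δ) * (K ω ^ 4)⁻¹) univ
      (fderiv ℝ (Src f N k σ g ω)) := fun ω => by
    have := ss.sat.comp2 ss.ts.sn (hnn ω) ss.ts.β0 ss.ts.β1 (hS ω).diff (hS ω).o1 (hS ω).o2
    convert this using 1 <;> first | (ring; done) | rfl
  have vi := Src_zero (f := f) (N := N) (k := k) (g := g) ss.sat i (fun ω x hx => (hS ω).vi x hx)
  have vk := Src_zero (f := f) (N := N) (k := k) (g := g) ss.sat κ (fun ω x hx => (hS ω).vk x hx)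
  have M := fun ω => TT_main ss.ts (c := 2 * Cσ ^ 2 * ((C0 + 16 * CN ^ 2 * p) * δ))
    (by positivity) hsd (fun ω => vi ω 0 rfl) o1 ω
  refine ⟨fun ω => (M ω).1, hsd, fun ω => ⟨(M ω).2.1, TT_van i vi ω, TT_van κ vk ω, (M ω).2.2.1,
    (M ω).2.2.2 o2⟩⟩

theorem Src_contr (ss : SS θ B K lam ε s t i κ β γ Λ dir η δ CN C0 Cσ f N k σ)
    (hg : ∀ ω, GG s t i κ β 1 (closedBall 0 1) (g ω))
    (hg' : ∀ ω, GG s t i κ β 1 (closedBall 0 1) (g' ω)) {d : ℝ} (hd : 0 ≤ d)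
    (h1 : ∀ ω, OB1 (wtt s t i κ) d (closedBall 0 1) (fderiv ℝ (fun x => g ω x - g' ω x))) (ω : Ω) :
    OB1 (wtt s t i κ) (Cs Λ ε γ δ CN C0 Cσ p * d) univ
      (fderiv ℝ (fun x => TT θ B dir (Src f N k σ g) ω x - TT θ B dir (Src f N k σ g') ω x)) := by
  obtain ⟨s1, d1, G1⟩ := Src_step ss hg
  obtain ⟨s2, d2, G2⟩ := Src_step ss hg'
  rw [← TT_sub s1 s2]
  have hK : ∀ ω, 0 < K ω := fun ω => zero_lt_one.trans_le (ss.ts.coc.K1 ω)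
  have hd0 := ss.δ0
  have hC0 := ss.C00
  have hCN := ss.CN1
  have hCσ := ss.sat.one
  have o1 : ∀ ω, OB1 (wtt s t i κ) (2 * Cσ ^ 2 * ((C0 + 16 * CN ^ 2 * p) * δ) * d * (K ω ^ 4)⁻¹) univ
      (fderiv ℝ (fun x => Src f N k σ g ω x - Src f N k σ g' ω x)) := fun ω => by
    have := hK ω
    have hS := S_est ss.β0 ss.βη ss.wok (ss.hf ω) ss.CN1 (ss.hN ω) (hg ω)
    have hS' := S_est ss.β0 ss.βη ss.wok (ss.hf ω) ss.CN1 (ss.hN ω) (hg' ω)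
    have := ss.sat.comp1 ss.ts.sn (by positivity) (hS.diff.sub hS'.diff)
      (S_contr ss.β0 ss.βη ss.wok (ss.hf ω) ss.CN1 ss.C00 (ss.hN ω) (hg ω) (hg' ω) hd (h1 ω))
    convert this using 1 <;> first | (ring; done) | rfl
  have M := TT_main ss.ts (h := fun ω x => Src f N k σ g ω x - Src f N k σ g' ω x)
    (c := 2 * Cσ ^ 2 * ((C0 + 16 * CN ^ 2 * p) * δ) * d)
    (by positivity) (fun ω => (d1 ω).sub (d2 ω)) (fun ω => ?_) o1 ω
  · convert M.2.2.1 using 1; unfold Cs; ring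
  · have hs0 : σ 0 = 0 := by
      funext b; have := ss.sat.cb 0 b; simpa using this
    have a1 : g ω 0 = 0 := (hg ω).vi 0 rfl
    have a2 : g' ω 0 = 0 := (hg' ω).vi 0 rfl
    simp [Src, hs0, a1, a2]

noncomputable def git (θ : Equiv.Perm Ω) (B : ℤ → Ω → ∀ b, V b →L[ℝ] V b) (dir : Fin p → Bool)
    (f N k : Ω → (∀ b, V b) → (∀ b, V b)) (σ : (∀ b, V b) → (∀ b, V b)) :
    ℕ → Ω → (∀ b, V b) → (∀ b, V b)
  | 0 => fun _ _ => 0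
  | (n+1) => TT θ B dir (Src f N k σ (git θ B dir f N k σ n))

theorem Cs_nonneg (ss : SS θ B K lam ε s t i κ β γ Λ dir η δ CN C0 Cσ f N k σ) :
    0 ≤ Cs Λ ε γ δ CN C0 Cσ p := by
  have hd0 := ss.δ0
  have hC0 := ss.C00
  have hCN := ss.CN1
  have hCσ := ss.sat.one
  have := (CT_pos (Λ := Λ) (ε := ε) (γ := γ) (by linarith [ss.ts.γε, ss.ts.ε0])).le
  unfold Cs
  positivity

theorem git_GG (ss : SS θ B K lam ε s t i κ β γ Λ dir η δ CN C0 Cσ f N k σ)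
    (hc : Cs Λ ε γ δ CN C0 Cσ p ≤ 1 / 2) (n : ℕ) (ω : Ω) :
    GG s t i κ β (Cs Λ ε γ δ CN C0 Cσ p) univ (git θ B dir f N k σ n ω) := by
  have h0 := Cs_nonneg ss
  induction n generalizing ω with
  | zero =>
    have e : fderiv ℝ (git θ B dir f N k σ 0 ω) = 0 := by
      funext x; exact fderiv_const_apply _
    refine ⟨differentiable_const _, fun _ _ => rfl, fun _ _ => rfl, ?_, ?_⟩
    · rw [e]; intro x _ v
      simpa using mul_nonneg h0 (nm_nonneg (wtt_nonneg (s := s) (t := t) (i := i) (κ := κ) x x) v)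
    · rw [e]; intro x _ y _ v
      have := nm_nonneg (wtt_nonneg (s := s) (t := t) (i := i) (κ := κ) x y) v
      simp; positivity
  | succ n ih =>
    exact (Src_step ss (fun ω => (ih ω).restr ss.ts.sn (by linarith) _)).2.2 ω

theorem git_diff (ss : SS θ B K lam ε s t i κ β γ Λ dir η δ CN C0 Cσ f N k σ)
    (hc : Cs Λ ε γ δ CN C0 Cσ p ≤ 1 / 2) (n : ℕ) (ω : Ω) :
    OB1 (wtt s t i κ) ((1/2) ^ n) univ
      (fderiv ℝ (fun x => git θ B dir f N k σ (n+1) ω x - git θ B dir f N k σ n ω x)) := by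
  have h0 := Cs_nonneg ss
  have G := fun n ω => (git_GG ss hc n ω).restr ss.ts.sn (c' := 1) (by linarith) (closedBall 0 1)
  induction n generalizing ω with
  | zero =>
    have := (git_GG ss hc 1 ω).o1
    simp only [git, sub_zero, pow_zero]
    exact this.mono (wtt_WM ss.ts.sn) (by linarith)
  | succ n ih =>
    have := Src_contr ss (G (n+1)) (G n) (d := (1/2)^n) (by positivity)
      (fun ω x _ v => ih ω x (mem_univ _) v) ω
    refine OB1.mono this (wtt_WM ss.ts.sn) ?_
    rw [pow_succ, mul_comm]; gcongr

theorem solve (ss : SS θ B K lam ε s t i κ β γ Λ dir η δ CN C0 Cσ f N k σ)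
    (hc : Cs Λ ε γ δ CN C0 Cσ p ≤ 1 / 2)
    [MeasurableSpace Ω] [∀ b, MeasurableSpace (V b)] [∀ b, BorelSpace (V b)]
    [∀ b, SecondCountableTopology (V b)]
    (hθ : ∀ m : ℤ, Measurable (θ ^ m : Equiv.Perm Ω))
    (hBm : ∀ n b v, Measurable fun ω => B n ω b v)
    (hfm : ∀ x, Measurable fun ω => f ω x) (hNm : ∀ x, Measurable fun ω => N ω x)
    (hkm : ∀ x, Measurable fun ω => k ω x) :
    ∃ g : Ω → (∀ b, V b) → (∀ b, V b),
      (∀ ω, GG s t i κ β (Cs Λ ε γ δ CN C0 Cσ p) univ (g ω)) ∧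
      (∀ x, Measurable fun ω => g ω x) ∧
      (∀ ω x, g (θ ω) (dg (B 1 ω) x) = dg (B 1 ω) (g ω x) + Src f N k σ g ω x) := by
  have h0 := Cs_nonneg ss
  set G := git θ B dir f N k σ with hG
  have GGn := fun n ω => git_GG ss hc n ω
  have GGb := fun n ω => (git_GG ss hc n ω).restr ss.ts.sn (c' := 1) (by linarith) (closedBall 0 1)
  have GD := fun n ω => git_diff ss hc n ω
  rw [← hG] at GGn GGb GD
  have zero_zero : ∀ n ω, G n ω 0 = 0 := fun n ω => (GGn n ω).vi 0 rfl
  have ser := fun ω => series_lemma (u := fun n x => G (n+1) ω x - G n ω x) (a := fun n => (1/2)^n)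
    (w := wtt s t i κ) (fun n => (GGn (n+1) ω).diff.sub (GGn n ω).diff)
    (fun n => by simp [zero_zero]) (fun n => by positivity)
    (summable_geometric_of_lt_one (by norm_num) (by norm_num)) (wtt_WM ss.ts.sn) (wtt_bdd ss.ts.sn)
    (fun n => GD n ω)
  set g : Ω → (∀ b, V b) → (∀ b, V b) := fun ω x => ∑' n, (G (n+1) ω x - G n ω x) with hg
  have lim : ∀ ω x, Tendsto (fun n => G n ω x) atTop (nhds (g ω x)) := by
    intro ω x
    have := ((ser ω).1 x).hasSum.tendsto_sum_nat
    have e : ∀ n, ∑ i ∈ Finset.range n, (G (i+1) ω x - G i ω x) = G n ω x := fun n => by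
      rw [Finset.sum_range_sub (fun n => G n ω x)]; simp [hG, git]
    simpa only [e] using this
  have dlim : ∀ ω x v, Tendsto (fun n => fderiv ℝ (G n ω) x v) atTop (nhds (fderiv ℝ (g ω) x v)) := by
    intro ω x v
    have := ((ser ω).2.2.2.2 x v).tendsto_sum_nat
    have e1 : ∀ n, fderiv ℝ (fun x => G (n+1) ω x - G n ω x) x v
        = fderiv ℝ (G (n+1) ω) x v - fderiv ℝ (G n ω) x v := fun n => by
      rw [show (fun x => G (n+1) ω x - G n ω x) = G (n+1) ω - G n ω from rfl,
        fderiv_sub ((GGn (n+1) ω).diff x) ((GGn n ω).diff x)]; rfl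
    have e0 : fderiv ℝ (G 0 ω) x v = 0 := by
      have : fderiv ℝ (G 0 ω) x = 0 := by
        have : G 0 ω = fun _ => 0 := rfl
        rw [this]; exact fderiv_const_apply _
      rw [this]; rfl
    have e : ∀ n, ∑ i ∈ Finset.range n, fderiv ℝ (fun x => G (i+1) ω x - G i ω x) x v
        = fderiv ℝ (G n ω) x v := fun n => by
      simp_rw [e1]
      rw [Finset.sum_range_sub (fun n => fderiv ℝ (G n ω) x v), e0, sub_zero]
    simpa only [e] using this
  have gmeas : ∀ n x, Measurable fun ω => G n ω x := by
    intro n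
    induction n with
    | zero => intro x; exact measurable_const
    | succ n ih =>
      obtain ⟨s1, d1, G1⟩ := Src_step ss (GGb n)
      refine TT_meas hθ hBm s1 (fun x => ?_) (fun ω => (d1 ω).continuous)
      unfold Src
      refine (meas_comp hfm (fun ω => (ss.hf ω).diff.continuous) measurable_id
        ((hNm _).add (ih _))).sub (hkm _)
  refine ⟨g, fun ω => ⟨(ser ω).2.1, ?_, ?_, ?_, ?_⟩, ?_, ?_⟩
  · intro x hx; simp [hg, fun n => (GGn n ω).vi x hx]
  · intro x hx; simp [hg, fun n => (GGn n ω).vk x hx]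
  · intro x _ v
    exact le_of_tendsto (dlim ω x v).norm (Eventually.of_forall fun n => (GGn n ω).o1 x (mem_univ _) v)
  · intro x _ y _ v
    exact le_of_tendsto ((dlim ω x v).sub (dlim ω y v)).norm
      (Eventually.of_forall fun n => (GGn n ω).o2 x (mem_univ _) y (mem_univ _) v)
  · intro x
    exact measurable_of_tendsto_metrizable (fun n => gmeas n x) (tendsto_pi_nhds.2 fun ω => lim ω x)
  · intro ω x
    have a1 := (lim (θ ω) (dg (B 1 ω) x)).comp (tendsto_add_atTop_nat 1)
    have a2 := (((dg (B 1 ω)).continuous.tendsto _).comp ((lim ω x).comp (tendsto_add_atTop_nat 1)))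
    have a3 : Tendsto (fun n => Src f N k σ (G n) ω x) atTop (nhds (Src f N k σ g ω x)) := by
      unfold Src
      exact (((ss.hf ω).diff.continuous.tendsto _).comp
        (tendsto_const_nhds.add (lim ω (σ x)))).sub tendsto_const_nhds
    refine tendsto_nhds_unique a1 ((a2.add a3).congr fun n => ?_)
    exact (TT_eq ss.ts.coc (Src_step ss (GGb n)).1 ω x).symm

end solve2
end RB

namespace RB
section ind
variable {p : ℕ} {V : Fin p → Type} [∀ b, NormedAddCommGroup (V b)] [∀ b, NormedSpace ℝ (V b)]
variable {s t : Fin p → ℝ} {β c γ Λ η δ CN C0 Cσ : ℝ} {i κ : Fin p}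
variable {Ω : Type*} {θ : Equiv.Perm Ω} {B : ℤ → Ω → ∀ b, V b →L[ℝ] V b} {K : Ω → ℝ}
  {lam : Fin p → ℝ} {ε : ℝ} {dir : Fin p → Fin p → Fin p → Bool}
  {f : Ω → (∀ b, V b) → (∀ b, V b)} {σ : (∀ b, V b) → (∀ b, V b)}

def OBB (w : (∀ b, V b) → (∀ b, V b) → Fin p → ℝ) (β c : ℝ)
    (A : (∀ b, V b) → (∀ b, V b) →L[ℝ] (∀ b, V b)) : Prop :=
  OB1 w c (closedBall 0 1) A ∧ OB2 w β c (closedBall 0 1) A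

section obb
variable {w w' : (∀ b, V b) → (∀ b, V b) → Fin p → ℝ} {c' : ℝ}
  {A A' : (∀ b, V b) → (∀ b, V b) →L[ℝ] (∀ b, V b)}
theorem OBB.mono (h : OBB w β c A) (hw : WM w) (hc : c ≤ c') : OBB w β c' A :=
  ⟨h.1.mono hw hc, h.2.mono hw hc⟩
theorem OBB.wmono (h : OBB w β c A) (hc : 0 ≤ c) (hw : ∀ x ∈ closedBall (0 : ∀ b, V b) 1,
    ∀ y ∈ closedBall (0 : ∀ b, V b) 1, ∀ b, w x y b ≤ w' x y b) : OBB w' β c A :=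
  ⟨h.1.wmono hc hw, h.2.wmono hc hw⟩
theorem OBB.add (h : OBB w β c A) (h' : OBB w β c' A') : OBB w β (c + c') (fun x => A x + A' x) :=
  ⟨h.1.add h'.1, h.2.add h'.2⟩
theorem OBB.sub (h : OBB w β c A) (h' : OBB w β c' A') : OBB w β (c + c') (fun x => A x - A' x) :=
  ⟨h.1.sub h'.1, h.2.sub h'.2⟩
end obb

/-- indicator weight -/
def ind (S : Finset (Fin p)) (_ _ : ∀ b, V b) (b : Fin p) : ℝ := if b ∈ S then 1 else 0

theorem ind_WM (S : Finset (Fin p)) : WM (V := V) (ind S) where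
  nn := by intro x y b; unfold ind; split_ifs <;> norm_num
  ml := by intro x y b; exact le_rfl
  mr := by intro x y b; exact le_rfl

theorem ind_mono {S S' : Finset (Fin p)} (h : S ⊆ S') (x y : ∀ b, V b) (b : Fin p) :
    ind S x y b ≤ ind S' x y b := by
  unfold ind
  split_ifs with h1 h2
  · exact le_rfl
  · exact absurd (h h1) h2
  · norm_num
  · norm_num

theorem wtt_zero (i κ : Fin p) : wtt (V := V) 0 0 i κ = ind (Finset.Icc i κ) := by
  funext x y b; unfold wtt ind; simp

/-- coordinate projection -/
noncomputable def prS (S : Finset (Fin p)) : (∀ b, V b) →L[ℝ] (∀ b, V b) :=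
  dg (fun b => if b ∈ S then ContinuousLinearMap.id ℝ (V b) else 0)

theorem prS_apply (S : Finset (Fin p)) (x : ∀ b, V b) (b : Fin p) :
    prS S x b = if b ∈ S then x b else 0 := by
  unfold prS; rw [dg_apply]; split_ifs <;> simp

theorem prS_OBB (S : Finset (Fin p)) : OBB (V := V) (ind S) β 1 (fun _ => prS S) := by
  constructor
  · intro x _ v
    rw [one_mul]
    refine (pi_norm_le_iff_of_nonneg (nm_nonneg ((ind_WM S).nn x x) v)).2 fun b => ?_
    rw [prS_apply]
    unfold nm
    calc ‖if b ∈ S then v b else 0‖ = ind S x x b * ‖v b‖ := by unfold ind; split_ifs <;> simp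
      _ ≤ _ := Finset.single_le_sum (f := fun b => ind S x x b * ‖v b‖)
        (fun b _ => mul_nonneg ((ind_WM S).nn x x b) (norm_nonneg _)) (Finset.mem_univ b)
  · intro x _ y _ v
    rw [sub_self, norm_zero]
    have := nm_nonneg ((ind_WM (V := V) S).nn x y) v
    positivity

noncomputable def tw (lam : Fin p → ℝ) (η : ℝ) (i κ b : Fin p) : ℝ :=
  (1 - η) * ((lam b - lam κ) / (lam i - lam κ))
noncomputable def sL (lam : Fin p → ℝ) (η : ℝ) (i κ b : Fin p) : ℝ :=
  (1 - η) * ((lam i - lam b) / (lam i - lam κ))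
noncomputable def sw (lam : Fin p → ℝ) (η : ℝ) (i κ b : Fin p) : ℝ := (1 - η) - tw lam η i κ b

theorem tw_nonneg (ha : StrictAnti lam) (hη : η < 1) (b : Fin p) (hb : b ∈ Finset.Icc i κ) :
    0 ≤ tw lam η i κ b := by
  obtain ⟨h1, h2⟩ := Finset.mem_Icc.1 hb
  have e1 := ha.antitone h1
  have e2 := ha.antitone h2
  exact mul_nonneg (by linarith) (div_nonneg (by linarith) (by linarith))

theorem sL_nonneg (ha : StrictAnti lam) (hη : η < 1) (b : Fin p) (hb : b ∈ Finset.Icc i κ) :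
    0 ≤ sL lam η i κ b := by
  obtain ⟨h1, h2⟩ := Finset.mem_Icc.1 hb
  have e1 := ha.antitone h1
  have e2 := ha.antitone h2
  exact mul_nonneg (by linarith) (div_nonneg (by linarith) (by linarith))

theorem sw_eq (ha : StrictAnti lam) (h : i < κ) : sw lam η i κ = sL lam η i κ := by
  funext b
  have := ha h
  have h0 : lam i - lam κ ≠ 0 := by linarith
  unfold sw sL tw
  field_simp
  ring

theorem sw_nonneg (ha : StrictAnti lam) (hη : η < 1) (b : Fin p) (hb : b ∈ Finset.Icc i κ) :
    0 ≤ sw lam η i κ b := by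
  obtain ⟨h1, h2⟩ := Finset.mem_Icc.1 hb
  rcases (h1.trans h2).lt_or_eq with h | h
  · rw [sw_eq ha h]; exact sL_nonneg ha hη b hb
  · subst h; simp [sw, tw]; exact hη.le

theorem swtw_WOK (ha : StrictAnti lam) (hη : η < 1) : WOK (sw lam η i κ) (tw lam η i κ) η i κ where
  η1 := hη
  sn := fun b hb => ⟨sw_nonneg ha hη b hb, tw_nonneg ha hη b hb⟩
  st := fun b hb => by unfold sw; ring

theorem tw_le (ha : StrictAnti lam) (hη : η < 1) {i' : Fin p} (hi : i ≤ i') (b : Fin p)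
    (hb : b ∈ Finset.Icc i' κ) : tw lam η i κ b ≤ tw lam η i' κ b := by
  obtain ⟨h1, h2⟩ := Finset.mem_Icc.1 hb
  rcases h2.lt_or_eq with h | h
  · have e1 := ha.antitone h1
    have e2 := ha h
    have e3 := ha.antitone hi
    unfold tw
    refine mul_le_mul_of_nonneg_left ?_ (by linarith)
    exact div_le_div_of_nonneg_left (by linarith) (by linarith) (by linarith)
  · subst h; simp [tw]

theorem sL_le (ha : StrictAnti lam) (hη : η < 1) {κ' : Fin p} (hi : κ' ≤ κ) (b : Fin p)
    (hb : b ∈ Finset.Icc i κ') : sL lam η i κ b ≤ sL lam η i κ' b := by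
  obtain ⟨h1, h2⟩ := Finset.mem_Icc.1 hb
  rcases h1.lt_or_eq with h | h
  · have e1 := ha.antitone h2
    have e2 := ha h
    have e3 := ha.antitone hi
    unfold sL
    refine mul_le_mul_of_nonneg_left ?_ (by linarith)
    exact div_le_div_of_nonneg_left (by linarith) (by linarith) (by linarith)
  · subst h; simp [sL]

theorem SN_tw (ha : StrictAnti lam) (hη : η < 1) : SN 0 (tw lam η i κ) i κ :=
  fun b hb => ⟨le_rfl, tw_nonneg ha hη b hb⟩
theorem SN_sL (ha : StrictAnti lam) (hη : η < 1) : SN (sL lam η i κ) 0 i κ :=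
  fun b hb => ⟨sL_nonneg ha hη b hb, le_rfl⟩

/-- constants -/
def CNc (p : ℕ) : ℝ := 4 ^ (p + 1)
noncomputable def C0c (p : ℕ) : ℝ := 24 * (CNc p) ^ 2 * p

structure Gl [MeasurableSpace Ω] [∀ b, MeasurableSpace (V b)]
    (θ : Equiv.Perm Ω) (B : ℤ → Ω → ∀ b, V b →L[ℝ] V b) (K : Ω → ℝ)
    (lam : Fin p → ℝ) (ε η β γ Λ δ Cσ : ℝ) (dir : Fin p → Fin p → Fin p → Bool)
    (f : Ω → (∀ b, V b) → (∀ b, V b)) (σ : (∀ b, V b) → (∀ b, V b)) : Prop where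
  coc : Coc θ B K lam ε
  ε0 : 0 < ε
  anti : StrictAnti lam
  η0 : 0 ≤ η
  η1 : η < 1
  hΛ : ∀ b, |lam b| ≤ Λ
  β0 : 0 < β
  βη : β ≤ η
  βΛ : β * Λ ≤ ε
  γε : 16 * ε ≤ γ
  fw : ∀ i κ, i ≤ κ → ∀ j, dir i κ j = true → ∀ b ∈ Finset.Icc i κ,
    sw lam η i κ b * lam i + tw lam η i κ b * lam κ + lam b - lam j ≤ -γ
  bw : ∀ i κ, i ≤ κ → ∀ j, dir i κ j = false → ∀ b ∈ Finset.Icc i κ,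
    γ ≤ sw lam η i κ b * lam i + tw lam η i κ b * lam κ + lam b - lam j
  sat : Sat σ Cσ β
  δ0 : 0 ≤ δ
  hf : ∀ ω, FF (f ω) (δ * (K ω ^ 4)⁻¹)
  hc : Cs Λ ε γ δ (CNc p) (C0c p) Cσ p ≤ 1 / 2
  hθ : ∀ m : ℤ, Measurable (θ ^ m : Equiv.Perm Ω)
  hBm : ∀ n b v, Measurable fun ω => B n ω b v
  hfm : ∀ x, Measurable fun ω => f ω x

structure Bas [MeasurableSpace Ω] [∀ b, MeasurableSpace (V b)]
    (θ : Equiv.Perm Ω) (B : ℤ → Ω → ∀ b, V b →L[ℝ] V b) (β : ℝ)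
    (f : Ω → (∀ b, V b) → (∀ b, V b)) (σ : (∀ b, V b) → (∀ b, V b))
    (S : Finset (Fin p)) (e : ℝ) (W : Ω → (∀ b, V b) → (∀ b, V b)) : Prop where
  diff : ∀ ω, Differentiable ℝ (W ω)
  z : ∀ ω, W ω 0 = 0
  dz : ∀ ω, fderiv ℝ (W ω) 0 = prS S
  sm : ∀ ω, OBB (ind S) β e (fun x => fderiv ℝ (W ω) x - prS S)
  meas : ∀ x, Measurable fun ω => W ω x
  eqn : ∀ ω x, W (θ ω) (dg (B 1 ω) x) = dg (B 1 ω) (W ω x) + f ω (W ω (σ x))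

structure RL (lam : Fin p → ℝ) (η β : ℝ) (i κ : Fin p) (R : ℝ)
    (W Wr Wl : Ω → (∀ b, V b) → (∀ b, V b)) : Prop where
  rd : ∀ ω, OBB (wtt 0 (tw lam η i κ) i κ) β R (fun x => fderiv ℝ (W ω) x - fderiv ℝ (Wr ω) x)
  rv : ∀ ω x, x κ = 0 → W ω x = Wr ω x
  ld : ∀ ω, OBB (wtt (sL lam η i κ) 0 i κ) β R (fun x => fderiv ℝ (W ω) x - fderiv ℝ (Wl ω) x)
  lv : ∀ ω x, x i = 0 → W ω x = Wl ω x

theorem Bas.tot [MeasurableSpace Ω] [∀ b, MeasurableSpace (V b)] {S : Finset (Fin p)} {e : ℝ}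
    {W : Ω → (∀ b, V b) → (∀ b, V b)} (h : Bas θ B β f σ S e W) (ω : Ω) :
    OBB (ind S) β (e + 1) (fun x => fderiv ℝ (W ω) x) := by
  have := (h.sm ω).add (prS_OBB S)
  simpa using this

end ind
end RB

namespace RB
section ind2
variable {p : ℕ} {V : Fin p → Type} [∀ b, NormedAddCommGroup (V b)] [∀ b, NormedSpace ℝ (V b)]
variable {β γ Λ η δ Cσ : ℝ} {i κ : Fin p}
variable {Ω : Type*} {θ : Equiv.Perm Ω} {B : ℤ → Ω → ∀ b, V b →L[ℝ] V b} {K : Ω → ℝ}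
  {lam : Fin p → ℝ} {ε : ℝ} {dir : Fin p → Fin p → Fin p → Bool}
  {f N k : Ω → (∀ b, V b) → (∀ b, V b)} {σ : (∀ b, V b) → (∀ b, V b)}

theorem CNc_ge (p : ℕ) : (1:ℝ) ≤ CNc p := one_le_pow₀ (by norm_num)
theorem CNc_ge_p (p : ℕ) : (p:ℝ) + 2 ≤ CNc p := by
  unfold CNc
  induction p with
  | zero => norm_num
  | succ n ih => rw [pow_succ]; push_cast; linarith [n.cast_nonneg (α := ℝ)]
theorem C0c_nonneg (p : ℕ) : 0 ≤ C0c p := by unfold C0c; positivity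

theorem wtt_at_zero {s t : Fin p → ℝ} (wok : WOK s t η i κ) (b : Fin p) :
    wtt (V := V) s t i κ 0 0 b = 0 := by
  unfold wtt
  split_ifs with hb
  · have h1 := wok.st b hb
    have h2 := wok.sn b hb
    have h3 := wok.η1
    have e : ∀ i : Fin p, mx i (0 : ∀ b, V b) 0 = 0 := fun i => by simp [mx]
    rw [e, e]
    by_cases hs : s b = 0
    · have : t b ≠ 0 := by intro h; rw [hs, h] at h1; linarith
      rw [Real.zero_rpow this, mul_zero]
    · rw [Real.zero_rpow hs, zero_mul]
  · rfl

theorem corr [∀ b, CompleteSpace (V b)] [MeasurableSpace Ω] [∀ b, MeasurableSpace (V b)]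
    [∀ b, BorelSpace (V b)] [∀ b, SecondCountableTopology (V b)]
    (gl : Gl θ B K lam ε η β γ Λ δ Cσ dir f σ) (hi : i ≤ κ)
    (hN : ∀ ω, NN (sw lam η i κ) (tw lam η i κ) i κ β (CNc p) (C0c p) (δ * (K ω ^ 4)⁻¹)
      (f ω) (N ω) (k ω)) (hNm : ∀ x, Measurable fun ω => N ω x)
    (hkm : ∀ x, Measurable fun ω => k ω x) :
    ∃ g : Ω → (∀ b, V b) → (∀ b, V b),
      (∀ ω, Differentiable ℝ (g ω)) ∧ (∀ ω x, x i = 0 → g ω x = 0) ∧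
      (∀ ω x, x κ = 0 → g ω x = 0) ∧ (∀ ω, fderiv ℝ (g ω) 0 = 0) ∧
      (∀ ω, OBB (wtt (sw lam η i κ) (tw lam η i κ) i κ) β
        (Cs Λ ε γ δ (CNc p) (C0c p) Cσ p) (fderiv ℝ (g ω))) ∧
      (∀ x, Measurable fun ω => g ω x) ∧
      (∀ ω x, g (θ ω) (dg (B 1 ω) x) = dg (B 1 ω) (g ω x) +
        (f ω (N ω (σ x) + g ω (σ x)) - k ω (σ x))) := by
  have wok : WOK (sw lam η i κ) (tw lam η i κ) η i κ := swtw_WOK gl.anti gl.η1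
  have ss : SS θ B K lam ε (sw lam η i κ) (tw lam η i κ) i κ β γ Λ (dir i κ) η δ (CNc p) (C0c p) Cσ
      f N k σ :=
    { ts := ⟨gl.coc, gl.ε0, wok.sn, fun b hb => by rw [wok.st b hb]; linarith [gl.η0], gl.hΛ,
        gl.β0.le, (gl.βη.trans gl.η1.le), gl.βΛ, gl.γε, gl.fw i κ hi, gl.bw i κ hi⟩
      β0 := gl.β0
      βη := gl.βη
      wok := wok
      sat := gl.sat
      δ0 := gl.δ0
      CN1 := CNc_ge p
      C00 := C0c_nonneg p
      hf := gl.hf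
      hN := hN }
  obtain ⟨g, hg, hm, he⟩ := solve ss gl.hc gl.hθ gl.hBm gl.hfm hNm hkm
  refine ⟨g, fun ω => (hg ω).diff, fun ω => (hg ω).vi, fun ω => (hg ω).vk, fun ω => ?_,
    fun ω => ⟨fun x _ v => (hg ω).o1 x (mem_univ _) v,
      fun x _ y _ v => (hg ω).o2 x (mem_univ _) y (mem_univ _) v⟩, hm, he⟩
  ext v : 1
  have := (hg ω).o1 0 (mem_univ _) v
  have e : nm (wtt (V := V) (sw lam η i κ) (tw lam η i κ) i κ 0 0) v = 0 := by
    unfold nm; simp [wtt_at_zero wok]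
  rw [e, mul_zero] at this
  exact norm_le_zero_iff.1 this

theorem Icc_self_S (i : Fin p) : Finset.Icc i i = {i} := Finset.Icc_self i

/-- base case -/
theorem base_step [∀ b, CompleteSpace (V b)] [MeasurableSpace Ω] [∀ b, MeasurableSpace (V b)]
    [∀ b, BorelSpace (V b)] [∀ b, SecondCountableTopology (V b)]
    (gl : Gl θ B K lam ε η β γ Λ δ Cσ dir f σ) (i : Fin p) :
    ∃ W : Ω → (∀ b, V b) → (∀ b, V b),
      Bas θ B β f σ (Finset.Icc i i) (Cs Λ ε γ δ (CNc p) (C0c p) Cσ p) W ∧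
      RL lam η β i i 2 W (fun _ _ => 0) (fun _ _ => 0) := by
  set c := Cs Λ ε γ δ (CNc p) (C0c p) Cσ p with hcdef
  have wok : WOK (sw lam η i i) (tw lam η i i) η i i := swtw_WOK gl.anti gl.η1
  set P : (∀ b, V b) →L[ℝ] (∀ b, V b) := prS (Finset.Icc i i) with hP
  have hPn : ∀ x : ∀ b, V b, ‖P x‖ ≤ ‖x i‖ := by
    intro x
    refine (pi_norm_le_iff_of_nonneg (norm_nonneg _)).2 fun b => ?_
    rw [hP, prS_apply]
    split_ifs with h
    · have : b = i := by simpa using h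
      subst this; exact le_rfl
    · simp
  have hPd : fderiv ℝ (fun x : ∀ b, V b => P x) = fun _ => P := by funext x; exact P.fderiv
  have hPo : OBB (wtt 0 0 i i) β 1 (fun _ => P) := by rw [wtt_zero]; exact prS_OBB _
  have hNN : ∀ ω, NN (sw lam η i i) (tw lam η i i) i i β (CNc p) (C0c p) (δ * (K ω ^ 4)⁻¹)
      (f ω) (fun x => P x) (fun _ => 0) := by
    intro ω
    have hf := gl.hf ω
    set M := δ * (K ω ^ 4)⁻¹
    have hM : 0 ≤ M := hf.M0
    have hp := one_le_p i
    have hCN := CNc_ge p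
    have hz : ∀ x : ∀ b, V b, x i = 0 → f ω (P x) - 0 = 0 := fun x hx => by
      have : P x = 0 := norm_le_zero_iff.1 ((hPn x).trans (by rw [hx, norm_zero]))
      rw [this, hf.z, sub_zero]
    obtain ⟨q0, q1, q2⟩ := Qmin_facts (V := V) i i
    have PQ := prodQ (a := 2 * M) (c := 1) (w := wtt 0 0 i i)
      (w' := wtt (sw lam η i i) (tw lam η i i) i i) (U := fun x => fderiv ℝ (f ω) (P x))
      (A := fun _ => P) (by positivity) zero_le_one gl.β0 (gl.βη.trans_lt gl.η1) q0 q1 q2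
      (by
        intro x hx
        have e1 := hf.nrm (P x)
        have e2 := mul_le_mul_of_nonneg_left (hPn x) hM
        have e3 : min (mx i x x) (mx i x x) = ‖x i‖ := by simp [mx]
        rw [e3]; linarith)
      (by
        intro x hx y hy
        have e1 := hf.lip (P x) (P y)
        rw [← map_sub] at e1
        have e2 := mul_le_mul_of_nonneg_left ((hPn (x - y)).trans (norm_le_pi_norm _ i)) hM
        have := mul_nonneg hM (norm_nonneg (x - y))
        linarith)
      (fun x hx y hy b => wtt_P1 wok gl.βη hx hy b) (wtt_WM (SN_zero i i)) (wtt_WM wok.sn)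
      hPo.1 hPo.2
    have hd : fderiv ℝ (fun x => f ω (P x) - 0) = fun x => (fderiv ℝ (f ω) (P x)).comp P := by
      funext x
      simp only [sub_zero]
      exact ((hf.diff _).hasFDerivAt.comp x P.hasFDerivAt).fderiv
    have hcst : 2 * (2 * M * 1) ≤ C0c p * M := by
      have : 4 ≤ C0c p := by unfold C0c; nlinarith
      nlinarith
    refine ⟨P.differentiable, map_zero _, ?_, ?_, differentiable_const _, ?_, ?_, hz, hz⟩
    · rw [hPd]; exact hPo.1.mono (wtt_WM (SN_zero i i)) hCN
    · rw [hPd]; exact hPo.2.mono (wtt_WM (SN_zero i i)) hCN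
    · rw [hd]; exact PQ.1.mono (wtt_WM wok.sn) hcst
    · rw [hd]; exact PQ.2.mono (wtt_WM wok.sn) hcst
  obtain ⟨g, gd, gv, _, gz, go, gm, ge⟩ := corr gl le_rfl hNN (fun x => measurable_const)
    (fun x => measurable_const)
  have hWd : ∀ ω x, fderiv ℝ (fun x => P x + g ω x) x = P + fderiv ℝ (g ω) x := fun ω x =>
    (P.hasFDerivAt.add (gd ω x).hasFDerivAt).fderiv
  have c1 : c ≤ 1 := by linarith [gl.hc]
  have g00 : ∀ ω, OBB (wtt 0 0 i i) β 1 (fderiv ℝ (g ω)) := fun ω =>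
    ((go ω).mono (wtt_WM wok.sn) c1).wmono zero_le_one
      (fun x hx y hy b => wtt_le_zero wok.sn hx hy b)
  have tot : ∀ ω, OBB (wtt 0 0 i i) β 2 (fun x => P + fderiv ℝ (g ω) x) := fun ω => by
    have := hPo.add (g00 ω); norm_num at this; exact this
  have cpos : OBB (wtt 0 0 i i) β 1 (fun _ => (0 : (∀ b, V b) →L[ℝ] (∀ b, V b))) → True := fun _ => trivial
  have hd0 : ∀ x, fderiv ℝ (fun _ : (∀ b, V b) => (0 : ∀ b, V b)) x = 0 := fun x => fderiv_const_apply _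
  refine ⟨fun ω x => P x + g ω x, ⟨?_, ?_, ?_, ?_, ?_, ?_⟩, ⟨?_, ?_, ?_, ?_⟩⟩
  · exact fun ω => P.differentiable.add (gd ω)
  · intro ω; simp [gv ω 0 rfl]
  · intro ω; rw [hWd, gz, add_zero]
  · intro ω
    have hc0 : 0 ≤ c := by
      have h1 := gl.δ0
      have h2 := C0c_nonneg p
      have h3 := gl.sat.one
      have h4 := (CT_pos (Λ := Λ) (ε := ε) (γ := γ) (by linarith [gl.γε, gl.ε0])).le
      rw [hcdef]; unfold Cs; positivity
    simp only [hWd, ← hP, add_sub_cancel_left]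
    rw [← wtt_zero]
    exact (go ω).wmono hc0 (fun x hx y hy b => wtt_le_zero wok.sn hx hy b)
  · intro x; exact measurable_const.add (gm x)
  · intro ω x
    rw [ge, map_add, sub_zero, ← add_assoc]
    congr 2
    funext b
    simp only [hP, prS_apply, dg_apply]
    split_ifs <;> simp
  · intro ω
    simp only [hWd, hd0, sub_zero]
    have : tw lam η i i = 0 := by funext b; simp [tw]
    rw [this]; exact tot ω
  · intro ω x hx
    rw [gv ω x hx, add_zero]; exact norm_le_zero_iff.1 ((hPn x).trans (by rw [hx, norm_zero]))
  · intro ω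
    simp only [hWd, hd0, sub_zero]
    have : sL lam η i i = 0 := by funext b; simp [sL]
    rw [this]; exact tot ω
  · intro ω x hx
    rw [gv ω x hx, add_zero]; exact norm_le_zero_iff.1 ((hPn x).trans (by rw [hx, norm_zero]))

end ind2
end RB

namespace RB
section ind3
variable {p : ℕ} {V : Fin p → Type} [∀ b, NormedAddCommGroup (V b)] [∀ b, NormedSpace ℝ (V b)]
variable {β γ Λ η δ Cσ : ℝ} {i κ i' κ' : Fin p}
variable {Ω : Type*} {θ : Equiv.Perm Ω} {B : ℤ → Ω → ∀ b, V b →L[ℝ] V b} {K : Ω → ℝ}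
  {lam : Fin p → ℝ} {ε : ℝ} {dir : Fin p → Fin p → Fin p → Bool}
  {f : Ω → (∀ b, V b) → (∀ b, V b)} {σ : (∀ b, V b) → (∀ b, V b)}

theorem lip_box {W : (∀ b, V b) → (∀ b, V b)} {S : Finset (Fin p)} {e : ℝ} (hd : Differentiable ℝ W)
    (he : 0 ≤ e) (h : OBB (ind S) β e (fun x => fderiv ℝ W x)) (x : ∀ b, V b)
    (hx : x ∈ closedBall (0 : ∀ b, V b) 1)
    (y : ∀ b, V b) (hy : y ∈ closedBall (0 : ∀ b, V b) 1) : ‖W x - W y‖ ≤ e * p * ‖x - y‖ :=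
  mvt_lip hd h.1 he (fun x hx b => by unfold ind; split_ifs <;> norm_num) x hx y hy

theorem prS_incl (i κ : Fin p) (h : i < κ) : (prS (Finset.Icc i κ) : (∀ b, V b) →L[ℝ] (∀ b, V b)) =
    prS (Finset.Ioc i κ) + prS (Finset.Ico i κ) - prS (Finset.Ioo i κ) := by
  ext x b
  simp only [ContinuousLinearMap.sub_apply, ContinuousLinearMap.add_apply, Pi.sub_apply, Pi.add_apply,
    prS_apply, Finset.mem_Icc, Finset.mem_Ioc, Finset.mem_Ico, Finset.mem_Ioo]
  rcases lt_trichotomy b i with h1 | h1 | h1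
  · simp [h1.not_ge, h1.not_gt]
  · subst h1; simp [h, h.le]
  · rcases lt_trichotomy b κ with h2 | h2 | h2
    · simp [h1, h1.le, h2, h2.le]
    · subst h2; simp [h1, h1.le]
    · simp [h2.not_ge, h2.not_gt]

/-- fibrewise source estimate in the inductive step -/
theorem NN_step (ha : StrictAnti lam) (hη : η < 1) (hβ0 : 0 < β) (hβη : β ≤ η) {M R e0 e1 : ℝ}
    (hik : i < κ) (hi' : Finset.Icc i' κ = Finset.Ioc i κ) (hii' : i ≤ i')
    (hk' : Finset.Icc i κ' = Finset.Ico i κ) (hkk' : κ' ≤ κ)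
    {F : (∀ b, V b) → (∀ b, V b)} (hf : FF F M)
    {A B' C : (∀ b, V b) → (∀ b, V b)} (hA : Differentiable ℝ A) (hB : Differentiable ℝ B')
    (hC : Differentiable ℝ C) (A0 : A 0 = 0) (B0 : B' 0 = 0) (C0 : C 0 = 0)
    (hR0 : 0 ≤ R) (hR : R ≤ CNc p) (he0 : 0 ≤ e0) (he1 : 0 ≤ e1) (hee : 2 * e1 + e0 + 1 ≤ CNc p)
    (sA : OBB (ind (Finset.Ioc i κ)) β e1 (fun x => fderiv ℝ A x - prS (Finset.Ioc i κ)))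
    (sB : OBB (ind (Finset.Ico i κ)) β e1 (fun x => fderiv ℝ B' x - prS (Finset.Ico i κ)))
    (sC : OBB (ind (Finset.Ioo i κ)) β e0 (fun x => fderiv ℝ C x - prS (Finset.Ioo i κ)))
    (rd : OBB (wtt 0 (tw lam η i' κ) i' κ) β R (fun x => fderiv ℝ A x - fderiv ℝ C x))
    (rv : ∀ x, x κ = 0 → A x = C x)
    (ld : OBB (wtt (sL lam η i κ') 0 i κ') β R (fun x => fderiv ℝ B' x - fderiv ℝ C x))
    (lv : ∀ x, x i = 0 → B' x = C x) :
    NN (sw lam η i κ) (tw lam η i κ) i κ β (CNc p) (C0c p) M F (fun x => A x + B' x - C x)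
      (fun x => F (A x) + F (B' x) - F (C x)) := by
  have hM := hf.M0
  have hp := one_le_p i
  have hCN := CNc_ge p
  have wok : WOK (sw lam η i κ) (tw lam η i κ) η i κ := swtw_WOK ha hη
  have hβ1 := hβη.trans_lt hη
  have sub1 : Finset.Ioc i κ ⊆ Finset.Icc i κ := Finset.Ioc_subset_Icc_self
  have sub2 : Finset.Ico i κ ⊆ Finset.Icc i κ := Finset.Ico_subset_Icc_self
  have sub3 : Finset.Ioo i κ ⊆ Finset.Icc i κ := Finset.Ioo_subset_Icc_self
  have dN : ∀ x, HasFDerivAt (fun x => A x + B' x - C x) (fderiv ℝ A x + fderiv ℝ B' x - fderiv ℝ C x) x :=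
    fun x => ((hA x).hasFDerivAt.add (hB x).hasFDerivAt).sub (hC x).hasFDerivAt
  have hNd : Differentiable ℝ (fun x => A x + B' x - C x) := fun x => (dN x).differentiableAt
  have totN : OBB (ind (Finset.Icc i κ)) β (CNc p) (fun x => fderiv ℝ (fun x => A x + B' x - C x) x) := by
    have h1 := (((sA.wmono he1 fun x _ y _ b => ind_mono sub1 x y b).add
      (sB.wmono he1 fun x _ y _ b => ind_mono sub2 x y b)).sub
      (sC.wmono he0 fun x _ y _ b => ind_mono sub3 x y b)).add (prS_OBB (Finset.Icc i κ))
    have h2 := h1.mono (c' := CNc p) (ind_WM _) (by linarith)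
    convert h2 using 2 with x
    rw [(dN x).fderiv, prS_incl i κ hik]
    abel
  have totA : OBB (ind (Finset.Ioc i κ)) β (CNc p) (fun x => fderiv ℝ A x) := by
    have := (sA.add (prS_OBB _)).mono (c' := CNc p) (ind_WM _) (by linarith)
    simpa using this
  have totB : OBB (ind (Finset.Ico i κ)) β (CNc p) (fun x => fderiv ℝ B' x) := by
    have := (sB.add (prS_OBB _)).mono (c' := CNc p) (ind_WM _) (by linarith)
    simpa using this
  have totC : OBB (ind (Finset.Ioo i κ)) β (CNc p) (fun x => fderiv ℝ C x) := by
    have := (sC.add (prS_OBB _)).mono (c' := CNc p) (ind_WM _) (by linarith)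
    simpa using this
  have lN := lip_box hNd (by linarith) totN
  have lA := lip_box hA (by linarith) totA
  have lB := lip_box hB (by linarith) totB
  have lC := lip_box hC (by linarith) totC
  have ba : ∀ x ∈ closedBall (0 : ∀ b, V b) 1, ‖A x - C x‖ ≤ R * mx κ x x := by
    intro x hx
    have := mvt_single (g := fun x => A x - C x) (hA.sub hC) (c := R) (w := wtt 0 (tw lam η i' κ) i' κ)
      (by
        rw [show fderiv ℝ (fun x => A x - C x) = fun x => fderiv ℝ A x - fderiv ℝ C x from
          funext fun x => fderiv_fun_sub (hA x) (hC x)]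
        exact rd.1) hR0 (fun x hx b => wtt_le_one (SN_tw ha hη) hx hx b) κ
      (fun x hx => by rw [rv x hx, sub_self]) x hx
    simpa [mx] using this
  have bb : ∀ x ∈ closedBall (0 : ∀ b, V b) 1, ‖B' x - C x‖ ≤ R * mx i x x := by
    intro x hx
    have := mvt_single (g := fun x => B' x - C x) (hB.sub hC) (c := R) (w := wtt (sL lam η i κ') 0 i κ')
      (by
        rw [show fderiv ℝ (fun x => B' x - C x) = fun x => fderiv ℝ B' x - fderiv ℝ C x from
          funext fun x => fderiv_fun_sub (hB x) (hC x)]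
        exact ld.1) hR0 (fun x hx b => wtt_le_one (SN_sL ha hη) hx hx b) i
      (fun x hx => by rw [lv x hx, sub_self]) x hx
    simpa [mx] using this
  have rdw : OBB (wtt 0 (tw lam η i κ) i κ) β (CNc p) (fun x => fderiv ℝ A x - fderiv ℝ C x) := by
    refine (rd.wmono hR0 fun x hx y hy b => ?_).mono (wtt_WM (SN_tw ha hη)) hR
    refine wtt_exp_mono (SN_tw ha hη) (by rw [hi']; exact sub1) (fun b hb => Or.inr ⟨rfl, le_rfl⟩)
      (fun b hb => Or.inl ⟨rfl, tw_le ha hη hii' b hb⟩) hx hy b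
  have ldw : OBB (wtt (sw lam η i κ) 0 i κ) β (CNc p) (fun x => fderiv ℝ B' x - fderiv ℝ C x) := by
    rw [sw_eq ha hik]
    refine (ld.wmono hR0 fun x hx y hy b => ?_).mono (wtt_WM (SN_sL ha hη)) hR
    refine wtt_exp_mono (SN_sL ha hη) (by rw [hk']; exact sub2)
      (fun b hb => Or.inl ⟨rfl, sL_le ha hη hkk' b hb⟩) (fun b hb => Or.inr ⟨rfl, le_rfl⟩) hx hy b
  have totCw : OBB (wtt 0 0 i κ) β (CNc p) (fun x => fderiv ℝ C x) := by
    rw [wtt_zero]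
    exact totC.wmono (by linarith) fun x _ y _ b => ind_mono sub3 x y b
  set G := fderiv ℝ F with hG
  have hCp : CNc p * 1 ≤ CNc p * p := by gcongr
  have hRp : R * M ≤ CNc p * p * M := by
    have : R ≤ CNc p * p := by linarith
    gcongr
  have lN' : ∀ x ∈ closedBall (0 : ∀ b, V b) 1, ∀ y ∈ closedBall (0 : ∀ b, V b) 1,
      ‖G (A x + B' x - C x) - G (A y + B' y - C y)‖ ≤ CNc p * p * M * ‖x - y‖ := fun x hx y hy =>
    (hf.lip _ _).trans (by have := mul_le_mul_of_nonneg_left (lN x hx y hy) hM; linarith)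
  have lA' : ∀ x ∈ closedBall (0 : ∀ b, V b) 1, ∀ y ∈ closedBall (0 : ∀ b, V b) 1,
      ‖G (A x) - G (A y)‖ ≤ CNc p * p * M * ‖x - y‖ := fun x hx y hy =>
    (hf.lip _ _).trans (by have := mul_le_mul_of_nonneg_left (lA x hx y hy) hM; linarith)
  have lB' : ∀ x ∈ closedBall (0 : ∀ b, V b) 1, ∀ y ∈ closedBall (0 : ∀ b, V b) 1,
      ‖G (B' x) - G (B' y)‖ ≤ CNc p * p * M * ‖x - y‖ := fun x hx y hy =>
    (hf.lip _ _).trans (by have := mul_le_mul_of_nonneg_left (lB x hx y hy) hM; linarith)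
  have lC' : ∀ x ∈ closedBall (0 : ∀ b, V b) 1, ∀ y ∈ closedBall (0 : ∀ b, V b) 1,
      ‖G (C x) - G (C y)‖ ≤ CNc p * p * M * ‖x - y‖ := fun x hx y hy =>
    (hf.lip _ _).trans (by have := mul_le_mul_of_nonneg_left (lC x hx y hy) hM; linarith)
  -- the difference bounds
  have dNA : ∀ x ∈ closedBall (0 : ∀ b, V b) 1, ‖G (A x + B' x - C x) - G (A x)‖ ≤ CNc p * p * M * mx i x x := by
    intro x hx
    have e := hf.lip (A x + B' x - C x) (A x)
    rw [show A x + B' x - C x - A x = B' x - C x by abel] at e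
    have e2 := mul_le_mul_of_nonneg_left (bb x hx) hM
    have e3 := mul_le_mul_of_nonneg_right hRp (mx_nonneg i x x)
    linarith
  have dBC : ∀ x ∈ closedBall (0 : ∀ b, V b) 1, ‖G (B' x) - G (C x)‖ ≤ CNc p * p * M * mx i x x := by
    intro x hx
    have e := hf.lip (B' x) (C x)
    have e2 := mul_le_mul_of_nonneg_left (bb x hx) hM
    have e3 := mul_le_mul_of_nonneg_right hRp (mx_nonneg i x x)
    linarith
  have dNB : ∀ x ∈ closedBall (0 : ∀ b, V b) 1, ‖G (A x + B' x - C x) - G (B' x)‖ ≤ CNc p * p * M * mx κ x x := by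
    intro x hx
    have e := hf.lip (A x + B' x - C x) (B' x)
    rw [show A x + B' x - C x - B' x = A x - C x by abel] at e
    have e2 := mul_le_mul_of_nonneg_left (ba x hx) hM
    have e3 := mul_le_mul_of_nonneg_right hRp (mx_nonneg κ x x)
    linarith
  have dAC : ∀ x ∈ closedBall (0 : ∀ b, V b) 1, ‖G (A x) - G (C x)‖ ≤ CNc p * p * M * mx κ x x := by
    intro x hx
    have e := hf.lip (A x) (C x)
    have e2 := mul_le_mul_of_nonneg_left (ba x hx) hM
    have e3 := mul_le_mul_of_nonneg_right hRp (mx_nonneg κ x x)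
    linarith
  have hcp0 : 0 ≤ CNc p * p * M := by positivity
  have T1 := prodQ (a := 4 * (CNc p * p * M)) (c := CNc p) (w := wtt 0 (tw lam η i κ) i κ)
    (w' := wtt (sw lam η i κ) (tw lam η i κ) i κ) (Q := fun x y => mx i x y)
    (U := fun x => G (A x + B' x - C x) - G (A x))
    (by positivity) (by linarith) hβ0 hβ1 (fun x y => mx_nonneg i x y)
    (fun x hx y hy => mx_le_one i hx hy) (fun x y => by simp [mx])
    (fun x hx => by
      have e1 := dNA x hx
      have := mul_nonneg hcp0 (mx_nonneg i x x)
      linarith)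
    (fun x hx y hy => by
      have e1 := lN' x hx y hy
      have e2 := lA' x hx y hy
      rw [sub_sub_sub_comm]
      have := norm_sub_le (G (A x + B' x - C x) - G (A y + B' y - C y)) (G (A x) - G (A y))
      have := mul_nonneg hcp0 (norm_nonneg (x - y))
      linarith)
    (fun x hx y hy b => wtt_P2 wok hβη hx hy b) (wtt_WM (SN_tw ha hη)) (wtt_WM wok.sn) rdw.1 rdw.2
  have T2 := prodQ (a := 4 * (CNc p * p * M)) (c := CNc p) (w := wtt (sw lam η i κ) 0 i κ)
    (w' := wtt (sw lam η i κ) (tw lam η i κ) i κ) (Q := fun x y => mx κ x y)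
    (U := fun x => G (A x + B' x - C x) - G (B' x))
    (by positivity) (by linarith) hβ0 hβ1 (fun x y => mx_nonneg κ x y)
    (fun x hx y hy => mx_le_one κ hx hy) (fun x y => by simp [mx])
    (fun x hx => by
      have e1 := dNB x hx
      have := mul_nonneg hcp0 (mx_nonneg κ x x)
      linarith)
    (fun x hx y hy => by
      have e1 := lN' x hx y hy
      have e2 := lB' x hx y hy
      rw [sub_sub_sub_comm]
      have := norm_sub_le (G (A x + B' x - C x) - G (A y + B' y - C y)) (G (B' x) - G (B' y))
      have := mul_nonneg hcp0 (norm_nonneg (x - y))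
      linarith)
    (fun x hx y hy b => wtt_P3 wok hβη hx hy b)
    (wtt_WM (by rw [sw_eq ha hik]; exact SN_sL ha hη)) (wtt_WM wok.sn) ldw.1 ldw.2
  obtain ⟨q0, q1, q2⟩ := Qmin_facts (V := V) i κ
  have T3 := prodQ (a := 4 * (CNc p * p * M)) (c := CNc p) (w := wtt 0 0 i κ)
    (w' := wtt (sw lam η i κ) (tw lam η i κ) i κ)
    (U := fun x => (G (A x + B' x - C x) - G (A x)) - (G (B' x) - G (C x)))
    (by positivity) (by linarith) hβ0 hβ1 q0 q1 q2
    (fun x hx => by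
      have n1 := norm_sub_le (G (A x + B' x - C x) - G (A x)) (G (B' x) - G (C x))
      have n2 := norm_sub_le (G (A x + B' x - C x) - G (B' x)) (G (A x) - G (C x))
      rw [sub_sub_sub_comm] at n2
      rcases min_cases (mx i x x) (mx κ x x) with h | h
      · rw [h.1]; linarith [dNA x hx, dBC x hx]
      · rw [h.1]; linarith [dNB x hx, dAC x hx])
    (fun x hx y hy => by
      have n1 := norm_sub_le ((G (A x + B' x - C x) - G (A y + B' y - C y)) - (G (A x) - G (A y)))
        ((G (B' x) - G (B' y)) - (G (C x) - G (C y)))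
      have n2 := norm_sub_le (G (A x + B' x - C x) - G (A y + B' y - C y)) (G (A x) - G (A y))
      have n3 := norm_sub_le (G (B' x) - G (B' y)) (G (C x) - G (C y))
      rw [show (G (A x + B' x - C x) - G (A x) - (G (B' x) - G (C x)) -
        (G (A y + B' y - C y) - G (A y) - (G (B' y) - G (C y)))) = ((G (A x + B' x - C x) - G (A y + B' y - C y)) - (G (A x) - G (A y))) -
        ((G (B' x) - G (B' y)) - (G (C x) - G (C y))) by abel]
      linarith [lN' x hx y hy, lA' x hx y hy, lB' x hx y hy, lC' x hx y hy])
    (fun x hx y hy b => wtt_P1 wok hβη hx hy b)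
    (wtt_WM (SN_zero i κ)) (wtt_WM wok.sn) totCw.1 totCw.2
  have hkd : ∀ x, HasFDerivAt (fun x => F (A x) + F (B' x) - F (C x))
      ((G (A x)).comp (fderiv ℝ A x) + (G (B' x)).comp (fderiv ℝ B' x)
        - (G (C x)).comp (fderiv ℝ C x)) x := fun x =>
    (((hf.diff _).hasFDerivAt.comp x (hA x).hasFDerivAt).add
      ((hf.diff _).hasFDerivAt.comp x (hB x).hasFDerivAt)).sub
      ((hf.diff _).hasFDerivAt.comp x (hC x).hasFDerivAt)
  have hSd : ∀ x, fderiv ℝ (fun x => F (A x + B' x - C x) - (F (A x) + F (B' x) - F (C x))) x =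
      (G (A x + B' x - C x) - G (A x)).comp (fderiv ℝ A x - fderiv ℝ C x)
      + (G (A x + B' x - C x) - G (B' x)).comp (fderiv ℝ B' x - fderiv ℝ C x)
      + ((G (A x + B' x - C x) - G (A x)) - (G (B' x) - G (C x))).comp (fderiv ℝ C x) := by
    intro x
    have e : HasFDerivAt (fun x => F (A x + B' x - C x) - (F (A x) + F (B' x) - F (C x))) _ x :=
      ((hf.diff _).hasFDerivAt.comp x (dN x)).sub (hkd x)
    rw [e.fderiv]
    ext v : 1
    simp [map_add, map_sub, ← hG]
    abel
  have hcst : 2 * (4 * (CNc p * p * M) * CNc p) + 2 * (4 * (CNc p * p * M) * CNc p)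
      + 2 * (4 * (CNc p * p * M) * CNc p) ≤ C0c p * M := by unfold C0c; nlinarith
  refine ⟨hNd, by simp [A0, B0, C0], ?_, ?_, fun x => (hkd x).differentiableAt, ?_, ?_, ?_, ?_⟩
  · rw [wtt_zero]; exact totN.1
  · rw [wtt_zero]; exact totN.2
  · rw [show fderiv ℝ (fun x => F (A x + B' x - C x) - (F (A x) + F (B' x) - F (C x))) = _ from funext hSd]
    exact ((T1.1.add T2.1).add T3.1).mono (wtt_WM wok.sn) hcst
  · rw [show fderiv ℝ (fun x => F (A x + B' x - C x) - (F (A x) + F (B' x) - F (C x))) = _ from funext hSd]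
    exact ((T1.2.add T2.2).add T3.2).mono (wtt_WM wok.sn) hcst
  · intro x hx; rw [lv x hx]; simp
  · intro x hx; rw [rv x hx]; simp

end ind3
end RB

namespace RB
section ind4
variable {p : ℕ} {V : Fin p → Type} [∀ b, NormedAddCommGroup (V b)] [∀ b, NormedSpace ℝ (V b)]
variable {β γ Λ η δ Cσ : ℝ} {i κ i' κ' : Fin p}
variable {Ω : Type*} {θ : Equiv.Perm Ω} {B : ℤ → Ω → ∀ b, V b →L[ℝ] V b} {K : Ω → ℝ}
  {lam : Fin p → ℝ} {ε : ℝ} {dir : Fin p → Fin p → Fin p → Bool}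
  {f : Ω → (∀ b, V b) → (∀ b, V b)} {σ : (∀ b, V b) → (∀ b, V b)}
variable [∀ b, CompleteSpace (V b)] [MeasurableSpace Ω] [∀ b, MeasurableSpace (V b)]
    [∀ b, BorelSpace (V b)] [∀ b, SecondCountableTopology (V b)]

theorem Cc_nonneg (gl : Gl θ B K lam ε η β γ Λ δ Cσ dir f σ) :
    0 ≤ Cs Λ ε γ δ (CNc p) (C0c p) Cσ p := by
  have h1 := gl.δ0
  have h2 := C0c_nonneg p
  have h3 := gl.sat.one
  have h4 := (CT_pos (Λ := Λ) (ε := ε) (γ := γ) (by linarith [gl.γε, gl.ε0])).le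
  unfold Cs; positivity

theorem ind_step (gl : Gl θ B K lam ε η β γ Λ δ Cσ dir f σ) {R e0 e1 : ℝ}
    (hik : i < κ) (hi' : Finset.Icc i' κ = Finset.Ioc i κ) (hii' : i ≤ i')
    (hk' : Finset.Icc i κ' = Finset.Ico i κ) (hkk' : κ' ≤ κ)
    (hR0 : 0 ≤ R) (hR : R ≤ CNc p) (he0 : 0 ≤ e0) (he1 : 0 ≤ e1) (hee : 2 * e1 + e0 + 1 ≤ CNc p)
    {A B' C D D' : Ω → (∀ b, V b) → (∀ b, V b)}
    (bA : Bas θ B β f σ (Finset.Ioc i κ) e1 A) (bB : Bas θ B β f σ (Finset.Ico i κ) e1 B')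
    (bC : Bas θ B β f σ (Finset.Ioo i κ) e0 C)
    (rA : RL lam η β i' κ R A C D) (rB : RL lam η β i κ' R B' D' C) :
    ∃ W : Ω → (∀ b, V b) → (∀ b, V b),
      Bas θ B β f σ (Finset.Icc i κ) (2 * e1 + e0 + Cs Λ ε γ δ (CNc p) (C0c p) Cσ p) W ∧
      RL lam η β i κ (R + 1) W B' A := by
  have hc0 := Cc_nonneg gl
  have hc1 := gl.hc
  have ha := gl.anti
  have hη := gl.η1
  have wok : WOK (sw lam η i κ) (tw lam η i κ) η i κ := swtw_WOK ha hη
  have sub1 : Finset.Ioc i κ ⊆ Finset.Icc i κ := Finset.Ioc_subset_Icc_self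
  have sub2 : Finset.Ico i κ ⊆ Finset.Icc i κ := Finset.Ico_subset_Icc_self
  have sub3 : Finset.Ioo i κ ⊆ Finset.Icc i κ := Finset.Ioo_subset_Icc_self
  have hNN := fun ω => NN_step ha hη gl.β0 gl.βη hik hi' hii' hk' hkk' (gl.hf ω) (bA.diff ω)
    (bB.diff ω) (bC.diff ω) (bA.z ω) (bB.z ω) (bC.z ω) hR0 hR he0 he1 hee (bA.sm ω) (bB.sm ω)
    (bC.sm ω) (rA.rd ω) (rA.rv ω) (rB.ld ω) (rB.lv ω)
  have fc : ∀ ω, Continuous (f ω) := fun ω => (gl.hf ω).diff.continuous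
  have fm : ∀ {Z : Ω → (∀ b, V b) → (∀ b, V b)}, (∀ x, Measurable fun ω => Z ω x) → ∀ x,
      Measurable fun ω => f ω (Z ω x) := fun hZ x =>
    meas_comp (E1 := ∀ b, V b) (E2 := ∀ b, V b) gl.hfm fc measurable_id (hZ x)
  obtain ⟨g, gd, gvi, gvk, gz, go, gm, ge⟩ := corr gl hik.le hNN
    (fun x => ((bA.meas x).add (bB.meas x)).sub (bC.meas x))
    (fun x => ((fm bA.meas x).add (fm bB.meas x)).sub (fm bC.meas x))
  have hWd : ∀ ω x, HasFDerivAt (fun x => A ω x + B' ω x - C ω x + g ω x)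
      (fderiv ℝ (A ω) x + fderiv ℝ (B' ω) x - fderiv ℝ (C ω) x + fderiv ℝ (g ω) x) x := fun ω x =>
    (((bA.diff ω x).hasFDerivAt.add (bB.diff ω x).hasFDerivAt).sub (bC.diff ω x).hasFDerivAt).add
      (gd ω x).hasFDerivAt
  have hWd' := fun ω x => (hWd ω x).fderiv
  refine ⟨fun ω x => A ω x + B' ω x - C ω x + g ω x, ⟨?_, ?_, ?_, ?_, ?_, ?_⟩, ⟨?_, ?_, ?_, ?_⟩⟩
  · exact fun ω x => (hWd ω x).differentiableAt
  · intro ω; simp [bA.z, bB.z, bC.z, gvi ω 0 rfl]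
  · intro ω; rw [hWd', gz, add_zero, bA.dz, bB.dz, bC.dz, prS_incl i κ hik]
  · intro ω
    have h1 := (((bA.sm ω).wmono he1 fun x _ y _ b => ind_mono sub1 x y b).add
      ((bB.sm ω).wmono he1 fun x _ y _ b => ind_mono sub2 x y b)).sub
      ((bC.sm ω).wmono he0 fun x _ y _ b => ind_mono sub3 x y b)
    have h2 : OBB (ind (Finset.Icc i κ)) β (Cs Λ ε γ δ (CNc p) (C0c p) Cσ p) (fderiv ℝ (g ω)) := by
      rw [← wtt_zero]
      exact (go ω).wmono hc0 (fun x hx y hy b => wtt_le_zero wok.sn hx hy b)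
    have h3 := (h1.add h2).mono (c' := 2 * e1 + e0 + Cs Λ ε γ δ (CNc p) (C0c p) Cσ p) (ind_WM _)
      (by linarith)
    convert h3 using 2 with x
    rw [hWd', prS_incl i κ hik]
    abel
  · intro x; exact (((bA.meas x).add (bB.meas x)).sub (bC.meas x)).add (gm x)
  · intro ω x
    simp only [ge, bA.eqn, bB.eqn, bC.eqn, map_add, map_sub]
    abel
  · intro ω
    have h1 : OBB (wtt 0 (tw lam η i κ) i κ) β R
        (fun x => fderiv ℝ (A ω) x - fderiv ℝ (C ω) x) := by
      refine ((rA.rd ω).wmono hR0 fun x hx y hy b => ?_)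
      refine wtt_exp_mono (SN_tw ha hη) (by rw [hi']; exact sub1) (fun b hb => Or.inr ⟨rfl, le_rfl⟩)
        (fun b hb => Or.inl ⟨rfl, tw_le ha hη hii' b hb⟩) hx hy b
    have h2 : OBB (wtt 0 (tw lam η i κ) i κ) β _ (fderiv ℝ (g ω)) :=
      (go ω).wmono hc0 (fun x hx y hy b => wtt_exp_mono (SN_tw ha hη) (Finset.Subset.refl _)
        (fun b hb => Or.inr ⟨rfl, (wok.sn b hb).1⟩) (fun b hb => Or.inl ⟨rfl, le_rfl⟩) hx hy b)
    have h3 := (h1.add h2).mono (c' := R + 1) (wtt_WM (SN_tw ha hη)) (by linarith)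
    convert h3 using 2 with x
    rw [hWd']; abel
  · intro ω x hx
    rw [gvk ω x hx, rA.rv ω x hx]; abel
  · intro ω
    have h1 : OBB (wtt (sL lam η i κ) 0 i κ) β R
        (fun x => fderiv ℝ (B' ω) x - fderiv ℝ (C ω) x) := by
      refine ((rB.ld ω).wmono hR0 fun x hx y hy b => ?_)
      refine wtt_exp_mono (SN_sL ha hη) (by rw [hk']; exact sub2)
        (fun b hb => Or.inl ⟨rfl, sL_le ha hη hkk' b hb⟩) (fun b hb => Or.inr ⟨rfl, le_rfl⟩) hx hy b
    have h2 : OBB (wtt (sL lam η i κ) 0 i κ) β _ (fderiv ℝ (g ω)) :=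
      (go ω).wmono hc0 (fun x hx y hy b => wtt_exp_mono (SN_sL ha hη) (Finset.Subset.refl _)
        (fun b hb => Or.inl ⟨rfl, by rw [sw_eq ha hik]⟩)
        (fun b hb => Or.inr ⟨rfl, (wok.sn b hb).2⟩) hx hy b)
    have h3 := (h1.add h2).mono (c' := R + 1) (wtt_WM (SN_sL ha hη)) (by linarith)
    convert h3 using 2 with x
    rw [hWd']; abel
  · intro ω x hx
    rw [gvi ω x hx, rB.lv ω x hx]; abel

def Sint (p a l : ℕ) : Finset (Fin p) := Finset.univ.filter fun b => a ≤ b.val ∧ b.val < a + l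

theorem Bas_zero (gl : Gl θ B K lam ε η β γ Λ δ Cσ dir f σ) {e : ℝ} (he : 0 ≤ e) :
    Bas θ B β f σ ∅ e (fun _ _ => 0) := by
  have hd0 : ∀ x, fderiv ℝ (fun _ : (∀ b, V b) => (0 : ∀ b, V b)) x = 0 := fun x => fderiv_const_apply _
  have hpr : (prS ∅ : (∀ b, V b) →L[ℝ] (∀ b, V b)) = 0 := by
    ext x b; simp [prS_apply]
  refine ⟨fun ω => differentiable_const _, fun _ => rfl, fun ω => ?_, fun ω => ?_,
    fun _ => measurable_const, fun ω x => ?_⟩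
  · rw [hd0, hpr]
  · simp only [hd0, hpr, sub_zero]
    constructor
    · intro x _ v; simp [nm, ind]
    · intro x _ y _ v; simp [nm, ind]
  · rw [(gl.hf ω).z]; simp

theorem induct (gl : Gl θ B K lam ε η β γ Λ δ Cσ dir f σ) (l : ℕ) (hl : l + 1 ≤ p) :
    ∃ u w : ℕ → Ω → (∀ b, V b) → (∀ b, V b),
      (∀ a, a + l ≤ p → Bas θ B β f σ (Sint p a l) (4 ^ l * Cs Λ ε γ δ (CNc p) (C0c p) Cσ p) (u a)) ∧
      (∀ a, a + (l + 1) ≤ p → Bas θ B β f σ (Sint p a (l + 1))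
        (4 ^ (l + 1) * Cs Λ ε γ δ (CNc p) (C0c p) Cσ p) (w a)) ∧
      (∀ i κ : Fin p, κ.val = i.val + l → RL lam η β i κ (2 + l) (w i) (u i) (u (i + 1))) := by
  have hc0 := Cc_nonneg gl
  have hc1 := gl.hc
  set c := Cs Λ ε γ δ (CNc p) (C0c p) Cσ p
  induction l with
  | zero =>
    choose W hW1 hW2 using base_step gl
    refine ⟨fun _ _ _ => 0, fun a => if h : a < p then W ⟨a, h⟩ else fun _ _ => 0, ?_, ?_, ?_⟩
    · intro a _
      have : Sint p a 0 = ∅ := by ext b; simp [Sint]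
      rw [this]; exact Bas_zero gl (by linarith)
    · intro a ha
      have hap : a < p := by omega
      simp only [hap, dif_pos]
      have e : Sint p a (0 + 1) = Finset.Icc ⟨a, hap⟩ ⟨a, hap⟩ := by
        ext b; simp only [Sint, Finset.mem_filter, Finset.mem_univ, true_and, Finset.mem_Icc,
          Fin.le_def]; omega
      rw [e]
      have h := hW1 ⟨a, hap⟩
      exact ⟨h.diff, h.z, h.dz, fun ω => (h.sm ω).mono (ind_WM _) (by change c ≤ 4 ^ (0+1) * c; norm_num; linarith), h.meas, h.eqn⟩
    · intro i κ hk
      have : κ = i := Fin.ext (by omega)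
      subst this
      simp only [κ.isLt, dif_pos]
      simpa using hW2 κ
  | succ l ih =>
    obtain ⟨u, w, hu, hw, hr⟩ := ih (by omega)
    have hpow : (4:ℝ) ^ (l + 2) ≤ CNc p := by
      unfold CNc; exact pow_le_pow_right₀ (by norm_num) (by omega)
    have h4 : (1:ℝ) ≤ 4 ^ l := one_le_pow₀ (by norm_num)
    have hp2 := CNc_ge_p p
    have step : ∀ a : ℕ, ∃ W : Ω → (∀ b, V b) → (∀ b, V b), ∀ h : a + (l + 2) ≤ p,
        Bas θ B β f σ (Sint p a (l + 2)) (4 ^ (l + 2) * c) W ∧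
        RL lam η β ⟨a, by omega⟩ ⟨a + (l + 1), by omega⟩ (2 + (l + 1 : ℕ)) W (w a) (w (a + 1)) := by
      intro a
      by_cases h : a + (l + 2) ≤ p
      swap
      · exact ⟨fun _ _ => 0, fun h' => absurd h' h⟩
      have rA := hr ⟨a + 1, by omega⟩ ⟨a + (l + 1), by omega⟩ (by simp; omega)
      have rB := hr ⟨a, by omega⟩ ⟨a + l, by omega⟩ (by simp)
      have bA := hw (a + 1) (by omega)
      have bB := hw a (by omega)
      have bC := hu (a + 1) (by omega)
      have e1 : Sint p (a + 1) (l + 1) = Finset.Ioc ⟨a, by omega⟩ ⟨a + (l + 1), by omega⟩ := by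
        ext b; simp only [Sint, Finset.mem_filter, Finset.mem_univ, true_and, Finset.mem_Ioc,
          Fin.le_def, Fin.lt_def]; omega
      have e2 : Sint p a (l + 1) = Finset.Ico ⟨a, by omega⟩ ⟨a + (l + 1), by omega⟩ := by
        ext b; simp only [Sint, Finset.mem_filter, Finset.mem_univ, true_and, Finset.mem_Ico,
          Fin.le_def, Fin.lt_def]
      have e3 : Sint p (a + 1) l = Finset.Ioo ⟨a, by omega⟩ ⟨a + (l + 1), by omega⟩ := by
        ext b; simp only [Sint, Finset.mem_filter, Finset.mem_univ, true_and, Finset.mem_Ioo,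
          Fin.le_def, Fin.lt_def]; omega
      have e4 : Sint p a (l + 2) = Finset.Icc ⟨a, by omega⟩ ⟨a + (l + 1), by omega⟩ := by
        ext b; simp only [Sint, Finset.mem_filter, Finset.mem_univ, true_and, Finset.mem_Icc,
          Fin.le_def, Fin.lt_def]; omega
      rw [e1] at bA
      rw [e2] at bB
      rw [e3] at bC
      rw [e4]
      have hlp : (l:ℝ) + 2 ≤ p := by exact_mod_cast (by omega : l + 2 ≤ p)
      obtain ⟨W, hW1, hW2⟩ := ind_step gl (i := ⟨a, by omega⟩) (κ := ⟨a + (l + 1), by omega⟩)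
        (i' := ⟨a + 1, by omega⟩) (κ' := ⟨a + l, by omega⟩) (R := 2 + l)
        (by simp [Fin.lt_def])
        (by ext b; simp only [Finset.mem_Icc, Finset.mem_Ioc, Fin.le_def, Fin.lt_def]; omega)
        (by simp [Fin.le_def])
        (by ext b; simp only [Finset.mem_Icc, Finset.mem_Ico, Fin.le_def, Fin.lt_def]; omega)
        (by simp [Fin.le_def]) (by positivity) (by linarith) (by positivity) (by positivity)
        (by
          rw [pow_succ] at hpow ⊢
          rw [pow_succ] at hpow
          nlinarith) bA bB bC rA rB
      refine ⟨W, fun h => ⟨?_, ?_⟩⟩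
      · refine ⟨hW1.diff, hW1.z, hW1.dz, fun ω => (hW1.sm ω).mono (ind_WM _) ?_, hW1.meas, hW1.eqn⟩
        change 2 * (4 ^ (l + 1) * c) + 4 ^ l * c + c ≤ 4 ^ (l + 2) * c
        rw [pow_succ, pow_succ, pow_succ]
        nlinarith
      · convert hW2 using 1; push_cast; ring
    choose W hW using step
    refine ⟨w, W, hw, fun a ha => (hW a ha).1, fun i κ hk => ?_⟩
    have h := (hW i (by have := κ.isLt; omega)).2
    have ek : κ = ⟨i.val + (l + 1), by have := κ.isLt; omega⟩ := Fin.ext hk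
    rw [ek]
    exact h

/-- core result in normalized coordinates -/
theorem core (gl : Gl θ B K lam ε η β γ Λ δ Cσ dir f σ) (hp : 1 ≤ p) :
    ∃ W : Ω → (∀ b, V b) → (∀ b, V b), (∀ ω, Differentiable ℝ (W ω)) ∧ (∀ ω, W ω 0 = 0) ∧
      (∀ ω, fderiv ℝ (W ω) 0 = ContinuousLinearMap.id ℝ _) ∧
      (∀ ω, ∀ x ∈ closedBall (0 : ∀ b, V b) 1,
        ‖fderiv ℝ (W ω) x - ContinuousLinearMap.id ℝ _‖ ≤
          4 ^ p * Cs Λ ε γ δ (CNc p) (C0c p) Cσ p * p) ∧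
      (∀ ω, ∀ x ∈ closedBall (0 : ∀ b, V b) 1, ∀ y ∈ closedBall (0 : ∀ b, V b) 1,
        ‖fderiv ℝ (W ω) x - fderiv ℝ (W ω) y‖ ≤
          4 ^ p * Cs Λ ε γ δ (CNc p) (C0c p) Cσ p * p * ‖x - y‖ ^ β) ∧
      (∀ x, Measurable fun ω => W ω x) ∧
      (∀ ω x, W (θ ω) (dg (B 1 ω) x) = dg (B 1 ω) (W ω x) + f ω (W ω (σ x))) := by
  have hc0 := Cc_nonneg gl
  set c := Cs Λ ε γ δ (CNc p) (C0c p) Cσ p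
  obtain ⟨u, w, -, hw, -⟩ := induct gl (p - 1) (by omega)
  have h := hw 0 (by omega)
  have e : p - 1 + 1 = p := by omega
  rw [e] at h
  have eS : Sint p 0 p = Finset.univ := by ext b; simp [Sint]
  have ep : (prS Finset.univ : (∀ b, V b) →L[ℝ] (∀ b, V b)) = ContinuousLinearMap.id ℝ _ := by
    ext x b; simp [prS_apply]
  rw [eS] at h
  have hwt : ∀ (x y v : ∀ b, V b), nm (ind (V := V) Finset.univ x y) v ≤ p * ‖v‖ := by
    intro x y v
    have := nm_le (R := 1) (w := ind (V := V) Finset.univ x y) (fun b => by simp [ind]) zero_le_one v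
    linarith
  refine ⟨w 0, h.diff, h.z, fun ω => by rw [h.dz, ep], fun ω x hx => ?_, fun ω x hx y hy => ?_,
    h.meas, h.eqn⟩
  · refine ContinuousLinearMap.opNorm_le_bound _ (by positivity) fun v => ?_
    have h1 := (h.sm ω).1 x hx v
    rw [ep] at h1
    refine h1.trans ?_
    rw [mul_assoc (4 ^ p * c)]
    exact mul_le_mul_of_nonneg_left (hwt x x v) (by positivity)
  · refine ContinuousLinearMap.opNorm_le_bound _ (by positivity) fun v => ?_
    have h1 := (h.sm ω).2 x hx y hy v
    have e : fderiv ℝ (w 0 ω) x v - fderiv ℝ (w 0 ω) y v =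
      (fderiv ℝ (w 0 ω) x - (prS Finset.univ : (∀ b, V b) →L[ℝ] (∀ b, V b))) v
      - (fderiv ℝ (w 0 ω) y - (prS Finset.univ : (∀ b, V b) →L[ℝ] (∀ b, V b))) v := by simp
    rw [ContinuousLinearMap.sub_apply, e]
    refine h1.trans ?_
    have := mul_le_mul_of_nonneg_left (hwt x y v)
      (by positivity : 0 ≤ 4 ^ p * c * ‖x - y‖ ^ β)
    linarith

end ind4
end RB
namespace RB
section nonres
variable {p : ℕ}

theorem fin_gap {ι : Type*} [Finite ι] (g : ι → ℝ) : ∃ m : ℝ, 0 < m ∧ ∀ i, g i ≠ 0 → m ≤ |g i| := by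
  have h : ∀ᶠ m in nhdsWithin (0 : ℝ) (Ioi 0), ∀ i, g i ≠ 0 → m ≤ |g i| := by
    refine eventually_all.2 fun i => ?_
    by_cases hi : g i = 0
    · simp [hi]
    · filter_upwards [nhdsWithin_le_nhds (Iic_mem_nhds (abs_pos.2 hi))] with m hm _ using hm
  obtain ⟨m, h1, h2⟩ := (h.and self_mem_nhdsWithin).exists
  exact ⟨m, h2, h1⟩

theorem mu_eq {lam : Fin p → ℝ} (ha : StrictAnti lam) (η : ℝ) {i κ : Fin p} (hik : i ≤ κ) {b : Fin p}
    (hb : b ∈ Finset.Icc i κ) : sw lam η i κ b * lam i + tw lam η i κ b * lam κ + lam b =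
      (lam i + lam κ) - η * (lam i + lam κ - lam b) := by
  unfold sw tw
  obtain ⟨h1, h2⟩ := Finset.mem_Icc.1 hb
  rcases hik.eq_or_lt with h | h
  · subst h
    have : b = i := le_antisymm h2 h1
    subst this
    simp; ring
  · have := ha h
    have h3 : lam i - lam κ ≠ 0 := by linarith
    field_simp
    ring

theorem nonres {lam : Fin p → ℝ} (ha : StrictAnti lam) (τ : ℕ)
    (hsign : ∀ j : Fin p, ((j : ℕ) < τ → 0 < lam j) ∧ (τ ≤ (j : ℕ) → lam j < 0))
    (hnonres : ∀ i κ j : Fin p, (i : ℕ) < τ → τ ≤ (κ : ℕ) → lam j ≠ lam i + lam κ)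
    {Λ : ℝ} (hΛ0 : 0 < Λ) (hΛ : ∀ b, |lam b| ≤ Λ) :
    ∃ (η γ : ℝ) (dir : Fin p → Fin p → Fin p → Bool), 0 < η ∧ η < 1 ∧ 0 < γ ∧
      (∀ i κ, i ≤ κ → ∀ j, dir i κ j = true → ∀ b ∈ Finset.Icc i κ,
        sw lam η i κ b * lam i + tw lam η i κ b * lam κ + lam b - lam j ≤ -γ) ∧
      (∀ i κ, i ≤ κ → ∀ j, dir i κ j = false → ∀ b ∈ Finset.Icc i κ,
        γ ≤ sw lam η i κ b * lam i + tw lam η i κ b * lam κ + lam b - lam j) := by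
  obtain ⟨m, hm0, hm⟩ := fin_gap (fun q : Fin p × Fin p × Fin p => lam q.1 + lam q.2.1 - lam q.2.2)
  obtain ⟨m', hm0', hm'⟩ := fin_gap lam
  set η := min (1/2) (m / (6 * Λ)) with hη
  have e0 : 0 < η := lt_min (by norm_num) (by positivity)
  have e1 : η ≤ 1/2 := min_le_left _ _
  have e2 : η * (3 * Λ) ≤ m / 2 := by
    have : η ≤ m / (6 * Λ) := min_le_right _ _
    calc η * (3 * Λ) ≤ m / (6 * Λ) * (3 * Λ) := by gcongr
      _ = m / 2 := by field_simp; norm_num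
  set γ := min (m/2) (η * m') with hγ
  have g0 : 0 < γ := lt_min (by positivity) (by positivity)
  have g1 : γ ≤ m / 2 := min_le_left _ _
  have g2 : γ ≤ η * m' := min_le_right _ _
  have key : ∀ i κ, i ≤ κ → ∀ j, (∀ b ∈ Finset.Icc i κ,
        sw lam η i κ b * lam i + tw lam η i κ b * lam κ + lam b - lam j ≤ -γ) ∨ (∀ b ∈ Finset.Icc i κ,
        γ ≤ sw lam η i κ b * lam i + tw lam η i κ b * lam κ + lam b - lam j) := by
    intro i κ hik j
    by_cases hg : lam i + lam κ - lam j = 0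
    · by_cases hκ : (κ : ℕ) < τ
      · left
        intro b hb
        rw [mu_eq ha η hik hb]
        obtain ⟨h1, h2⟩ := Finset.mem_Icc.1 hb
        have q1 := (hsign κ).1 hκ
        have q2 : m' ≤ lam κ := by have := hm' κ q1.ne'; rwa [abs_of_pos q1] at this
        have q3 := ha.antitone h1
        have : η * m' ≤ η * (lam i + lam κ - lam b) := by gcongr; linarith
        linarith
      · push Not at hκ
        by_cases hi : (i : ℕ) < τ
        · exact absurd (by linarith) (hnonres i κ j hi hκ)
        · push Not at hi
          right
          intro b hb
          rw [mu_eq ha η hik hb]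
          obtain ⟨h1, h2⟩ := Finset.mem_Icc.1 hb
          have q1 := (hsign i).2 hi
          have q2 : m' ≤ - lam i := by have := hm' i q1.ne; rwa [abs_of_neg q1] at this
          have q3 := ha.antitone h2
          have : η * m' ≤ η * (-(lam i + lam κ - lam b)) := by gcongr; linarith
          linarith
    · have hm1 := hm (i, κ, j) hg
      simp only at hm1
      have hb' : ∀ b, |η * (lam i + lam κ - lam b)| ≤ m / 2 := by
        intro b
        rw [abs_mul, abs_of_pos e0]
        refine le_trans ?_ e2
        gcongr
        have a1 := abs_le.1 (hΛ i)
        have a2 := abs_le.1 (hΛ κ)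
        have a3 := abs_le.1 (hΛ b)
        rw [abs_le]; constructor <;> linarith
      rcases lt_or_gt_of_ne hg with h | h
      · left
        intro b hb
        rw [mu_eq ha η hik hb]
        rw [abs_of_neg h] at hm1
        have := abs_le.1 (hb' b)
        linarith
      · right
        intro b hb
        rw [mu_eq ha η hik hb]
        rw [abs_of_pos h] at hm1
        have := abs_le.1 (hb' b)
        linarith
  classical
  refine ⟨η, γ, fun i κ j => decide (∀ b ∈ Finset.Icc i κ,
        sw lam η i κ b * lam i + tw lam η i κ b * lam κ + lam b - lam j ≤ -γ), e0, by linarith, g0,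
        fun i κ h j hd => ?_, fun i κ h j hd => ?_⟩
  · exact of_decide_eq_true hd
  · exact (key i κ h j).resolve_left (of_decide_eq_false hd)
end nonres
end RB
namespace RB
section sat
variable {p : ℕ} {V : Fin p → Type} [∀ b, NormedAddCommGroup (V b)] [∀ b, NormedSpace ℝ (V b)]

theorem exists_sat1 (E : Type*) [NormedAddCommGroup E] [NormedSpace ℝ E] [FiniteDimensional ℝ E]
    [HasContDiffBump E] : ∃ (s : E → E) (C : ℝ), 0 ≤ C ∧ Differentiable ℝ s ∧ (∀ y, ‖s y‖ ≤ ‖y‖) ∧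
      (∀ y, ‖s y‖ ≤ 1) ∧ (∀ y, ‖y‖ ≤ 1/2 → s y = y) ∧ (∀ y, ‖fderiv ℝ s y‖ ≤ C) ∧
      (∀ y z, ‖fderiv ℝ s y - fderiv ℝ s z‖ ≤ C * ‖y - z‖) ∧ (∀ y z, ‖s y - s z‖ ≤ C * ‖y - z‖) := by
  let χ : ContDiffBump (0 : E) := ⟨1/2, 1, by norm_num, by norm_num⟩
  have hs : ContDiff ℝ 2 (fun y : E => χ y • y) := χ.contDiff.smul contDiff_id
  have hcs : HasCompactSupport (fun y : E => χ y • y) := χ.hasCompactSupport.smul_right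
  obtain ⟨C1, h1⟩ := hs.lipschitzWith_of_hasCompactSupport hcs (by norm_num)
  have hs2 : ContDiff ℝ 1 (fderiv ℝ (fun y : E => χ y • y)) := hs.fderiv_right (by norm_num)
  obtain ⟨C2, h2⟩ := hs2.lipschitzWith_of_hasCompactSupport (hcs.fderiv ℝ) (by norm_num)
  have hle : ∀ y, ‖χ y • y‖ ≤ ‖y‖ := fun y => by
    rw [norm_smul, Real.norm_eq_abs, abs_of_nonneg χ.nonneg]
    exact mul_le_of_le_one_left (norm_nonneg _) χ.le_one
  refine ⟨fun y => χ y • y, C1 + C2, by positivity, hs.differentiable (by norm_num), hle, fun y => ?_,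
    fun y hy => ?_, fun y => ?_, fun y z => ?_, fun y z => ?_⟩
  · by_cases hy : ‖y‖ ≤ 1
    · exact (hle y).trans hy
    · have : χ y = 0 := χ.zero_of_le_dist (by rw [dist_zero_right]; exact (not_le.1 hy).le)
      simp [this]
  · have : χ y = 1 := χ.one_of_mem_closedBall (by rw [mem_closedBall_zero_iff]; exact hy)
    simp [this]
  · exact (norm_fderiv_le_of_lipschitz ℝ h1).trans (by simp)
  · refine (h2.norm_sub_le y z).trans ?_
    gcongr; simp
  · refine (h1.norm_sub_le y z).trans ?_
    gcongr; simp

theorem holder_of_lip {a t C β : ℝ} (hC : 0 ≤ C) (ht : 0 ≤ t) (hβ0 : 0 < β) (hβ : β ≤ 1) (h1 : a ≤ 2 * C)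
    (h2 : a ≤ C * t) : a ≤ 2 * C * t ^ β := by
  rcases le_total t 1 with h | h
  · have : t ≤ t ^ β := by
      rcases ht.eq_or_lt with h0 | h0
      · rw [← h0, Real.zero_rpow hβ0.ne']
      · calc t = t ^ (1:ℝ) := (Real.rpow_one t).symm
          _ ≤ t ^ β := Real.rpow_le_rpow_of_exponent_ge h0 h hβ
    nlinarith
  · have : 1 ≤ t ^ β := Real.one_le_rpow h hβ0.le
    nlinarith

theorem exists_sat [∀ b, FiniteDimensional ℝ (V b)] [∀ b, HasContDiffBump (V b)] :
    ∃ (σ : (∀ b, V b) → (∀ b, V b)) (C : ℝ), ∀ β : ℝ, 0 < β → β ≤ 1 → Sat σ C β := by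
  choose s C C0 sd sle s1 sid sb sl sL using fun b => exists_sat1 (V b)
  have hC : ∀ b, C b ≤ ∑ b, C b := fun b =>
    Finset.single_le_sum (fun b _ => C0 b) (Finset.mem_univ b)
  have hCs : 0 ≤ ∑ b, C b := Finset.sum_nonneg fun b _ => C0 b
  set T := ∑ b, C b
  have hd : ∀ x, HasFDerivAt (fun (x : ∀ b, V b) b => s b (x b))
      (dg fun b => fderiv ℝ (s b) (x b)) x := by
    intro x
    rw [hasFDerivAt_pi']
    intro b
    have := ((sd b (x b)).hasFDerivAt).comp x (ContinuousLinearMap.proj (R := ℝ) (φ := V) b).hasFDerivAt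
    exact this
  refine ⟨fun x b => s b (x b), 1 + 2 * T, fun β hβ0 hβ1 => ⟨fun x => (hd x).differentiableAt,
    fun x b => sle b _, fun x => ?_, fun x hx => ?_, fun x v b => ?_, fun x y v b => ?_, fun x y => ?_,
    by linarith⟩⟩
  · rw [mem_closedBall_zero_iff]
    exact (pi_norm_le_iff_of_nonneg zero_le_one).2 fun b => s1 b _
  · funext b
    exact sid b _ ((norm_le_pi_norm x b).trans hx)
  · rw [(hd x).fderiv, dg_apply]
    refine (ContinuousLinearMap.le_opNorm _ _).trans ?_
    gcongr
    have := sb b (x b); have := hC b; linarith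
  · rw [(hd x).fderiv, (hd y).fderiv, dg_apply, dg_apply, ← ContinuousLinearMap.sub_apply]
    refine (ContinuousLinearMap.le_opNorm _ _).trans ?_
    gcongr
    have h1 : ‖fderiv ℝ (s b) (x b) - fderiv ℝ (s b) (y b)‖ ≤ 2 * T :=
      (norm_sub_le _ _).trans (by have := sb b (x b); have := sb b (y b); have := hC b; linarith)
    have h2 : ‖fderiv ℝ (s b) (x b) - fderiv ℝ (s b) (y b)‖ ≤ T * ‖x - y‖ :=
      (sl b _ _).trans (by gcongr; exact hC b; exact norm_le_pi_norm (x - y) b)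
    refine (holder_of_lip hCs (norm_nonneg _) hβ0 hβ1 h1 h2).trans ?_
    gcongr; linarith
  · refine (pi_norm_le_iff_of_nonneg (by positivity)).2 fun b => ?_
    refine (sL b (x b) (y b)).trans ?_
    gcongr
    · have := hC b; linarith
    · exact norm_le_pi_norm (x - y) b

/-- composing with a saturation gives a global nonlinearity -/
theorem FF_of_loc {σ : (∀ b, V b) → (∀ b, V b)} {C : ℝ} (hσ : Sat σ C 1)
    {g : (∀ b, V b) → (∀ b, V b)} {m : ℝ} (hm : 0 ≤ m)
    (gd : ∀ x ∈ closedBall (0 : ∀ b, V b) 1, DifferentiableAt ℝ g x) (g0 : g 0 = 0)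
    (dg0 : fderiv ℝ g 0 = 0) (gl : ∀ x ∈ closedBall (0 : ∀ b, V b) 1, ∀ y ∈ closedBall (0 : ∀ b, V b) 1,
      ‖fderiv ℝ g x - fderiv ℝ g y‖ ≤ m * ‖x - y‖) :
    FF (fun x => g (σ x)) (2 * C ^ 2 * m) := by
  have hC := hσ.one
  have hd : ∀ x, HasFDerivAt (fun x => g (σ x)) ((fderiv ℝ g (σ x)).comp (fderiv ℝ σ x)) x := fun x =>
    (gd _ (hσ.box x)).hasFDerivAt.comp x (hσ.diff x).hasFDerivAt
  have s0 : σ 0 = 0 := hσ.idn 0 (by simp)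
  have z0 : (0 : ∀ b, V b) ∈ closedBall (0 : ∀ b, V b) 1 := by simp
  have b1 : ∀ x, ‖fderiv ℝ σ x‖ ≤ C := fun x =>
    ContinuousLinearMap.opNorm_le_bound _ (by linarith) fun v =>
      (pi_norm_le_iff_of_nonneg (by positivity)).2 fun b => (hσ.d1 x v b).trans
        (by gcongr; exact norm_le_pi_norm v b)
  have b2 : ∀ x y, ‖fderiv ℝ σ x - fderiv ℝ σ y‖ ≤ C * ‖x - y‖ := fun x y =>
    ContinuousLinearMap.opNorm_le_bound _ (by positivity) fun v =>
      (pi_norm_le_iff_of_nonneg (by positivity)).2 fun b => by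
        have := hσ.d2 x y v b
        rw [Real.rpow_one] at this
        exact this.trans (by gcongr; exact norm_le_pi_norm v b)
  refine ⟨fun x => (hd x).differentiableAt, by simp [s0, g0], ?_, fun x y => ?_, by positivity⟩
  · rw [(hd 0).fderiv, s0, dg0]; simp
  · rw [(hd x).fderiv, (hd y).fderiv]
    have e : (fderiv ℝ g (σ x)).comp (fderiv ℝ σ x) - (fderiv ℝ g (σ y)).comp (fderiv ℝ σ y) =
      (fderiv ℝ g (σ x) - fderiv ℝ g (σ y)).comp (fderiv ℝ σ x) +
      (fderiv ℝ g (σ y)).comp (fderiv ℝ σ x - fderiv ℝ σ y) := by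
      ext v; simp
    rw [e]
    have c1 : ‖(fderiv ℝ g (σ x) - fderiv ℝ g (σ y)).comp (fderiv ℝ σ x)‖ ≤ (m * (C * ‖x - y‖)) * C := by
      refine (ContinuousLinearMap.opNorm_comp_le _ _).trans ?_
      refine mul_le_mul ((gl _ (hσ.box x) _ (hσ.box y)).trans ?_) (b1 x) (norm_nonneg _) (by positivity)
      gcongr; exact hσ.lip x y
    have c2 : ‖fderiv ℝ g (σ y)‖ ≤ m := by
      have := gl _ (hσ.box y) 0 z0
      rw [dg0, sub_zero, sub_zero] at this
      exact this.trans (mul_le_of_le_one_right hm (mem_closedBall_zero_iff.1 (hσ.box y)))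
    have c3 : ‖(fderiv ℝ g (σ y)).comp (fderiv ℝ σ x - fderiv ℝ σ y)‖ ≤ m * (C * ‖x - y‖) := by
      refine (ContinuousLinearMap.opNorm_comp_le _ _).trans ?_
      exact mul_le_mul c2 (b2 x y) (norm_nonneg _) hm
    refine (norm_add_le _ _).trans ((add_le_add c1 c3).trans ?_)
    have : 0 ≤ m * ‖x - y‖ := by positivity
    have h4 : C ≤ C ^ 2 := by nlinarith
    nlinarith
end sat
end RB
namespace RB
section temper
variable {Ω : Type*} {it : ℤ → Ω → Ω} {K K' : Ω → ℝ}

def Tm (it : ℤ → Ω → Ω) (K : Ω → ℝ) : Prop :=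
  ∀ ω, ∀ ε : ℝ, 0 < ε → ∃ C : ℝ, 0 < C ∧ ∀ n : ℤ, K (it n ω) ≤ C * Real.exp (ε * |(n : ℝ)|)

theorem Tm_of_above (h : TemperedAbove it K) (hK : ∀ ω, 0 < K ω) : Tm it K := by
  intro ω ε hε
  have key : ∀ᶠ n : ℤ in cofinite, K (it n ω) * Real.exp (-(ε * |(n : ℝ)|)) ≤ 1 := by
    rw [Int.cofinite_eq, eventually_sup]
    have aux : ∀ n : ℤ, n ≠ 0 → |((n : ℝ))⁻¹ * max 0 (Real.log (K (it n ω)))| < ε →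
        K (it n ω) * Real.exp (-(ε * |(n : ℝ)|)) ≤ 1 := by
      intro n hn h1
      rw [abs_mul, abs_inv, abs_of_nonneg (le_max_left (0:ℝ) _)] at h1
      have hn' : 0 < |(n : ℝ)| := abs_pos.2 (by exact_mod_cast hn)
      have h2 : max 0 (Real.log (K (it n ω))) < ε * |(n : ℝ)| := by
        rw [inv_mul_lt_iff₀ hn'] at h1; linarith
      have h3 : Real.log (K (it n ω)) ≤ ε * |(n : ℝ)| := (le_max_right _ _).trans h2.le
      rw [Real.log_le_iff_le_exp (hK _)] at h3
      rw [Real.exp_neg]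
      exact (mul_inv_le_iff₀ (Real.exp_pos _)).2 (by linarith)
    constructor
    · have := (h ω).2
      rw [Metric.tendsto_nhds] at this
      filter_upwards [this ε hε, eventually_lt_atBot (0 : ℤ)] with n h1 h2
      rw [Real.dist_eq, sub_zero] at h1
      exact aux n h2.ne h1
    · have := (h ω).1
      rw [Metric.tendsto_nhds] at this
      filter_upwards [this ε hε, eventually_gt_atTop (0 : ℤ)] with n h1 h2
      rw [Real.dist_eq, sub_zero] at h1
      exact aux n h2.ne' h1
  have hb : BddAbove (range fun n : ℤ => K (it n ω) * Real.exp (-(ε * |(n : ℝ)|))) :=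
    Filter.IsBoundedUnder.bddAbove_range_of_cofinite ⟨1, by simpa using key⟩
  obtain ⟨C, hC⟩ := hb
  refine ⟨max C 1, by positivity, fun n => ?_⟩
  have := hC ⟨n, rfl⟩
  simp only at this
  rw [Real.exp_neg, mul_inv_le_iff₀ (Real.exp_pos _)] at this
  refine this.trans ?_
  gcongr
  exact le_max_left _ _

theorem above_of_Tm (h : Tm it K) (hK : ∀ ω, 0 < K ω) : TemperedAbove it K := by
  intro ω
  have aux : ∀ ε : ℝ, 0 < ε → ∀ᶠ n : ℤ in cofinite,
      |((n : ℝ))⁻¹ * max 0 (Real.log (K (it n ω)))| < ε := by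
    intro ε hε
    obtain ⟨C, hC, h⟩ := h ω (ε/2) (by positivity)
    have ht : Tendsto (fun n : ℤ => |(n : ℝ)|) cofinite atTop := by
      rw [Int.cofinite_eq]
      refine Tendsto.sup ?_ ?_
      · exact tendsto_abs_atBot_atTop.comp (tendsto_intCast_atBot_iff.2 tendsto_id)
      · exact tendsto_abs_atTop_atTop.comp tendsto_intCast_atTop_atTop
    filter_upwards [ht.eventually_gt_atTop (2 * |Real.log C| / ε), ht.eventually_gt_atTop 0] with n h1 h2
    rw [abs_mul, abs_inv, abs_of_nonneg (le_max_left (0:ℝ) _), inv_mul_lt_iff₀ h2]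
    have h3 : Real.log (K (it n ω)) ≤ Real.log C + ε/2 * |(n:ℝ)| := by
      rw [Real.log_le_iff_le_exp (hK _), Real.exp_add, Real.exp_log hC]
      exact h n
    rw [div_lt_iff₀ hε] at h1
    have := le_abs_self (Real.log C)
    have := abs_nonneg (Real.log C)
    exact max_lt (by positivity) (by nlinarith)
  have ht : Tendsto (fun n : ℤ => ((n : ℝ))⁻¹ * max 0 (Real.log (K (it n ω)))) cofinite (nhds 0) := by
    rw [Metric.tendsto_nhds]
    intro ε hε
    filter_upwards [aux ε hε] with n hn
    rwa [Real.dist_eq, sub_zero]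
  rw [Int.cofinite_eq] at ht
  exact ⟨ht.mono_left le_sup_right, ht.mono_left le_sup_left⟩

theorem below_iff_inv : TemperedBelow it K ↔ TemperedAbove it (fun ω => (K ω)⁻¹) := by
  have e : ∀ x : ℝ, max 0 (Real.log x⁻¹) = - min 0 (Real.log x) := fun x => by
    rw [Real.log_inv, ← max_neg_neg, neg_zero]
  unfold TemperedBelow TemperedAbove
  simp only [e, mul_neg]
  have e2 : ∀ (g : ℤ → ℝ) (l : Filter ℤ), Tendsto (fun n => -g n) l (nhds 0) ↔ Tendsto g l (nhds 0) :=
    fun g l => by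
      constructor
      · intro h; simpa using h.neg
      · intro h; simpa using h.neg
  simp only [e2]

theorem Tm.add (h : Tm it K) (h' : Tm it K') : Tm it (fun ω => K ω + K' ω) := by
  intro ω ε hε
  obtain ⟨C, hC, h⟩ := h ω ε hε
  obtain ⟨C', hC', h'⟩ := h' ω ε hε
  exact ⟨C + C', by positivity, fun n => by have := h n; have := h' n; linarith⟩

theorem Tm_const (c : ℝ) : Tm it (fun _ => c) := by
  intro ω ε hε
  refine ⟨|c| + 1, by positivity, fun n => ?_⟩
  have := Real.one_le_exp (by positivity : 0 ≤ ε * |(n:ℝ)|)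
  have := le_abs_self c
  nlinarith [abs_nonneg c]

theorem Tm.pow (h : Tm it K) (hK : ∀ ω, 0 < K ω) (c : ℝ) (hc : 0 < c) (k : ℕ) :
    Tm it (fun ω => c * K ω ^ k) := by
  intro ω ε hε
  obtain ⟨C, hC, h⟩ := h ω (ε / (k+1)) (by positivity)
  refine ⟨c * C ^ k, by positivity, fun n => ?_⟩
  have h1 := pow_le_pow_left₀ (hK _).le (h n) k
  rw [mul_pow, ← Real.exp_nat_mul] at h1
  have h2 : (k : ℝ) * (ε / (k + 1) * |(n:ℝ)|) ≤ ε * |(n:ℝ)| := by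
    have : (k : ℝ) / (k+1) ≤ 1 := (div_le_one (by positivity)).2 (by linarith)
    calc (k : ℝ) * (ε / (k + 1) * |(n:ℝ)|) = (k : ℝ) / (k+1) * (ε * |(n:ℝ)|) := by ring
      _ ≤ _ := mul_le_of_le_one_left (by positivity) this
  rw [mul_assoc]
  exact mul_le_mul_of_nonneg_left (h1.trans (by gcongr)) hc.le

theorem envelope [MeasurableSpace Ω] {θ : Equiv.Perm Ω} (hθ : ∀ m : ℤ, Measurable (θ ^ m : Equiv.Perm Ω))
    {Q0 : Ω → ℝ} (hm : Measurable Q0) (h1 : ∀ ω, 1 ≤ Q0 ω) (hT : Tm (fun n ω => (θ ^ n : Equiv.Perm Ω) ω) Q0)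
    {ε : ℝ} (hε : 0 < ε) : ∃ Q : Ω → ℝ, Measurable Q ∧ (∀ ω, Q0 ω ≤ Q ω) ∧
      Tm (fun n ω => (θ ^ n : Equiv.Perm Ω) ω) Q ∧
      ∀ (n : ℤ) ω, Q ((θ ^ n) ω) ≤ Real.exp (ε * |(n : ℝ)|) * Q ω := by
  set u : ℤ → Ω → ℝ := fun n ω => Real.exp (-(ε * |(n:ℝ)|)) * Q0 ((θ ^ n) ω) with hu
  have ub : ∀ ω, ∀ ε' : ℝ, 0 < ε' → ε' ≤ ε → ∃ C, 0 < C ∧ ∀ m n : ℤ,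
      u n ((θ ^ m) ω) ≤ C * Real.exp (ε' * |(m:ℝ)|) := by
    intro ω ε' h0 hle
    obtain ⟨C, hC, h⟩ := hT ω ε' h0
    refine ⟨C, hC, fun m n => ?_⟩
    have h2 := h (n + m)
    simp only [hu]
    simp only [zpow_add, Equiv.Perm.mul_apply] at h2
    calc Real.exp (-(ε * |(n:ℝ)|)) * Q0 ((θ ^ n) ((θ ^ m) ω))
        ≤ Real.exp (-(ε * |(n:ℝ)|)) * (C * Real.exp (ε' * |((n+m : ℤ) : ℝ)|)) := by gcongr
      _ = C * Real.exp (-(ε * |(n:ℝ)|) + ε' * |((n+m : ℤ) : ℝ)|) := by rw [Real.exp_add]; ring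
      _ ≤ C * Real.exp (ε' * |(m:ℝ)|) := by
        gcongr
        push_cast
        have := abs_add_le (n:ℝ) m
        nlinarith [abs_nonneg (n:ℝ), abs_nonneg (m:ℝ)]
  have bdd : ∀ ω, BddAbove (range fun n => u n ω) := by
    intro ω
    obtain ⟨C, -, h⟩ := ub ω ε hε le_rfl
    refine ⟨C, ?_⟩
    rintro _ ⟨n, rfl⟩
    simpa using h 0 n
  refine ⟨fun ω => ⨆ n, u n ω, ?_, fun ω => ?_, fun ω ε' h' => ?_, fun m ω => ?_⟩
  · refine Measurable.iSup fun n => ?_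
    exact (hm.comp (hθ n)).const_mul _
  · have := le_ciSup (bdd ω) 0
    simpa [hu] using this
  · obtain ⟨C, hC, h⟩ := ub ω (min ε' ε) (lt_min h' hε) (min_le_right _ _)
    refine ⟨C, hC, fun m => ciSup_le fun n => (h m n).trans ?_⟩
    gcongr
    exact min_le_left _ _
  · refine ciSup_le fun n => ?_
    have h2 := le_ciSup (bdd ω) (n + m)
    have h3 : u n ((θ ^ m) ω) ≤ Real.exp (ε * |(m:ℝ)|) * u (n+m) ω := by
      simp only [hu, zpow_add, Equiv.Perm.mul_apply]
      rw [← mul_assoc, ← Real.exp_add]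
      have : 0 ≤ Q0 ((θ ^ n) ((θ ^ m) ω)) := by linarith [h1 ((θ ^ n) ((θ ^ m) ω))]
      gcongr
      push_cast
      have := abs_add_le (n:ℝ) m
      nlinarith
    exact h3.trans (by gcongr)
end temper
end RB
namespace RB
section inv
variable {Ω : Type*} {E : Type*} [NormedAddCommGroup E] [NormedSpace ℝ E] [CompleteSpace E]

theorem meas_fderiv [MeasurableSpace Ω] {E1 E2 : Type*} [NormedAddCommGroup E1] [NormedSpace ℝ E1]
    [NormedAddCommGroup E2] [NormedSpace ℝ E2] [MeasurableSpace E2] [BorelSpace E2]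
    [SecondCountableTopology E2]
    {Φ : Ω → E1 → E2} (hd : ∀ ω, Differentiable ℝ (Φ ω)) (hm : ∀ x, Measurable fun ω => Φ ω x) (x v : E1) :
    Measurable fun ω => fderiv ℝ (Φ ω) x v := by
  refine measurable_of_tendsto_metrizable (f := fun (n : ℕ) ω =>
    (n : ℝ) • (Φ ω (x + (n : ℝ)⁻¹ • v) - Φ ω x)) (fun n => ((hm _).sub (hm _)).const_smul _) ?_
  rw [tendsto_pi_nhds]
  intro ω
  exact ((hd ω x).hasFDerivAt.lim_real v).comp tendsto_natCast_atTop_atTop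

theorem cont_of_holder {E1 E2 : Type*} [NormedAddCommGroup E1] [NormedAddCommGroup E2]
    {g : E1 → E2} {c β : ℝ} (hβ : 0 < β) (h : ∀ x y, ‖g x - g y‖ ≤ c * ‖x - y‖ ^ β) : Continuous g := by
  rw [continuous_iff_continuousAt]
  intro y
  rw [ContinuousAt, tendsto_iff_norm_sub_tendsto_zero]
  have h1 : Tendsto (fun x => c * ‖x - y‖ ^ β) (nhds y) (nhds (c * ‖y - y‖ ^ β)) := by
    refine Continuous.tendsto (f := fun x => c * ‖x - y‖ ^ β) ?_ y
    exact continuous_const.mul ((continuous_id.sub continuous_const).norm.rpow_const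
      fun x => Or.inr hβ.le)
  simp only [sub_self, norm_zero, Real.zero_rpow hβ.ne', mul_zero] at h1
  exact squeeze_zero (fun x => norm_nonneg _) (fun x => h x y) h1

theorem global_inv [MeasurableSpace Ω] [MeasurableSpace E] [BorelSpace E] [SecondCountableTopology E]
    {ψ : Ω → E → E} {c β : ℝ} (hc : 0 ≤ c) (hβ : 0 < β) (hβ1 : β ≤ 1)
    (hd : ∀ ω, Differentiable ℝ (ψ ω)) (h0 : ∀ ω, ψ ω 0 = 0) (hd0 : ∀ ω, fderiv ℝ (ψ ω) 0 = 0)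
    (hb : ∀ ω x, ‖fderiv ℝ (ψ ω) x‖ ≤ 1/2)
    (hh : ∀ ω x y, ‖fderiv ℝ (ψ ω) x - fderiv ℝ (ψ ω) y‖ ≤ c * ‖x - y‖ ^ β)
    (hm : ∀ x, Measurable fun ω => ψ ω x) :
    ∃ Φ : Ω → E → E, (∀ ω x, Φ ω x + ψ ω (Φ ω x) = x) ∧ (∀ ω x, Φ ω (x + ψ ω x) = x) ∧
      (∀ ω, Differentiable ℝ (Φ ω)) ∧ (∀ ω, Φ ω 0 = 0) ∧
      (∀ ω, fderiv ℝ (Φ ω) 0 = ContinuousLinearMap.id ℝ E) ∧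
      (∀ ω x, ‖Φ ω x‖ ≤ 2 * ‖x‖) ∧
      (∀ ω x y, ‖fderiv ℝ (Φ ω) x - fderiv ℝ (Φ ω) y‖ ≤ 8 * c * ‖x - y‖ ^ β) ∧
      (∀ x, Measurable fun ω => Φ ω x) := by
  have hlip : ∀ ω x y, ‖ψ ω x - ψ ω y‖ ≤ 1/2 * ‖x - y‖ := fun ω x y =>
    Convex.norm_image_sub_le_of_norm_fderiv_le (fun z _ => hd ω z) (fun z _ => hb ω z) convex_univ
      (mem_univ _) (mem_univ _)
  have hcon : ∀ ω x, ContractingWith (1/2 : NNReal) (fun y => x - ψ ω y) := by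
    intro ω x
    refine ⟨by rw [← NNReal.coe_lt_coe]; norm_num, LipschitzWith.of_dist_le_mul fun y z => ?_⟩
    rw [dist_eq_norm, dist_eq_norm]
    have := hlip ω z y
    simp only [sub_sub_sub_cancel_left]
    rw [norm_sub_rev y z]
    simpa using this
  set Φ : Ω → E → E := fun ω x => (hcon ω x).fixedPoint with hΦ
  have f1 : ∀ ω x, Φ ω x + ψ ω (Φ ω x) = x := fun ω x => by
    have : x - ψ ω (Φ ω x) = Φ ω x := (hcon ω x).fixedPoint_isFixedPt
    conv_lhs => arg 1; rw [← this]
    abel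
  have inj : ∀ ω x y, ‖x - y‖ ≤ 2 * ‖(x + ψ ω x) - (y + ψ ω y)‖ := fun ω x y => by
    have h1 := hlip ω x y
    have e : x - y = ((x + ψ ω x) - (y + ψ ω y)) - (ψ ω x - ψ ω y) := by abel
    have h2 : ‖x - y‖ ≤ ‖(x + ψ ω x) - (y + ψ ω y)‖ + ‖ψ ω x - ψ ω y‖ := by
      conv_lhs => rw [e]
      exact norm_sub_le _ _
    linarith
  have f2 : ∀ ω x, Φ ω (x + ψ ω x) = x := fun ω x => by
    have := inj ω (Φ ω (x + ψ ω x)) x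
    rw [f1, sub_self, norm_zero, mul_zero] at this
    exact sub_eq_zero.1 (norm_le_zero_iff.1 this)
  have fl : ∀ ω x y, ‖Φ ω x - Φ ω y‖ ≤ 2 * ‖x - y‖ := fun ω x y => by
    have := inj ω (Φ ω x) (Φ ω y)
    rwa [f1, f1] at this
  have f0 : ∀ ω, Φ ω 0 = 0 := fun ω => by
    have := f2 ω 0
    rwa [h0, add_zero] at this
  have fc : ∀ ω, LipschitzWith 2 (Φ ω) := fun ω => LipschitzWith.of_dist_le_mul fun x y => by
    rw [dist_eq_norm, dist_eq_norm]; exact_mod_cast fl ω x y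
  have fd : ∀ ω, Differentiable ℝ (Φ ω) := by
    intro ω x
    have hn : ‖-(fderiv ℝ (ψ ω) (Φ ω x))‖ < 1 := by
      rw [norm_neg]; have := hb ω (Φ ω x); linarith
    let e := ContinuousLinearEquiv.unitsEquiv ℝ E (Units.oneSub _ hn)
    have he : (e : E →L[ℝ] E) = ContinuousLinearMap.id ℝ E + fderiv ℝ (ψ ω) (Φ ω x) := by
      ext v
      change ((Units.oneSub (-(fderiv ℝ (ψ ω) (Φ ω x))) hn : (E →L[ℝ] E)ˣ) : E →L[ℝ] E) v = _
      simp
    have hA : HasFDerivAt (fun y => y + ψ ω y) (e : E →L[ℝ] E) (Φ ω x) := by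
      rw [he]
      exact (hasFDerivAt_id _).add (hd ω _).hasFDerivAt
    exact (HasFDerivAt.of_local_left_inverse (fc ω).continuous.continuousAt hA
      (Eventually.of_forall (f1 ω))).differentiableAt
  have deq : ∀ ω x, fderiv ℝ (Φ ω) x + (fderiv ℝ (ψ ω) (Φ ω x)).comp (fderiv ℝ (Φ ω) x) =
      ContinuousLinearMap.id ℝ E := by
    intro ω x
    have h1 : HasFDerivAt (fun x => Φ ω x + ψ ω (Φ ω x)) (fderiv ℝ (Φ ω) x +
      (fderiv ℝ (ψ ω) (Φ ω x)).comp (fderiv ℝ (Φ ω) x)) x :=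
      (fd ω x).hasFDerivAt.add ((hd ω (Φ ω x)).hasFDerivAt.comp x (fd ω x).hasFDerivAt)
    have h2 : (fun x => Φ ω x + ψ ω (Φ ω x)) = id := funext (f1 ω)
    rw [h2] at h1
    exact h1.unique (hasFDerivAt_id x)
  have db : ∀ ω x, ‖fderiv ℝ (Φ ω) x‖ ≤ 2 := fun ω x => norm_fderiv_le_of_lipschitz ℝ (fc ω)
  refine ⟨Φ, f1, f2, fd, f0, fun ω => ?_, fun ω x => ?_, fun ω x y => ?_, fun x => ?_⟩
  · have := deq ω 0
    rwa [f0, hd0, ContinuousLinearMap.zero_comp, add_zero] at this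
  · have := fl ω x 0
    rwa [f0, sub_zero, sub_zero] at this
  · set D := fderiv ℝ (Φ ω) x
    set D' := fderiv ℝ (Φ ω) y
    set P := fderiv ℝ (ψ ω) (Φ ω x)
    set P' := fderiv ℝ (ψ ω) (Φ ω y)
    have e : D - D' = -(P.comp (D - D')) - (P - P').comp D' := by
      have a1 : D + P.comp D = ContinuousLinearMap.id ℝ E := deq ω x
      have a2 : D' + P'.comp D' = ContinuousLinearMap.id ℝ E := deq ω y
      have : D - D' = P'.comp D' - P.comp D := by
        rw [sub_eq_sub_iff_add_eq_add, a1, add_comm, a2]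
      refine this.trans ?_
      ext v; simp
    have b1 : ‖P.comp (D - D')‖ ≤ 1/2 * ‖D - D'‖ :=
      (ContinuousLinearMap.opNorm_comp_le _ _).trans (by gcongr; exact hb ω _)
    have b2 : ‖(P - P').comp D'‖ ≤ (c * (2 * ‖x - y‖ ^ β)) * 2 := by
      refine (ContinuousLinearMap.opNorm_comp_le _ _).trans ?_
      refine mul_le_mul ((hh ω _ _).trans ?_) (db ω y) (norm_nonneg _) (by positivity)
      gcongr
      calc ‖Φ ω x - Φ ω y‖ ^ β ≤ (2 * ‖x - y‖) ^ β := by gcongr; exact fl ω x y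
        _ = 2 ^ β * ‖x - y‖ ^ β := Real.mul_rpow (by norm_num) (norm_nonneg _)
        _ ≤ 2 * ‖x - y‖ ^ β := by
          gcongr
          calc (2:ℝ) ^ β ≤ 2 ^ (1:ℝ) := Real.rpow_le_rpow_of_exponent_le (by norm_num) hβ1
            _ = 2 := Real.rpow_one 2
    have h3 : ‖D - D'‖ ≤ ‖P.comp (D - D')‖ + ‖(P - P').comp D'‖ := by
      conv_lhs => rw [e]
      exact (norm_sub_le _ _).trans (by rw [norm_neg])
    linarith
  · have key : ∀ n : ℕ, Measurable fun ω => (fun y => x - ψ ω y)^[n] (0 : E) := by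
      intro n
      induction n with
      | zero => exact measurable_const
      | succ n ih =>
        simp only [Function.iterate_succ', Function.comp]
        exact measurable_const.sub (meas_comp hm (fun ω => (hd ω).continuous) measurable_id ih)
    refine measurable_of_tendsto_metrizable key ?_
    rw [tendsto_pi_nhds]
    intro ω
    exact (hcon ω x).tendsto_iterate_fixedPoint 0
end inv
end RB
namespace RB
section core2
variable {p : ℕ} {V : Fin p → Type} [∀ b, NormedAddCommGroup (V b)] [∀ b, NormedSpace ℝ (V b)]

theorem Sat.dn {σ : (∀ b, V b) → (∀ b, V b)} {C β : ℝ} (hσ : Sat σ C β) (x : ∀ b, V b) :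
    ‖fderiv ℝ σ x‖ ≤ C := by
  have hC := hσ.one
  exact ContinuousLinearMap.opNorm_le_bound _ (by linarith) fun v =>
      (pi_norm_le_iff_of_nonneg (by positivity)).2 fun b => (hσ.d1 x v b).trans
        (by gcongr; exact norm_le_pi_norm v b)

theorem Sat.dh {σ : (∀ b, V b) → (∀ b, V b)} {C β : ℝ} (hσ : Sat σ C β) (x y : ∀ b, V b) :
    ‖fderiv ℝ σ x - fderiv ℝ σ y‖ ≤ C * ‖x - y‖ ^ β := by
  have hC := hσ.one
  exact ContinuousLinearMap.opNorm_le_bound _ (by positivity) fun v =>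
      (pi_norm_le_iff_of_nonneg (by positivity)).2 fun b => (hσ.d2 x y v b).trans
        (by gcongr; exact norm_le_pi_norm v b)

variable [∀ b, CompleteSpace (V b)]
  {Ω : Type*} [MeasurableSpace Ω] [∀ b, MeasurableSpace (V b)] [∀ b, BorelSpace (V b)]
  [∀ b, SecondCountableTopology (V b)]
  {θ : Equiv.Perm Ω} {B : ℤ → Ω → ∀ b, V b →L[ℝ] V b} {K : Ω → ℝ}
  {lam : Fin p → ℝ} {ε η β γ Λ δ Cσ : ℝ} {dir : Fin p → Fin p → Fin p → Bool}
  {g : Ω → (∀ b, V b) → (∀ b, V b)} {σ : (∀ b, V b) → (∀ b, V b)}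

theorem core2 (gl : Gl θ B K lam ε η β γ Λ δ Cσ dir (fun ω x => g ω (σ x)) σ) (hp : 1 ≤ p) (hβ1 : β ≤ 1)
    (hΛ0 : 0 ≤ Λ)
    (hsm : 4 ^ p * Cs Λ ε γ δ (CNc p) (C0c p) Cσ p * p * Cσ ≤ 1 / 2) :
    ∃ (Φ Ψ : Ω → (∀ b, V b) → (∀ b, V b)) (c : ℝ), (∀ ω x, Ψ ω (Φ ω x) = x) ∧ (∀ ω x, Φ ω (Ψ ω x) = x) ∧
      (∀ ω, Differentiable ℝ (Φ ω)) ∧ (∀ ω, Differentiable ℝ (Ψ ω)) ∧ (∀ ω, Φ ω 0 = 0) ∧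
      (∀ ω, fderiv ℝ (Φ ω) 0 = ContinuousLinearMap.id ℝ _) ∧
      (∀ ω x y, ‖fderiv ℝ (Φ ω) x - fderiv ℝ (Φ ω) y‖ ≤ c * ‖x - y‖ ^ β) ∧
      (∀ ω x y, ‖fderiv ℝ (Ψ ω) x - fderiv ℝ (Ψ ω) y‖ ≤ c * ‖x - y‖ ^ β) ∧
      (∀ x, Measurable fun ω => Φ ω x) ∧
      (∀ ω y, K ω * Real.exp (Λ + ε) * ‖y‖ ≤ 1 / 4 →
        Φ (θ ω) (dg (B 1 ω) y + g ω y) = dg (B 1 ω) (Φ ω y)) := by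
  obtain ⟨W, Wd, W0, Wd0, Wb, Wh, Wm, We⟩ := core gl hp
  have hCs : 0 ≤ Cs Λ ε γ δ (CNc p) (C0c p) Cσ p := Cc_nonneg gl
  have hσ := gl.sat
  have hC := hσ.one
  have hβ0 := gl.β0
  set c0 : ℝ := 4 ^ p * Cs Λ ε γ δ (CNc p) (C0c p) Cσ p * p with hc0
  have c00 : 0 ≤ c0 := by positivity
  set ψ : Ω → (∀ b, V b) → (∀ b, V b) := fun ω x => W ω (σ x) - σ x with hψ
  have s0 : σ 0 = 0 := hσ.idn 0 (by simp)
  have ψd : ∀ ω x, HasFDerivAt (ψ ω) ((fderiv ℝ (W ω) (σ x) - ContinuousLinearMap.id ℝ _).comp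
      (fderiv ℝ σ x)) x := by
    intro ω x
    have h1 := ((Wd ω (σ x)).hasFDerivAt.comp x (hσ.diff x).hasFDerivAt).sub (hσ.diff x).hasFDerivAt
    rw [ContinuousLinearMap.sub_comp, ContinuousLinearMap.id_comp]
    exact h1
  have bd : ∀ ω x, ‖fderiv ℝ (ψ ω) x‖ ≤ 1/2 := fun ω x => by
    rw [(ψd ω x).fderiv]
    refine (ContinuousLinearMap.opNorm_comp_le _ _).trans (le_trans ?_ hsm)
    exact mul_le_mul (Wb ω _ (hσ.box x)) (hσ.dn x) (norm_nonneg _) c00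
  have hh : ∀ ω x y, ‖fderiv ℝ (ψ ω) x - fderiv ℝ (ψ ω) y‖ ≤ 2 * c0 * Cσ ^ 2 * ‖x - y‖ ^ β := by
    intro ω x y
    rw [(ψd ω x).fderiv, (ψd ω y).fderiv]
    set A := fderiv ℝ (W ω) (σ x)
    set A' := fderiv ℝ (W ω) (σ y)
    have e : (A - ContinuousLinearMap.id ℝ _).comp (fderiv ℝ σ x) -
        (A' - ContinuousLinearMap.id ℝ _).comp (fderiv ℝ σ y) =
        (A - A').comp (fderiv ℝ σ x) + (A' - ContinuousLinearMap.id ℝ _).comp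
          (fderiv ℝ σ x - fderiv ℝ σ y) := by ext v; simp; abel
    rw [e]
    have hC2 : Cσ ^ β ≤ Cσ := by
      calc Cσ ^ β ≤ Cσ ^ (1:ℝ) := Real.rpow_le_rpow_of_exponent_le hC hβ1
        _ = Cσ := Real.rpow_one _
    have t0 : 0 ≤ ‖x - y‖ ^ β := by positivity
    have c1 : ‖(A - A').comp (fderiv ℝ σ x)‖ ≤ (c0 * (Cσ * ‖x - y‖ ^ β)) * Cσ := by
      refine (ContinuousLinearMap.opNorm_comp_le _ _).trans ?_
      refine mul_le_mul ((Wh ω _ (hσ.box x) _ (hσ.box y)).trans ?_) (hσ.dn x) (norm_nonneg _)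
        (by positivity)
      gcongr
      calc ‖σ x - σ y‖ ^ β ≤ (Cσ * ‖x - y‖) ^ β := by gcongr; exact hσ.lip x y
        _ = Cσ ^ β * ‖x - y‖ ^ β := Real.mul_rpow (by linarith) (norm_nonneg _)
        _ ≤ Cσ * ‖x - y‖ ^ β := by gcongr
    have c2 : ‖(A' - ContinuousLinearMap.id ℝ _).comp (fderiv ℝ σ x - fderiv ℝ σ y)‖ ≤
        c0 * (Cσ * ‖x - y‖ ^ β) := by
      refine (ContinuousLinearMap.opNorm_comp_le _ _).trans ?_
      exact mul_le_mul (Wb ω _ (hσ.box y)) (hσ.dh x y) (norm_nonneg _) c00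
    refine (norm_add_le _ _).trans ((add_le_add c1 c2).trans ?_)
    have h4 : Cσ ≤ Cσ ^ 2 := by nlinarith
    have : 0 ≤ c0 * ‖x - y‖ ^ β := by positivity
    nlinarith
  obtain ⟨Φ, f1, f2, fd, f0, fd0, fl, fh, fm⟩ := global_inv (ψ := ψ) (c := 2 * c0 * Cσ ^ 2) (by positivity)
    hβ0 hβ1 (fun ω x => (ψd ω x).differentiableAt) (fun ω => by simp [hψ, s0, W0])
    (fun ω => by rw [(ψd ω 0).fderiv, s0, Wd0]; simp) bd hh (fun x => (Wm _).sub measurable_const)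
  have Ψd : ∀ ω x, HasFDerivAt (fun x => x + ψ ω x) (ContinuousLinearMap.id ℝ _ + fderiv ℝ (ψ ω) x) x :=
    fun ω x => (hasFDerivAt_id x).add (ψd ω x).differentiableAt.hasFDerivAt
  refine ⟨Φ, fun ω x => x + ψ ω x, 8 * (2 * c0 * Cσ ^ 2), f1, f2, fd,
    fun ω x => (Ψd ω x).differentiableAt, f0, fd0, fh, fun ω x y => ?_, fm, fun ω y hy => ?_⟩
  · rw [(Ψd ω x).fderiv, (Ψd ω y).fderiv, add_sub_add_left_eq_sub]
    refine (hh ω x y).trans ?_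
    have : 0 ≤ 2 * c0 * Cσ ^ 2 := by positivity
    exact mul_le_mul_of_nonneg_right (by linarith) (by positivity)
  · have hK := gl.coc.K1 ω
    have hε := gl.ε0
    have hE : 1 ≤ Real.exp (Λ + ε) := Real.one_le_exp (by positivity)
    have hKE : 1 ≤ K ω * Real.exp (Λ + ε) := by nlinarith
    have y4 : ‖y‖ ≤ 1/4 := by nlinarith [norm_nonneg y]
    set x := Φ ω y with hx
    have x2 : ‖x‖ ≤ 2 * ‖y‖ := fl ω y
    have hxy : x + ψ ω x = y := f1 ω y
    have sx : σ x = x := hσ.idn x (by linarith)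
    have sy : σ y = y := hσ.idn y (by linarith)
    have hW : W ω x = y := by
      have := hxy; simp only [hψ, sx] at this; rw [← this]; abel
    have hB : ∀ b, ‖B 1 ω b‖ ≤ K ω * Real.exp (Λ + ε) := fun b => by
      refine (gl.coc.bd 1 ω b).trans ?_
      have := (abs_le.1 (gl.hΛ b)).2
      exact mul_le_mul_of_nonneg_left (Real.exp_le_exp.2 (by simp; exact this)) (by linarith)
    have hBx : ‖dg (B 1 ω) x‖ ≤ 1/2 := by
      refine (dg_norm_le (by positivity) hB x).trans ?_
      nlinarith
    have h1 := We ω x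
    simp only [sx, hW, sy] at h1
    have h2 := f2 (θ ω) (dg (B 1 ω) x)
    simp only [hψ, hσ.idn _ hBx, h1] at h2
    rw [← h2]
    congr 1
    abel
end core2
end RB
namespace RB
section scaled
variable {p : ℕ} {V : Fin p → Type} [∀ b, NormedAddCommGroup (V b)] [∀ b, NormedSpace ℝ (V b)]
  [∀ b, FiniteDimensional ℝ (V b)] [∀ b, HasContDiffBump (V b)]
  {Ω : Type*} [MeasurableSpace Ω] [∀ b, MeasurableSpace (V b)] [∀ b, BorelSpace (V b)]
  {θ : Equiv.Perm Ω} {B : ℤ → Ω → ∀ b, V b →L[ℝ] V b} {Q : Ω → ℝ}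
  {lam : Fin p → ℝ} {ε0 η β γ Λ : ℝ} {dir : Fin p → Fin p → Fin p → Bool}
  {H : Ω → (∀ b, V b) → (∀ b, V b)}

theorem meas_comp_at {E1 E2 : Type*} [NormedAddCommGroup E1] [MeasurableSpace E1] [BorelSpace E1]
    [SecondCountableTopology E1] [NormedAddCommGroup E2] [MeasurableSpace E2] [BorelSpace E2]
    {g : Ω → E1 → E2} (hg : ∀ x, Measurable fun ω => g ω x) {y : Ω → E1} (hy : Measurable y)
    (hc : ∀ ω, ContinuousAt (g ω) (y ω)) : Measurable fun ω => g ω (y ω) := by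
  have hs := hy.stronglyMeasurable
  refine measurable_of_tendsto_metrizable (f := fun n ω => g ω (hs.approx n ω))
    (fun n => (hs.approx n).measurable_bind (fun x ω => g ω x) hg) ?_
  rw [tendsto_pi_nhds]
  intro ω
  exact (hc ω).tendsto.comp (hs.tendsto_approx ω)

section sg
variable {E : Type*} [NormedAddCommGroup E] [NormedSpace ℝ E]
theorem sg1 {H : E → E} {a b : ℝ} {x : E} (hd : DifferentiableAt ℝ H (a • x)) :
    HasFDerivAt (fun z => b • H (a • z)) ((b * a) • fderiv ℝ H (a • x)) x := by
  have h1 : HasFDerivAt (fun z : E => a • z) (a • ContinuousLinearMap.id ℝ E) x :=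
    (hasFDerivAt_id x).const_smul a
  have h2 := (hd.hasFDerivAt.comp x h1).const_smul b
  have e : (b * a) • fderiv ℝ H (a • x) =
      b • (fderiv ℝ H (a • x)).comp (a • ContinuousLinearMap.id ℝ E) := by
    ext v; simp [smul_smul]
  rw [e]; exact h2

theorem sg2 {H : E → E} {a b : ℝ} {x : E} (hd : DifferentiableAt ℝ H (a • x)) (h0 : fderiv ℝ H (a • x) = 0) :
    fderiv ℝ (fun z => b • H (a • z)) x = 0 := by
  rw [(sg1 hd).fderiv, h0, smul_zero]

theorem sg3 {H : E → E} {a b : ℝ} {x y : E} (hd : DifferentiableAt ℝ H (a • x))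
    (hd' : DifferentiableAt ℝ H (a • y)) :
    ‖fderiv ℝ (fun z => b • H (a • z)) x - fderiv ℝ (fun z => b • H (a • z)) y‖ =
      |b * a| * ‖fderiv ℝ H (a • x) - fderiv ℝ H (a • y)‖ := by
  rw [(sg1 hd).fderiv, (sg1 hd').fderiv, ← smul_sub, norm_smul, Real.norm_eq_abs]

theorem sg4 {H : E → E} {a : ℝ} (ha : a ≠ 0) (x : E) (hd : Differentiable ℝ H) :
    HasFDerivAt (fun z => a • H (a⁻¹ • z)) (fderiv ℝ H (a⁻¹ • x)) x := by
  have := sg1 (b := a) (hd (a⁻¹ • x))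
  rwa [mul_inv_cancel₀ ha, one_smul] at this
end sg

theorem scaled (hp : 1 ≤ p) (hB0 : ∀ ω b, B 0 ω b = ContinuousLinearMap.id ℝ (V b))
    (hBadd : ∀ m n ω b, B (m + n) ω b = (B m ((θ ^ n) ω) b).comp (B n ω b))
    (hBb : ∀ n ω b, ‖B n ω b‖ ≤ Q ω * Real.exp (lam b * n + ε0 * |(n : ℝ)|))
    (hQ1 : ∀ ω, 1 ≤ Q ω) (hQs : ∀ (n : ℤ) ω, Q ((θ ^ n) ω) ≤ Real.exp (ε0 * |(n : ℝ)|) * Q ω)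
    (hQm : Measurable Q)
    (hε0 : 0 < ε0) (anti : StrictAnti lam) (η0 : 0 ≤ η) (η1 : η < 1) (hΛ0 : 0 ≤ Λ)
    (hΛ : ∀ b, |lam b| ≤ Λ) (β0 : 0 < β) (β1 : β ≤ 1) (βη : β ≤ η) (βΛ : β * Λ ≤ 6 * ε0)
    (γε : 16 * (6 * ε0) ≤ γ)
    (fw : ∀ i κ, i ≤ κ → ∀ j, dir i κ j = true → ∀ b ∈ Finset.Icc i κ,
      sw lam η i κ b * lam i + tw lam η i κ b * lam κ + lam b - lam j ≤ -γ)
    (bw : ∀ i κ, i ≤ κ → ∀ j, dir i κ j = false → ∀ b ∈ Finset.Icc i κ,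
      γ ≤ sw lam η i κ b * lam i + tw lam η i κ b * lam κ + lam b - lam j)
    (hθ : ∀ m : ℤ, Measurable (θ ^ m : Equiv.Perm Ω))
    (hBm : ∀ n b v, Measurable fun ω => B n ω b v)
    {c1 C2 : ℝ} (hc1 : 0 < c1) (hC2 : 0 < C2)
    (Hd : ∀ ω, ∀ x ∈ closedBall (0 : ∀ b, V b) (c1 * (Q ω)⁻¹), DifferentiableAt ℝ (H ω) x)
    (H0 : ∀ ω, H ω 0 = 0) (dH0 : ∀ ω, fderiv ℝ (H ω) 0 = 0)
    (Hl : ∀ ω, ∀ x ∈ closedBall (0 : ∀ b, V b) (c1 * (Q ω)⁻¹), ∀ y ∈ closedBall (0 : ∀ b, V b) (c1 * (Q ω)⁻¹),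
      ‖fderiv ℝ (H ω) x - fderiv ℝ (H ω) y‖ ≤ C2 * Q ω * ‖x - y‖)
    (Hm : ∀ x, Measurable fun ω => H ω x) :
    ∃ (Φ Ψ : Ω → (∀ b, V b) → (∀ b, V b)) (r1 : ℝ), 0 < r1 ∧
      (∀ ω x, Ψ ω (Φ ω x) = x) ∧ (∀ ω x, Φ ω (Ψ ω x) = x) ∧
      (∀ ω, Differentiable ℝ (Φ ω)) ∧ (∀ ω, Differentiable ℝ (Ψ ω)) ∧ (∀ ω, Φ ω 0 = 0) ∧
      (∀ ω, fderiv ℝ (Φ ω) 0 = ContinuousLinearMap.id ℝ _) ∧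
      (∀ ω, ∃ c : ℝ, (∀ x y, ‖fderiv ℝ (Φ ω) x - fderiv ℝ (Φ ω) y‖ ≤ c * ‖x - y‖ ^ β) ∧
      (∀ x y, ‖fderiv ℝ (Ψ ω) x - fderiv ℝ (Ψ ω) y‖ ≤ c * ‖x - y‖ ^ β)) ∧
      (∀ x, Measurable fun ω => Φ ω x) ∧
      (∀ ω y, ‖y‖ ≤ r1 * (Q ω ^ 6)⁻¹ →
        Φ (θ ω) (dg (B 1 ω) y + H ω y) = dg (B 1 ω) (Φ ω y)) := by
  obtain ⟨σ, Cσ, hσ⟩ := exists_sat (V := V)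
  have hCσ : 1 ≤ Cσ := (hσ 1 one_pos le_rfl).one
  have hγ : 0 < γ := by linarith
  have hCT := CT_pos (Λ := Λ) (ε := 6 * ε0) (γ := γ) hγ
  have hC0 := C0c_nonneg p
  have hQ0 : ∀ ω, 0 < Q ω := fun ω => by linarith [hQ1 ω]
  -- choice of δ
  set Z : ℝ := Cs Λ (6 * ε0) γ 1 (CNc p) (C0c p) Cσ p with hZ
  have hZ0 : 0 ≤ Z := by rw [hZ]; unfold Cs; positivity
  have hZδ : ∀ δ, Cs Λ (6 * ε0) γ δ (CNc p) (C0c p) Cσ p = δ * Z := fun δ => by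
    rw [hZ]; unfold Cs; ring
  set T : ℝ := 1 + Z + 4 ^ p * Z * p * Cσ with hT
  have hT0 : 0 < T := by positivity
  set δ : ℝ := 1 / 2 / T with hδ
  have hδ0 : 0 < δ := by positivity
  have hδT : δ * T = 1 / 2 := by rw [hδ]; field_simp
  have hcc1 : δ * Z ≤ 1 / 2 := by
    rw [← hδT]; gcongr; rw [hT]; have : 0 ≤ 4 ^ p * Z * p * Cσ := by positivity
    linarith
  have hcc2 : 4 ^ p * (δ * Z) * p * Cσ ≤ 1 / 2 := by
    have : 4 ^ p * (δ * Z) * p * Cσ = δ * (4 ^ p * Z * p * Cσ) := by ring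
    rw [this, ← hδT]; gcongr; rw [hT]; linarith
  -- choice of r0
  set r0 : ℝ := min c1 (δ / (2 * Cσ ^ 2 * C2 * Real.exp (5 * ε0))) with hr0
  have r00 : 0 < r0 := lt_min hc1 (by positivity)
  have r01 : r0 ≤ c1 := min_le_left _ _
  have r02 : 2 * Cσ ^ 2 * (r0 * C2 * Real.exp (5 * ε0)) ≤ δ := by
    have : r0 ≤ δ / (2 * Cσ ^ 2 * C2 * Real.exp (5 * ε0)) := min_le_right _ _
    rw [le_div_iff₀ (by positivity)] at this
    linarith
  set r : Ω → ℝ := fun ω => r0 * (Q ω ^ 5)⁻¹ with hr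
  have rpos : ∀ ω, 0 < r ω := fun ω => by have := hQ0 ω; simp only [hr]; positivity
  have rm : Measurable r := (hQm.pow_const 5).inv.const_mul r0
  have rrat : ∀ (n : ℤ) ω, r ω / r ((θ ^ n) ω) ≤ Real.exp (5 * ε0 * |(n:ℝ)|) := by
    intro n ω
    have h1 := hQ0 ω
    have h2 := hQ0 ((θ ^ n) ω)
    have e : r ω / r ((θ ^ n) ω) = (Q ((θ ^ n) ω) / Q ω) ^ 5 := by
      simp only [hr]; field_simp
    rw [e]
    have h3 : Q ((θ ^ n) ω) / Q ω ≤ Real.exp (ε0 * |(n:ℝ)|) := by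
      rw [div_le_iff₀ h1]; exact hQs n ω
    calc _ ≤ (Real.exp (ε0 * |(n:ℝ)|)) ^ 5 := by gcongr
      _ = _ := by rw [← Real.exp_nat_mul]; push_cast; ring_nf
  have rc1 : ∀ ω, r ω ≤ c1 * (Q ω)⁻¹ := fun ω => by
    simp only [hr]
    have h1 := hQ1 ω
    have : Q ω ≤ Q ω ^ 5 := le_self_pow₀ h1 (by norm_num)
    gcongr
  have ballr : ∀ ω, ∀ x ∈ closedBall (0 : ∀ b, V b) 1, r ω • x ∈ closedBall (0 : ∀ b, V b) (c1 * (Q ω)⁻¹) := by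
    intro ω x hx
    rw [mem_closedBall_zero_iff] at hx ⊢
    rw [norm_smul, Real.norm_eq_abs, abs_of_pos (rpos ω)]
    have := rc1 ω
    nlinarith [rpos ω]
  set g : Ω → (∀ b, V b) → (∀ b, V b) := fun ω z => (r (θ ω))⁻¹ • H ω (r ω • z) with hg
  have gder : ∀ ω, ∀ x ∈ closedBall (0 : ∀ b, V b) 1, DifferentiableAt ℝ (g ω) x :=
    fun ω x hx => (sg1 (Hd ω _ (ballr ω x hx))).differentiableAt
  have z0 : (0 : ∀ b, V b) ∈ closedBall (0 : ∀ b, V b) 1 := by simp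
  have hgF : ∀ ω, FF (fun x => g ω (σ x)) (δ * (Q ω ^ 4)⁻¹) := by
    intro ω
    have hq := hQ0 ω
    have rr1 : r ω / r (θ ω) ≤ Real.exp (5 * ε0) := by simpa using rrat 1 ω
    have rr0 : 0 ≤ r ω / r (θ ω) := by have := rpos ω; have := rpos (θ ω); positivity
    have h := FF_of_loc (hσ 1 one_pos le_rfl) (g := g ω) (m := Real.exp (5 * ε0) * (C2 * Q ω) * r ω)
      (by have := rpos ω; positivity) (gder ω) (by simp [hg, H0])
      (sg2 (Hd ω _ (ballr ω 0 z0)) (by rw [smul_zero]; exact dH0 ω)) (fun x hx y hy => by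
        refine (sg3 (Hd ω _ (ballr ω x hx)) (Hd ω _ (ballr ω y hy))).le.trans ?_
        rw [← div_eq_inv_mul, abs_of_nonneg rr0]
        have h1 := Hl ω _ (ballr ω x hx) _ (ballr ω y hy)
        have e : r ω • x - r ω • y = r ω • (x - y) := (smul_sub _ _ _).symm
        rw [e, norm_smul, Real.norm_eq_abs, abs_of_pos (rpos ω)] at h1
        calc _ ≤ Real.exp (5 * ε0) * (C2 * Q ω * (r ω * ‖x - y‖)) :=
              mul_le_mul rr1 h1 (norm_nonneg _) (by positivity)
          _ = _ := by ring)
    refine ⟨h.diff, h.z, h.dz, fun x y => (h.lip x y).trans ?_, by positivity⟩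
    refine mul_le_mul_of_nonneg_right ?_ (norm_nonneg _)
    calc 2 * Cσ ^ 2 * (Real.exp (5 * ε0) * (C2 * Q ω) * r ω)
        = (2 * Cσ ^ 2 * (r0 * C2 * Real.exp (5 * ε0))) * (Q ω ^ 4)⁻¹ := by
          simp only [hr]; field_simp
      _ ≤ _ := by gcongr
  set B' : ℤ → Ω → ∀ b, V b →L[ℝ] V b := fun n ω b => (r ω / r ((θ ^ n) ω)) • B n ω b with hB'
  have hcoc : Coc θ B' Q lam (6 * ε0) := by
    refine ⟨fun ω b => ?_, fun m n ω b => ?_, fun n ω b => ?_, hQ1, fun n ω => (hQs n ω).trans ?_⟩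
    · simp [hB', hB0, div_self (rpos ω).ne']
    · have h1 := (rpos ((θ ^ n) ω)).ne'
      simp only [hB', hBadd, zpow_add, Equiv.Perm.mul_apply]
      ext v
      simp only [ContinuousLinearMap.smul_apply, ContinuousLinearMap.comp_apply, map_smul, smul_smul]
      congr 1
      field_simp
    · have h2 := rpos ω
      have h3 := rpos ((θ ^ n) ω)
      have h4 := hQ0 ω
      simp only [hB']
      rw [norm_smul, Real.norm_eq_abs, abs_of_pos (by positivity)]
      calc _ ≤ Real.exp (5 * ε0 * |(n:ℝ)|) * (Q ω * Real.exp (lam b * n + ε0 * |(n : ℝ)|)) := by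
            gcongr; exact rrat n ω; exact hBb n ω b
        _ = Q ω * (Real.exp (5 * ε0 * |(n:ℝ)|) * Real.exp (lam b * n + ε0 * |(n : ℝ)|)) := by ring
        _ = _ := by rw [← Real.exp_add]; ring_nf
    · have := hQ0 ω
      gcongr
      linarith
  have hθ1 : Measurable θ := by simpa using hθ 1
  have gl : Gl θ B' Q lam (6 * ε0) η β γ Λ δ Cσ dir (fun ω x => g ω (σ x)) σ :=
    { coc := hcoc, ε0 := by positivity, anti := anti, η0 := η0, η1 := η1, hΛ := hΛ, β0 := β0, βη := βη
      βΛ := βΛ, γε := γε, fw := fw, bw := bw, sat := hσ β β0 β1, δ0 := hδ0.le, hf := hgF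
      hc := by rw [hZδ]; exact hcc1
      hθ := hθ
      hBm := fun n b v => (rm.div (rm.comp (hθ n))).smul (hBm n b v)
      hfm := fun x => by
        refine (rm.comp hθ1).inv.smul ?_
        refine meas_comp_at (E1 := ∀ b, V b) (E2 := ∀ b, V b) Hm (rm.smul_const (σ x)) fun ω => ?_
        exact (Hd ω _ (ballr ω _ ((hσ 1 one_pos le_rfl).box x))).continuousAt }
  obtain ⟨Φ, Ψ, c, i1, i2, d1, d2, f0, fd0, h1, h2, fm, fe⟩ := core2 gl hp β1 hΛ0 (by rw [hZδ]; exact hcc2)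
  have rne : ∀ ω, r ω ≠ 0 := fun ω => (rpos ω).ne'
  have sc : ∀ {U : Ω → (∀ b, V b) → (∀ b, V b)}, (∀ ω, Differentiable ℝ (U ω)) → ∀ ω x,
      HasFDerivAt (fun x => r ω • U ω ((r ω)⁻¹ • x)) (fderiv ℝ (U ω) ((r ω)⁻¹ • x)) x := by
    intro U hU ω x
    exact sg4 (rne ω) x (hU ω)
  have hol : ∀ {U : Ω → (∀ b, V b) → (∀ b, V b)}, (∀ ω, Differentiable ℝ (U ω)) →
      (∀ ω x y, ‖fderiv ℝ (U ω) x - fderiv ℝ (U ω) y‖ ≤ c * ‖x - y‖ ^ β) → ∀ ω x y,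
      ‖fderiv ℝ (fun x => r ω • U ω ((r ω)⁻¹ • x)) x - fderiv ℝ (fun x => r ω • U ω ((r ω)⁻¹ • x)) y‖ ≤
        (c * ((r ω)⁻¹) ^ β) * ‖x - y‖ ^ β := by
    intro U hU hh ω x y
    rw [(sc hU ω x).fderiv, (sc hU ω y).fderiv]
    refine (hh ω _ _).trans (le_of_eq ?_)
    have := rpos ω
    rw [← smul_sub, norm_smul, Real.norm_eq_abs, abs_of_pos (by positivity),
      Real.mul_rpow (by positivity) (norm_nonneg _), mul_assoc]
  refine ⟨fun ω x => r ω • Φ ω ((r ω)⁻¹ • x), fun ω x => r ω • Ψ ω ((r ω)⁻¹ • x),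
    r0 / (4 * Real.exp (Λ + 6 * ε0)), by positivity, fun ω x => ?_, fun ω x => ?_,
    fun ω x => (sc d1 ω x).differentiableAt, fun ω x => (sc d2 ω x).differentiableAt, fun ω => ?_, fun ω => ?_,
    fun ω => ⟨c * ((r ω)⁻¹) ^ β, hol d1 h1 ω, hol d2 h2 ω⟩, fun x => ?_, fun ω y hy => ?_⟩
  · simp [smul_smul, rne ω, i1]
  · simp [smul_smul, rne ω, i2]
  · simp [f0]
  · rw [(sc d1 ω 0).fderiv, smul_zero, fd0]
  · refine rm.smul ?_
    exact meas_comp (E1 := ∀ b, V b) (E2 := ∀ b, V b) fm (fun ω => (d1 ω).continuous) measurable_id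
      (rm.inv.smul_const x)
  · have hq := hQ0 ω
    have key := fe ω ((r ω)⁻¹ • y) (by
      rw [norm_smul, norm_inv, Real.norm_eq_abs, abs_of_pos (rpos ω)]
      have := rpos ω
      calc Q ω * Real.exp (Λ + 6 * ε0) * ((r ω)⁻¹ * ‖y‖) ≤ Q ω * Real.exp (Λ + 6 * ε0) * ((r ω)⁻¹ *
            (r0 / (4 * Real.exp (Λ + 6 * ε0)) * (Q ω ^ 6)⁻¹)) := by gcongr
        _ = 1/4 := by simp only [hr]; field_simp)
    have e1 : dg (B' 1 ω) ((r ω)⁻¹ • y) + g ω ((r ω)⁻¹ • y) = (r (θ ω))⁻¹ • (dg (B 1 ω) y + H ω y) := by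
      simp only [hg, smul_smul, mul_inv_cancel₀ (rne ω), one_smul, smul_add]
      congr 1
      funext b
      simp only [dg_apply, hB', ContinuousLinearMap.smul_apply, Pi.smul_apply, map_smul, smul_smul, zpow_one]
      congr 1
      have := rne ω
      have := rne (θ ω)
      field_simp
    have e2 : r (θ ω) • dg (B' 1 ω) (Φ ω ((r ω)⁻¹ • y)) = dg (B 1 ω) (r ω • Φ ω ((r ω)⁻¹ • y)) := by
      funext b
      simp only [dg_apply, hB', ContinuousLinearMap.smul_apply, Pi.smul_apply, map_smul, smul_smul, zpow_one]
      congr 1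
      have := rne (θ ω)
      field_simp
    rw [e1] at key
    simp only
    rw [key, e2]
end scaled
end RB
namespace RB
section outer1
variable {Ω : Type*}

theorem iter_eq {θ : Equiv.Perm Ω} {it : ℤ → Ω → Ω} (h0 : ∀ ω, it 0 ω = ω)
    (hS : ∀ (n : ℤ) (ω : Ω), it (n + 1) ω = θ (it n ω)) (n : ℤ) : it n = fun ω => (θ ^ n) ω := by
  funext ω
  induction n using Int.induction_on with
  | zero => simp [h0]
  | succ n ih => rw [hS, ih, add_comm, zpow_add, zpow_one]; rfl
  | pred n ih =>
    apply θ.injective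
    rw [← hS, sub_add_cancel, ih, ← Equiv.Perm.mul_apply, ← zpow_one_add]
    congr 2; ring

theorem perm_meas [MeasurableSpace Ω] {θ : Equiv.Perm Ω} (h : Measurable θ) (h' : Measurable θ.symm) (m : ℤ) :
    Measurable (θ ^ m : Equiv.Perm Ω) := by
  induction m using Int.induction_on with
  | zero => simpa using measurable_id
  | succ n ih => rw [zpow_add, zpow_one]; exact ih.comp h
  | pred n ih => rw [zpow_sub, zpow_one]; exact ih.comp h'

theorem exists_dec {d p : ℕ} {X : Fin p → Submodule ℝ (Ed d)} (hX : DirectSum.IsInternal X) :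
    ∃ e : Ed d ≃L[ℝ] (∀ b, X b), ∀ y, e.symm y = ∑ b, (y b : Ed d) := by
  let f : (∀ b, X b) ≃ₗ[ℝ] Ed d := (DirectSum.linearEquivFunOnFintype ℝ (Fin p) (fun b => X b)).symm.trans
    (LinearEquiv.ofBijective (DirectSum.coeLinearMap X) hX)
  refine ⟨f.symm.toContinuousLinearEquiv, fun y => ?_⟩
  change f y = _
  have h1 : ∀ b (v : X b), f (Pi.single b v) = v := by
    intro b v
    change DirectSum.coeLinearMap X ((DirectSum.linearEquivFunOnFintype ℝ (Fin p) (fun b => X b)).symm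
      (Pi.single b v)) = v
    rw [DirectSum.linearEquivFunOnFintype_symm_single, DirectSum.coeLinearMap_lof]
  conv_lhs => rw [← Finset.univ_sum_single y]
  rw [map_sum]
  exact Finset.sum_congr rfl fun b _ => h1 b _

section clm
variable {E : Type*} [NormedAddCommGroup E] [NormedSpace ℝ E] [FiniteDimensional ℝ E]
  [MeasurableSpace E] [BorelSpace E] [MeasurableSpace Ω]

theorem meas_clm {y : Ω → E →L[ℝ] E} (h : ∀ v, Measurable fun ω => y ω v) : Measurable y := by
  let b := Module.finBasis ℝ E
  let T : (Fin (Module.finrank ℝ E) → E) →ₗ[ℝ] (E →L[ℝ] E) :=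
    (LinearMap.toContinuousLinearMap : (E →ₗ[ℝ] E) ≃ₗ[ℝ] (E →L[ℝ] E)).toLinearMap.comp
      (b.constr ℝ : _ ≃ₗ[ℝ] (E →ₗ[ℝ] E)).toLinearMap
  have e : y = fun ω => T (fun i => y ω (b i)) := by
    funext ω
    ext v
    have : b.constr ℝ (fun i => y ω (b i)) = (y ω : E →ₗ[ℝ] E) := by
      apply b.ext; intro i; simp
    simp [T, this]
  have : ProperSpace E := FiniteDimensional.proper_real E
  rw [e]
  exact T.continuous_of_finiteDimensional.measurable.comp (measurable_pi_lambda _ fun i => h _)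

theorem meas_symm {y : Ω → E ≃L[ℝ] E} (h : ∀ v, Measurable fun ω => y ω v) (v : E) :
    Measurable fun ω => (y ω).symm v := by
  have : CompleteSpace E := FiniteDimensional.complete ℝ E
  have : ProperSpace (E →L[ℝ] E) := FiniteDimensional.proper_real _
  have h1 : Measurable fun ω => (y ω : E →L[ℝ] E) := meas_clm h
  have h2 : Measurable fun ω => ContinuousLinearMap.inverse (y ω : E →L[ℝ] E) :=
    meas_comp_at (g := fun _ T => ContinuousLinearMap.inverse T) (fun T => measurable_const) h1
      (fun ω => (contDiffAt_map_inverse (n := 0) (y ω)).continuousAt)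
  have h3 := (ContinuousLinearMap.measurable_apply v).comp h2
  simpa [Function.comp_def] using h3
end clm
end outer1
end RB
namespace RB
section outer2
variable {Ω : Type*}

theorem exists_coc [MeasurableSpace Ω] {d p : ℕ} {X : Fin p → Submodule ℝ (Ed d)}
    (e : Ed d ≃L[ℝ] (∀ b, X b)) (he : ∀ y, e.symm y = ∑ b, (y b : Ed d))
    {θ : Equiv.Perm Ω} (hθ : ∀ m : ℤ, Measurable (θ ^ m : Equiv.Perm Ω))
    (Λ : Ω → (Ed d ≃L[ℝ] Ed d)) (hΛm : ∀ v, Measurable fun ω => Λ ω v)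
    (hΛX : ∀ (ω : Ω) (j : Fin p), (X j).map (Λ ω : Ed d →ₗ[ℝ] Ed d) = X j)
    (Λc : ℤ → Ω → (Ed d ≃L[ℝ] Ed d))
    (hΛc0 : ∀ ω, Λc 0 ω = ContinuousLinearEquiv.refl ℝ (Ed d))
    (hΛcS : ∀ (n : ℤ) (ω : Ω), Λc (n + 1) ω = (Λc n ω).trans (Λ ((θ ^ n) ω))) :
    ∃ B : ℤ → Ω → ∀ b, X b →L[ℝ] X b,
      (∀ ω b, B 0 ω b = ContinuousLinearMap.id ℝ (X b)) ∧
      (∀ m n ω b, B (m + n) ω b = (B m ((θ ^ n) ω) b).comp (B n ω b)) ∧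
      (∀ n ω b v, ((B n ω b v : X b) : Ed d) = Λc n ω v) ∧
      (∀ n b v, Measurable fun ω => B n ω b v) ∧
      (∀ ω x, dg (B 1 ω) (e x) = e (Λ ω x)) := by
  have hS : ∀ (n : ℤ) (ω : Ω) x, Λc (n + 1) ω x = Λ ((θ ^ n) ω) (Λc n ω x) := fun n ω x => by
    rw [hΛcS]; rfl
  have h0 : ∀ ω x, Λc 0 ω x = x := fun ω x => by rw [hΛc0]; rfl
  have hi : ∀ ω j x, Λ ω x ∈ X j ↔ x ∈ X j := by
    intro ω j x
    constructor
    · intro h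
      rw [← hΛX ω j] at h
      obtain ⟨y, hy, hyx⟩ := h
      have : y = x := (Λ ω).injective hyx
      exact this ▸ hy
    · intro h
      rw [← hΛX ω j]
      exact ⟨x, h, rfl⟩
  have hc : ∀ n ω j x, Λc n ω x ∈ X j ↔ x ∈ X j := by
    intro n ω j x
    induction n using Int.induction_on with
    | zero => rw [h0]
    | succ n ih => rw [hS, hi, ih]
    | pred n ih =>
      rw [← ih]
      have := hS (-n - 1) ω x
      rw [sub_add_cancel] at this
      rw [this, hi]
  have hadd : ∀ m n ω x, Λc (m + n) ω x = Λc m ((θ ^ n) ω) (Λc n ω x) := by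
    intro m n ω x
    induction m using Int.induction_on with
    | zero => rw [h0, zero_add]
    | succ m ih =>
      rw [show (m : ℤ) + 1 + n = (m + n) + 1 by ring, hS, hS, ih, zpow_add]; rfl
    | pred m ih =>
      apply (Λ ((θ ^ (-(m:ℤ) - 1 + n)) ω)).injective
      rw [← hS, show -(m:ℤ) - 1 + n + 1 = -m + n by ring, ih, zpow_add, Equiv.Perm.mul_apply, ← hS,
        sub_add_cancel]
  have hm : ∀ n v, Measurable fun ω => Λc n ω v := by
    intro n v
    induction n using Int.induction_on with
    | zero => simp only [h0]; exact measurable_const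
    | succ n ih =>
      simp only [hS]
      exact meas_comp (g := fun ω x => Λ ω x) hΛm (fun ω => (Λ ω).continuous) (hθ n) ih
    | pred n ih =>
      have : ∀ ω, Λc (-n - 1) ω v = (Λ ((θ ^ (-(n:ℤ) - 1)) ω)).symm (Λc (-n) ω v) := by
        intro ω
        have := hS (-n - 1) ω v
        rw [sub_add_cancel] at this
        rw [this, ContinuousLinearEquiv.symm_apply_apply]
      simp only [this]
      exact meas_comp (g := fun ω x => (Λ ω).symm x) (meas_symm hΛm) (fun ω => (Λ ω).symm.continuous) (hθ _) ih
  refine ⟨fun n ω b => (((Λc n ω : Ed d →L[ℝ] Ed d).comp (X b).subtypeL).codRestrict (X b)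
    (fun v => (hc n ω b v).2 v.2)), ?_, ?_, ?_, ?_, ?_⟩
  · intro ω b
    ext v : 2
    exact h0 ω v
  · intro m n ω b
    ext v : 2
    exact hadd m n ω v
  · intro n ω b v; rfl
  · intro n b v
    exact Measurable.subtype_mk (hm n v)
  · intro ω x
    apply e.symm.injective
    rw [e.symm_apply_apply, he]
    have h1 : ∀ b, ((dg (fun b => (((Λc 1 ω : Ed d →L[ℝ] Ed d).comp (X b).subtypeL).codRestrict (X b)
      (fun v => (hc 1 ω b v).2 v.2))) (e x) b : X b) : Ed d) = Λ ω (e x b : Ed d) := by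
      intro b
      rw [dg_apply]
      change Λc 1 ω (e x b : Ed d) = _
      have := hS 0 ω (e x b : Ed d)
      rwa [zero_add, h0, zpow_zero] at this
    rw [Finset.sum_congr rfl fun b _ => h1 b, ← map_sum, ← he, e.symm_apply_apply]

theorem lip_of_d2 {E : Type*} [NormedAddCommGroup E] [NormedSpace ℝ E] {f : E → E} {r M : ℝ}
    (h : ContDiffOn ℝ 2 f (ball 0 r)) (hb : ∀ x ∈ ball (0:E) r, ‖iteratedFDeriv ℝ 2 f x‖ ≤ M) :
    (∀ x ∈ ball (0:E) r, DifferentiableAt ℝ f x) ∧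
    ∀ x ∈ ball (0:E) r, ∀ y ∈ ball (0:E) r, ‖fderiv ℝ f x - fderiv ℝ f y‖ ≤ M * ‖x - y‖ := by
  have hc : ∀ x ∈ ball (0:E) r, ContDiffAt ℝ 2 f x := fun x hx => h.contDiffAt (isOpen_ball.mem_nhds hx)
  refine ⟨fun x hx => (hc x hx).differentiableAt (by norm_num), fun x hx y hy => ?_⟩
  refine (convex_ball (0:E) r).norm_image_sub_le_of_norm_fderiv_le (𝕜 := ℝ) (f := fderiv ℝ f) (fun z hz => ?_)
    (fun z hz => ?_) hy hx
  · exact ((hc z hz).fderiv_right (m := 1) (by norm_num)).differentiableAt (by norm_num)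
  · rw [← norm_iteratedFDeriv_one, norm_iteratedFDeriv_fderiv]
    exact hb z hz

section cj
variable {E1 E2 : Type*} [NormedAddCommGroup E1] [NormedSpace ℝ E1] [NormedAddCommGroup E2] [NormedSpace ℝ E2]
  (e : E1 ≃L[ℝ] E2)

theorem cj_norm (A : E1 →L[ℝ] E1) : ‖(e : E1 →L[ℝ] E2).comp (A.comp (e.symm : E2 →L[ℝ] E1))‖ ≤
    ‖(e : E1 →L[ℝ] E2)‖ * ‖(e.symm : E2 →L[ℝ] E1)‖ * ‖A‖ := by
  refine (ContinuousLinearMap.opNorm_comp_le _ _).trans ?_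
  have := ContinuousLinearMap.opNorm_comp_le A (e.symm : E2 →L[ℝ] E1)
  have := mul_le_mul_of_nonneg_left this (norm_nonneg (e : E1 →L[ℝ] E2))
  linarith

theorem cj_deriv {f : E1 → E1} {z : E2} (hf : DifferentiableAt ℝ f (e.symm z)) :
    HasFDerivAt (fun z => e (f (e.symm z)))
      ((e : E1 →L[ℝ] E2).comp ((fderiv ℝ f (e.symm z)).comp (e.symm : E2 →L[ℝ] E1))) z :=
  (e : E1 →L[ℝ] E2).hasFDerivAt.comp z (hf.hasFDerivAt.comp z (e.symm : E2 →L[ℝ] E1).hasFDerivAt)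

theorem cj_diff {f : E1 → E1} {x y : E2} (hx : DifferentiableAt ℝ f (e.symm x))
    (hy : DifferentiableAt ℝ f (e.symm y)) {c β : ℝ} (hc : 0 ≤ c) (hβ : 0 ≤ β)
    (h : ‖fderiv ℝ f (e.symm x) - fderiv ℝ f (e.symm y)‖ ≤ c * ‖e.symm x - e.symm y‖ ^ β) :
    ‖fderiv ℝ (fun z => e (f (e.symm z))) x - fderiv ℝ (fun z => e (f (e.symm z))) y‖ ≤
      (‖(e : E1 →L[ℝ] E2)‖ * ‖(e.symm : E2 →L[ℝ] E1)‖ * (c * ‖(e.symm : E2 →L[ℝ] E1)‖ ^ β)) * ‖x - y‖ ^ β := by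
  rw [(cj_deriv e hx).fderiv, (cj_deriv e hy).fderiv, ← ContinuousLinearMap.comp_sub,
    ← ContinuousLinearMap.sub_comp]
  refine (cj_norm e _).trans ?_
  rw [mul_assoc _ (c * _) _]
  refine mul_le_mul_of_nonneg_left (h.trans ?_) (by positivity)
  rw [mul_assoc]
  refine mul_le_mul_of_nonneg_left ?_ hc
  rw [← Real.mul_rpow (norm_nonneg _) (norm_nonneg _), ← map_sub]
  exact Real.rpow_le_rpow (norm_nonneg _) ((e.symm : E2 →L[ℝ] E1).le_opNorm _) hβ
end cj
end outer2
end RB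
set_option maxHeartbeats 400000
namespace RB
theorem cj_pack {E1 E2 : Type*} [NormedAddCommGroup E1] [NormedSpace ℝ E1] [NormedAddCommGroup E2] [NormedSpace ℝ E2]
    (e : E1 ≃L[ℝ] E2) {f : E1 → E1} (hf : Differentiable ℝ f) {β c : ℝ} (hβ : 0 < β)
    (h : ∀ x y, ‖fderiv ℝ f x - fderiv ℝ f y‖ ≤ c * ‖x - y‖ ^ β) :
    Differentiable ℝ (fun z => e (f (e.symm z))) ∧ ContDiff ℝ 1 (fun z => e (f (e.symm z))) ∧
    ∃ c', 0 ≤ c' ∧ ∀ x y, ‖fderiv ℝ (fun z => e (f (e.symm z))) x - fderiv ℝ (fun z => e (f (e.symm z))) y‖ ≤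
      c' * ‖x - y‖ ^ β := by
  have hd : Differentiable ℝ (fun z => e (f (e.symm z))) := fun z => (cj_deriv e (hf _)).differentiableAt
  have hh := fun x y => cj_diff e (x := x) (y := y) (hf _) (hf _) (abs_nonneg c) hβ.le
    ((h (e.symm x) (e.symm y)).trans (mul_le_mul_of_nonneg_right (le_abs_self c) (by positivity)))
  exact ⟨hd, contDiff_one_iff_fderiv.2 ⟨hd, cont_of_holder hβ hh⟩, _, by positivity, hh⟩

theorem outer {p : ℕ} {V : Fin p → Type} [∀ b, NormedAddCommGroup (V b)] [∀ b, NormedSpace ℝ (V b)]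
    [∀ b, FiniteDimensional ℝ (V b)] [∀ b, HasContDiffBump (V b)]
    {Ω : Type*} [MeasurableSpace Ω] [∀ b, MeasurableSpace (V b)] [∀ b, BorelSpace (V b)]
    {E1 : Type*} [NormedAddCommGroup E1] [NormedSpace ℝ E1] [MeasurableSpace E1] [BorelSpace E1]
    {θ : Equiv.Perm Ω} {B : ℤ → Ω → ∀ b, V b →L[ℝ] V b} {Q : Ω → ℝ}
    {lam : Fin p → ℝ} {ε0 η β γ Λb : ℝ} {dir : Fin p → Fin p → Fin p → Bool}
    (e : E1 ≃L[ℝ] (∀ b, V b)) {f Λ : Ω → E1 → E1} {ρ : Ω → ℝ}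
    (hp : 1 ≤ p) (hB0 : ∀ ω b, B 0 ω b = ContinuousLinearMap.id ℝ (V b))
    (hBadd : ∀ m n ω b, B (m + n) ω b = (B m ((θ ^ n) ω) b).comp (B n ω b))
    (hBb : ∀ n ω b v, ‖B n ω b v‖ ≤ Q ω * Real.exp (lam b * n + ε0 * |(n : ℝ)|) * ‖v‖)
    (hQ1 : ∀ ω, 1 ≤ Q ω) (hQs : ∀ (n : ℤ) ω, Q ((θ ^ n) ω) ≤ Real.exp (ε0 * |(n : ℝ)|) * Q ω)
    (hQm : Measurable Q)
    (hε0 : 0 < ε0) (anti : StrictAnti lam) (η0 : 0 ≤ η) (η1 : η < 1) (hΛ0 : 0 ≤ Λb)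
    (hΛ : ∀ b, |lam b| ≤ Λb) (β0 : 0 < β) (β1 : β ≤ 1) (βη : β ≤ η) (βΛ : β * Λb ≤ 6 * ε0)
    (γε : 16 * (6 * ε0) ≤ γ)
    (fw : ∀ i κ, i ≤ κ → ∀ j, dir i κ j = true → ∀ b ∈ Finset.Icc i κ,
      sw lam η i κ b * lam i + tw lam η i κ b * lam κ + lam b - lam j ≤ -γ)
    (bw : ∀ i κ, i ≤ κ → ∀ j, dir i κ j = false → ∀ b ∈ Finset.Icc i κ,
      γ ≤ sw lam η i κ b * lam i + tw lam η i κ b * lam κ + lam b - lam j)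
    (hθ : ∀ m : ℤ, Measurable (θ ^ m : Equiv.Perm Ω))
    (hBm : ∀ n b v, Measurable fun ω => B n ω b v)
    (hB1 : ∀ ω x, dg (B 1 ω) (e x) = e (Λ ω x))
    (hρpos : ∀ ω, 0 < ρ ω) (hQρ : ∀ ω, (Q ω)⁻¹ ≤ ρ ω)
    (hf0 : ∀ ω, f ω 0 = 0) (hfm : ∀ x, Measurable fun ω => f ω x)
    (hfd : ∀ ω, ∀ x ∈ ball (0 : E1) (ρ ω), DifferentiableAt ℝ (f ω) x)
    (hf1 : ∀ ω, fderiv ℝ (f ω) 0 = 0)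
    (hfl : ∀ ω, ∀ x ∈ ball (0 : E1) (ρ ω), ∀ y ∈ ball (0 : E1) (ρ ω),
      ‖fderiv ℝ (f ω) x - fderiv ℝ (f ω) y‖ ≤ Q ω * ‖x - y‖) :
    ∃ (Φ Ψ : Ω → E1 → E1) (r2 : ℝ), 0 < r2 ∧ r2 ≤ 1 ∧ (∀ ω x, Ψ ω (Φ ω x) = x) ∧
      (∀ ω, Differentiable ℝ (Φ ω)) ∧ (∀ ω, ContDiff ℝ 1 (Φ ω)) ∧ (∀ ω, ContDiff ℝ 1 (Ψ ω)) ∧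
      (∀ ω, ∃ C : ℝ, (∀ x y, ‖fderiv ℝ (Φ ω) x - fderiv ℝ (Φ ω) y‖ ≤ C * ‖x - y‖ ^ β) ∧
        (∀ x y, ‖fderiv ℝ (Ψ ω) x - fderiv ℝ (Ψ ω) y‖ ≤ C * ‖x - y‖ ^ β)) ∧
      (∀ x, Measurable fun ω => Φ ω x) ∧ (∀ ω, Φ ω 0 = 0) ∧
      (∀ ω, fderiv ℝ (Φ ω) 0 = ContinuousLinearMap.id ℝ E1) ∧
      (∀ ω x, ‖x‖ ≤ r2 * (Q ω ^ 6)⁻¹ → Φ (θ ω) (Λ ω x + f ω x) = Λ ω (Φ ω x)) := by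
  have hQp : ∀ ω, 0 < Q ω := fun ω => by linarith [hQ1 ω]
  set N : ℝ := ‖(e.symm : (∀ b, V b) →L[ℝ] E1)‖ with hN
  have hN0 : 0 ≤ N := ContinuousLinearMap.opNorm_nonneg (e.symm : (∀ b, V b) →L[ℝ] E1)
  have hin : ∀ ω, ∀ z ∈ closedBall (0 : ∀ b, V b) (1 / (N + 1) * (Q ω)⁻¹), e.symm z ∈ ball (0 : E1) (ρ ω) := by
    intro ω z hz
    rw [mem_closedBall_zero_iff] at hz
    rw [mem_ball_zero_iff]
    refine lt_of_lt_of_le ?_ (hQρ ω)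
    have h1 : ‖e.symm z‖ ≤ N * ‖z‖ := (e.symm : (∀ b, V b) →L[ℝ] E1).le_opNorm z
    have h2 := mul_le_mul_of_nonneg_left hz hN0
    have h3 : N * (1 / (N + 1)) < 1 := by
      rw [mul_one_div, div_lt_one (by positivity)]; linarith
    have h4 := mul_lt_mul_of_pos_right h3 (inv_pos.2 (hQp ω))
    linarith
  obtain ⟨H, hH⟩ : ∃ H : Ω → (∀ b, V b) → (∀ b, V b), H = fun ω z => e (f ω (e.symm z)) := ⟨_, rfl⟩
  set C2 : ℝ := ‖(e : E1 →L[ℝ] (∀ b, V b))‖ * N * N + 1 with hC2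
  obtain ⟨Φ, Ψ, r1, hr1, hΨΦ, hΦΨ, hΦd, hΨd, hΦ0, hdΦ0, hΦh, hΦm, hconj⟩ :=
    RB.scaled (V := fun b => V b) (θ := θ) (B := B) (Q := Q) (lam := lam) (ε0 := ε0) (η := η) (β := β) (γ := γ)
      (Λ := Λb) (dir := dir) (H := H) hp hB0 hBadd (fun n ω b => ContinuousLinearMap.opNorm_le_bound _ (by have := hQp ω; positivity) (hBb n ω b))
      hQ1 hQs hQm hε0 anti η0 η1 hΛ0 hΛ β0 β1 βη βΛ γε fw bw hθ hBm (c1 := 1 / (N + 1)) (C2 := C2)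
      (by positivity) (by positivity)
      (by
        intro ω z hz
        rw [hH]
        exact (RB.cj_deriv e (hfd ω _ (hin ω z hz))).differentiableAt)
      (by intro ω; rw [hH]; simp [hf0])
      (by
        intro ω
        rw [hH]
        have h1 := hfd ω (e.symm 0) (by rw [map_zero]; exact mem_ball_self (hρpos ω))
        refine (RB.cj_deriv e h1).fderiv.trans ?_
        rw [map_zero, hf1, ContinuousLinearMap.zero_comp, ContinuousLinearMap.comp_zero])
      (by
        intro ω x hx y hy
        have hx' := hin ω x hx
        have hy' := hin ω y hy
        rw [hH]
        have := RB.cj_diff e (hfd ω _ hx') (hfd ω _ hy') (c := Q ω) (β := 1)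
          (hQp ω).le zero_le_one (by
            rw [Real.rpow_one]
            exact hfl ω _ hx' _ hy')
        refine this.trans ?_
        rw [Real.rpow_one, Real.rpow_one, ← hN]
        refine mul_le_mul_of_nonneg_right ?_ (norm_nonneg _)
        rw [hC2]
        have := hQp ω
        linarith)
      (by
        intro x
        rw [hH]
        exact e.continuous.measurable.comp (hfm _))
  set N' : ℝ := ‖(e : E1 →L[ℝ] (∀ b, V b))‖ with hN'
  have hN'0 : 0 ≤ N' := ContinuousLinearMap.opNorm_nonneg (e : E1 →L[ℝ] (∀ b, V b))
  obtain ⟨r2, hr2⟩ : ∃ r2 : ℝ, r2 = min 1 (r1 / (N' + 1)) := ⟨_, rfl⟩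
  have hr20 : 0 < r2 := by rw [hr2]; exact lt_min one_pos (by positivity)
  have hr2N : N' * r2 ≤ r1 := by
    have h1 : r2 ≤ r1 / (N' + 1) := by rw [hr2]; exact min_le_right _ _
    rw [le_div_iff₀ (by positivity)] at h1
    linarith
  have pk := fun ω => (hΦh ω).elim fun c hc => RB.cj_pack e.symm (hΦd ω) β0 hc.1
  have pk' := fun ω => (hΦh ω).elim fun c hc => RB.cj_pack e.symm (hΨd ω) β0 hc.2
  refine ⟨fun ω y => e.symm (Φ ω (e.symm.symm y)), fun ω y => e.symm (Ψ ω (e.symm.symm y)), r2, hr20,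
    by rw [hr2]; exact min_le_left _ _, ?_, fun ω => (pk ω).1, fun ω => (pk ω).2.1, fun ω => (pk' ω).2.1, ?_,
    fun x => e.symm.continuous.measurable.comp (hΦm _), ?_, ?_, ?_⟩
  · intro ω x
    simp only [e.symm.symm_apply_apply, hΨΦ, e.symm.apply_symm_apply]
  · intro ω
    obtain ⟨-, -, C, hC0, hC⟩ := pk ω
    obtain ⟨-, -, D, hD0, hD⟩ := pk' ω
    refine ⟨C + D, fun x y => ?_, fun x y => ?_⟩
    · exact (hC x y).trans (mul_le_mul_of_nonneg_right (by linarith) (by positivity))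
    · exact (hD x y).trans (mul_le_mul_of_nonneg_right (by linarith) (by positivity))
  · intro ω
    simp only [map_zero, hΦ0]
  · intro ω
    rw [(RB.cj_deriv e.symm (hΦd ω _)).fderiv, map_zero, hdΦ0]
    ext v : 1
    exact e.symm.apply_symm_apply v
  · intro ω x hx
    have h1 : ‖e x‖ ≤ r1 * (Q ω ^ 6)⁻¹ := by
      have h1 : ‖e x‖ ≤ N' * ‖x‖ := (e : E1 →L[ℝ] (∀ b, V b)).le_opNorm x
      have h2 := mul_le_mul_of_nonneg_left hx hN'0
      have h3 := mul_le_mul_of_nonneg_right hr2N (inv_pos.2 (pow_pos (hQp ω) 6)).le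
      linarith
    have h2 := hconj ω (e x) h1
    have h3 : RB.dg (B 1 ω) (e x) + H ω (e x) = e (Λ ω x + f ω x) := by
      rw [hB1, hH]
      simp only [e.symm_apply_apply]
      rw [← map_add]
    rw [h3] at h2
    change e.symm (Φ (θ ω) (e (Λ ω x + f ω x))) = Λ ω (e.symm (Φ ω (e x)))
    rw [h2, e.symm_apply_eq, ← hB1, e.apply_symm_apply]
end RB

/-- Belitskii-type C^{1,β_α} linearization theorem for tempered C^{2,α}
random dynamical systems whose linear part satisfies the conclusions of the
Multiplicative Ergodic Theorem with Lyapunov exponents obeying the partial second-order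
non-resonance condition λ_j ≠ λ_i + λ_κ. -/
theorem random_belitskii_linearization
    {Ω : Type*} [MeasurableSpace Ω] (P : MeasureTheory.Measure Ω)
    [MeasureTheory.IsProbabilityMeasure P]
    (θ θinv : Ω → Ω) (hθm : Measurable θ) (hθim : Measurable θinv)
    (hli : Function.LeftInverse θinv θ) (hri : Function.RightInverse θinv θ)
    (hpres : MeasureTheory.MeasurePreserving θ P P)
    (θiter : ℤ → Ω → Ω)
    (hiter0 : ∀ ω, θiter 0 ω = ω)
    (hiterS : ∀ (n : ℤ) (ω : Ω), θiter (n + 1) ω = θ (θiter n ω))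
    (d p : ℕ) (hd : 1 ≤ d) (hp : 2 ≤ p)
    (X : Fin p → Submodule ℝ (Ed d)) (hX : DirectSum.IsInternal X) (hXne : ∀ j, X j ≠ ⊥)
    (lam : Fin p → ℝ) (hmono : ∀ i j : Fin p, i < j → lam j < lam i)
    (τ : ℕ) (hτ1 : 1 ≤ τ) (hτp : τ ≤ p - 1)
    (hsign : ∀ j : Fin p, ((j : ℕ) < τ → 0 < lam j) ∧ (τ ≤ (j : ℕ) → lam j < 0))
    (hnonres : ∀ i κ j : Fin p, (i : ℕ) < τ → τ ≤ (κ : ℕ) → lam j ≠ lam i + lam κ)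
    (α : ℝ) (hα : α ∈ Set.Icc (0 : ℝ) 1)
    (ρ : Ω → ℝ) (hρm : Measurable ρ) (hρpos : ∀ ω, 0 < ρ ω)
    (hρtemp : TemperedBelow θiter ρ)
    (F Finv : Ω → Ed d → Ed d)
    (hF0 : ∀ ω, F ω 0 = 0)
    (hFC2 : ∀ ω, ContDiffOn ℝ 2 (F ω) (ball 0 (ρ ω)))
    (hFinj : ∀ ω, Set.InjOn (F ω) (ball 0 (ρ ω)))
    (hFinvC2 : ∀ ω, ContDiffOn ℝ 2 (Finv ω) (F ω '' ball 0 (ρ ω)))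
    (hFinv : ∀ ω, ∀ x ∈ ball (0 : Ed d) (ρ ω), Finv ω (F ω x) = x)
    (hFmeas : ∀ x : Ed d, Measurable fun ω => F ω x)
    (hDFmeas : ∀ x v : Ed d, Measurable fun ω => fderiv ℝ (F ω) x v)
    (hD2Fmeas : ∀ x v w : Ed d, Measurable fun ω => iteratedFDeriv ℝ 2 (F ω) x ![v, w])
    (M L : Ω → ℝ) (hMm : Measurable M) (hLm : Measurable L)
    (hMpos : ∀ ω, 0 < M ω) (hLpos : ∀ ω, 0 < L ω)
    (hMtemp : TemperedAbove θiter M) (hLtemp : TemperedAbove θiter L)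
    (hbF : ∀ ω, ∀ x ∈ ball (0 : Ed d) (ρ ω), ‖F ω x‖ ≤ M ω)
    (hbDF : ∀ ω, ∀ x ∈ ball (0 : Ed d) (ρ ω), ‖fderiv ℝ (F ω) x‖ ≤ M ω)
    (hbD2F : ∀ ω, ∀ x ∈ ball (0 : Ed d) (ρ ω), ‖iteratedFDeriv ℝ 2 (F ω) x‖ ≤ M ω)
    (hHolder : ∀ ω, ∀ x ∈ ball (0 : Ed d) (ρ ω), ∀ y ∈ ball (0 : Ed d) (ρ ω),
      ‖iteratedFDeriv ℝ 2 (F ω) x - iteratedFDeriv ℝ 2 (F ω) y‖ ≤ L ω * ‖x - y‖ ^ α)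
    (hequi : α = 0 → ∀ ω : Ω, ∀ ε : ℝ, 0 < ε → ∀ η : ℝ, 0 < η → ∃ γ : ℝ, 0 < γ ∧
      ∀ n : ℤ, ∀ x ∈ ball (0 : Ed d) (ρ (θiter n ω)), ∀ y ∈ ball (0 : Ed d) (ρ (θiter n ω)),
        ‖x - y‖ < γ →
        Real.exp (-(ε * |(n : ℝ)|)) *
          ‖iteratedFDeriv ℝ 2 (F (θiter n ω)) x - iteratedFDeriv ℝ 2 (F (θiter n ω)) y‖ < η)
    (Λ : Ω → (Ed d ≃L[ℝ] Ed d))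
    (hΛ : ∀ ω, (Λ ω : Ed d →L[ℝ] Ed d) = fderiv ℝ (F ω) 0)
    (hΛX : ∀ (ω : Ω) (j : Fin p), (X j).map (Λ ω : Ed d →ₗ[ℝ] Ed d) = X j)
    (Λc : ℤ → Ω → (Ed d ≃L[ℝ] Ed d))
    (hΛc0 : ∀ ω, Λc 0 ω = ContinuousLinearEquiv.refl ℝ (Ed d))
    (hΛcS : ∀ (n : ℤ) (ω : Ω), Λc (n + 1) ω = (Λc n ω).trans (Λ (θiter n ω)))
    (hMET : ∀ ε : ℝ, 0 < ε → ∃ K : Ω → ℝ, Measurable K ∧ TemperedAbove θiter K ∧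
      (∀ ω, 1 ≤ K ω) ∧
      ∀ (ω : Ω) (j : Fin p) (n : ℤ), ∀ x ∈ X j,
        (n < 0 → ‖Λc n ω x‖ ≤ K ω * Real.exp ((lam j - ε) * n) * ‖x‖) ∧
        (0 ≤ n → ‖Λc n ω x‖ ≤ K ω * Real.exp ((lam j + ε) * n) * ‖x‖)) :
    ∃ β : ℝ, ((α = 0 → β = 0) ∧ (0 < α → 0 < β ∧ β ≤ α)) ∧
    ∃ ρU : Ω → ℝ, Measurable ρU ∧ TemperedBelow θiter ρU ∧
      (∀ ω, 0 < ρU ω ∧ ρU ω ≤ ρ ω) ∧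
    ∃ Φ Ψ : Ω → Ed d → Ed d,
      (∀ x : Ed d, Measurable fun ω => Φ ω x) ∧
      (∀ x v : Ed d, Measurable fun ω => fderiv ℝ (Φ ω) x v) ∧
      ∀ ω : Ω,
        Set.InjOn (Φ ω) (ball 0 (ρU ω)) ∧
        ContDiffOn ℝ 1 (Φ ω) (ball 0 (ρU ω)) ∧
        ContDiffOn ℝ 1 (Ψ ω) (Φ ω '' ball 0 (ρU ω)) ∧
        (∀ x ∈ ball (0 : Ed d) (ρU ω), Ψ ω (Φ ω x) = x) ∧
        (0 < α → ∃ C : ℝ,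
          (∀ x ∈ ball (0 : Ed d) (ρU ω), ∀ y ∈ ball (0 : Ed d) (ρU ω),
            ‖fderiv ℝ (Φ ω) x - fderiv ℝ (Φ ω) y‖ ≤ C * ‖x - y‖ ^ β) ∧
          (∀ x ∈ Φ ω '' ball 0 (ρU ω), ∀ y ∈ Φ ω '' ball 0 (ρU ω),
            ‖fderiv ℝ (Ψ ω) x - fderiv ℝ (Ψ ω) y‖ ≤ C * ‖x - y‖ ^ β)) ∧
        Φ ω 0 = 0 ∧
        fderiv ℝ (Φ ω) 0 = ContinuousLinearMap.id ℝ (Ed d) ∧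
        ∀ x ∈ ball (0 : Ed d) (ρU ω), Φ (θ ω) (F ω x) = Λ ω (Φ ω x) := by
  obtain ⟨θ', hθ', hθi⟩ : ∃ θ' : Equiv.Perm Ω, (θ' : Ω → Ω) = θ ∧ (θ'.symm : Ω → Ω) = θinv :=
    ⟨⟨θ, θinv, hli, hri⟩, rfl, rfl⟩
  subst hθ'
  subst hθi
  have hθ := RB.perm_meas hθm hθim
  obtain rfl : θiter = fun n ω => (θ' ^ n) ω := funext fun n => RB.iter_eq hiter0 hiterS n
  simp only at hΛcS
  have hΛm : ∀ v, Measurable fun ω => Λ ω v := by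
    intro v
    have : ∀ ω, Λ ω v = fderiv ℝ (F ω) 0 v := fun ω => by rw [← hΛ]; rfl
    simp only [this]
    exact hDFmeas 0 v
  obtain ⟨e, he⟩ := RB.exists_dec hX
  obtain ⟨B, hB0, hBadd, hBc, hBm, hB1⟩ := RB.exists_coc e he hθ Λ hΛm hΛX Λc hΛc0 hΛcS
  have anti : StrictAnti lam := fun i j h => hmono i j h
  set Λb : ℝ := 1 + ∑ b, |lam b| with hΛb
  have hΛb0 : 0 < Λb := by positivity
  have hΛb1 : ∀ b, |lam b| ≤ Λb := fun b => by
    have := Finset.single_le_sum (f := fun b => |lam b|) (fun i _ => abs_nonneg _) (Finset.mem_univ b)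
    linarith
  obtain ⟨η, γ, dir, η0, η1, hγ, fw, bw⟩ := RB.nonres anti τ hsign hnonres hΛb0 hΛb1
  obtain ⟨ε0, hε0⟩ : ∃ ε0, ε0 = γ / 96 := ⟨_, rfl⟩
  have hepsPos : 0 < ε0 := by rw [hε0]; positivity
  obtain ⟨β, β0, βη, βΛ, βα⟩ : ∃ β : ℝ, 0 < β ∧ β ≤ η ∧ β * Λb ≤ 6 * ε0 ∧ (0 < α → β ≤ α) := by
    refine ⟨min (min η (6 * ε0 / Λb)) (if 0 < α then α else 1), ?_, ?_, ?_, ?_⟩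
    · refine lt_min (lt_min η0 (by positivity)) ?_
      split_ifs with h
      · exact h
      · exact one_pos
    · exact (min_le_left _ _).trans (min_le_left _ _)
    · rw [← le_div_iff₀ hΛb0]
      exact (min_le_left _ _).trans (min_le_right _ _)
    · intro h
      refine (min_le_right _ _).trans ?_
      rw [if_pos h]
  obtain ⟨K, hKm, hKt, hK1, hK⟩ := hMET ε0 hepsPos
  have hK0 : ∀ ω, 0 < K ω := fun ω => by linarith [hK1 ω]
  have hρi : ∀ ω, 0 < (ρ ω)⁻¹ := fun ω => inv_pos.2 (hρpos ω)
  obtain ⟨Q, hQm, hQ0, hQt, hQs⟩ := RB.envelope hθ (Q0 := fun ω => K ω + M ω + (ρ ω)⁻¹)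
    ((hKm.add hMm).add hρm.inv) (fun ω => by linarith [hK1 ω, hMpos ω, hρi ω])
    (((RB.Tm_of_above hKt hK0).add (RB.Tm_of_above hMtemp hMpos)).add
      (RB.Tm_of_above (RB.below_iff_inv.1 hρtemp) hρi)) hepsPos
  have hQ1 : ∀ ω, 1 ≤ Q ω := fun ω => by linarith [hK1 ω, hMpos ω, hρi ω, hQ0 ω]
  have hQK : ∀ ω, K ω ≤ Q ω := fun ω => by linarith [hMpos ω, hρi ω, hQ0 ω]
  have hQM : ∀ ω, M ω ≤ Q ω := fun ω => by linarith [hK1 ω, hρi ω, hQ0 ω]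
  have hQp : ∀ ω, 0 < Q ω := fun ω => by linarith [hQ1 ω]
  have hQρ : ∀ ω, (Q ω)⁻¹ ≤ ρ ω := fun ω => by
    rw [inv_le_comm₀ (hQp ω) (hρpos ω)]
    linarith [hK1 ω, hMpos ω, hQ0 ω]
  have hBb : ∀ (n : ℤ) ω b (v : X b), ‖B n ω b v‖ ≤ Q ω * Real.exp (lam b * n + ε0 * |(n : ℝ)|) * ‖v‖ := by
    intro n ω b v
    have h1 : ‖B n ω b v‖ = ‖Λc n ω v‖ := by rw [← hBc]; rfl
    have h2 : ‖Λc n ω v‖ ≤ K ω * Real.exp (lam b * n + ε0 * |(n : ℝ)|) * ‖(v : Ed d)‖ := by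
      rcases lt_or_ge n 0 with h | h
      · have h3 := (hK ω b n v v.2).1 h
        have h4 : ((n : ℤ) : ℝ) < 0 := by exact_mod_cast h
        rw [abs_of_neg h4]
        convert h3 using 4; ring
      · have h3 := (hK ω b n v v.2).2 h
        have h4 : (0:ℝ) ≤ ((n : ℤ) : ℝ) := by exact_mod_cast h
        rw [abs_of_nonneg h4]
        convert h3 using 4; ring
    rw [h1]
    refine h2.trans ?_
    exact mul_le_mul_of_nonneg_right (mul_le_mul_of_nonneg_right (hQK ω) (Real.exp_pos _).le) (norm_nonneg _)
  -- the nonlinear part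
  obtain ⟨f, hf⟩ : ∃ f : Ω → Ed d → Ed d, f = fun ω x => F ω x - Λ ω x := ⟨_, rfl⟩
  have hlip := fun ω => RB.lip_of_d2 (hFC2 ω) (hbD2F ω)
  have hfd : ∀ ω, ∀ x ∈ ball (0 : Ed d) (ρ ω), HasFDerivAt (f ω) (fderiv ℝ (F ω) x - (Λ ω : Ed d →L[ℝ] Ed d)) x := by
    intro ω x hx
    rw [hf]
    exact ((hlip ω).1 x hx).hasFDerivAt.sub (Λ ω : Ed d →L[ℝ] Ed d).hasFDerivAt
  obtain ⟨Φ, Ψ, r2, hr20, hr21, hΨΦ, hΦd, hΦ1, hΨ1, hΦh, hΦm, hΦ0, hdΦ0, hconj⟩ :=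
    RB.outer (V := fun b => X b) (θ := θ') (B := B) (Q := Q) (lam := lam) (ε0 := ε0) (η := η) (β := β) (γ := γ)
      (Λb := Λb) (dir := dir) e (f := f) (Λ := fun ω x => Λ ω x) (ρ := ρ) (by omega) hB0 hBadd hBb hQ1 hQs hQm
      hepsPos anti η0.le η1 hΛb0.le hΛb1
      β0 (by linarith) βη βΛ (by rw [hε0]; linarith) fw bw hθ hBm hB1 hρpos hQρ
      (by intro ω; rw [hf]; simp [hF0])
      (by intro x; rw [hf]; exact (hFmeas _).sub (hΛm _))
      (fun ω x hx => (hfd ω x hx).differentiableAt)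
      (by intro ω; rw [(hfd ω 0 (mem_ball_self (hρpos ω))).fderiv, hΛ, sub_self])
      (by
        intro ω x hx y hy
        rw [(hfd ω _ hx).fderiv, (hfd ω _ hy).fderiv, sub_sub_sub_cancel_right]
        exact ((hlip ω).2 _ hx _ hy).trans (mul_le_mul_of_nonneg_right (hQM ω) (norm_nonneg _)))
  have hρU : ∀ ω, r2 * (Q ω ^ 6)⁻¹ ≤ ρ ω := by
    intro ω
    refine le_trans ?_ (hQρ ω)
    have h1 : (Q ω ^ 6)⁻¹ ≤ (Q ω)⁻¹ := by
      apply inv_anti₀ (hQp ω)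
      exact le_self_pow₀ (hQ1 ω) (by norm_num)
    have h2 := hr21
    have h3 := inv_pos.2 (pow_pos (hQp ω) 6)
    have h4 := mul_le_mul_of_nonneg_right h2 h3.le
    linarith
  refine ⟨if α = 0 then 0 else β, ⟨fun h => if_pos h, fun h => ?_⟩, fun ω => r2 * (Q ω ^ 6)⁻¹,
    (hQm.pow_const 6).inv.const_mul r2, ?_, fun ω => ⟨by have := hQp ω; positivity, hρU ω⟩,
    Φ, Ψ, hΦm, RB.meas_fderiv hΦd hΦm, fun ω => ?_⟩
  · rw [if_neg h.ne']; exact ⟨β0, βα h⟩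
  · rw [RB.below_iff_inv]
    have h1 : (fun ω => (r2 * (Q ω ^ 6)⁻¹)⁻¹) = fun ω => r2⁻¹ * Q ω ^ 6 := by
      funext ω; rw [mul_inv, inv_inv]
    rw [h1]
    exact RB.above_of_Tm (hQt.pow hQp r2⁻¹ (inv_pos.2 hr20) 6) fun ω => by have := hQp ω; positivity
  · obtain ⟨C, hC, hD⟩ := hΦh ω
    refine ⟨fun x _ y _ h => ?_, (hΦ1 ω).contDiffOn, (hΨ1 ω).contDiffOn, fun x _ => hΨΦ ω x,
      fun hα0 => ⟨C, ?_, ?_⟩, hΦ0 ω, hdΦ0 ω, ?_⟩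
    · rw [← hΨΦ ω x, ← hΨΦ ω y, h]
    · intro x _ y _
      rw [if_neg hα0.ne']
      exact hC x y
    · intro x _ y _
      rw [if_neg hα0.ne']
      exact hD x y
    · intro x hx
      rw [mem_ball_zero_iff] at hx
      have h2 := hconj ω x hx.le
      have h3 : Λ ω x + f ω x = F ω x := by rw [hf]; simp
      rwa [h3] at h2
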